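/- Let (f,ξ) be a classical solution of the Vlasov–Poisson system with point charge on [0,T] with M₀ = ∬ f₀ dx dv < 1, with the cutoff decomposition and backward flow (X,V) associated with a fixed t ∈ [0,T]. Then for all 3 ≤ m < m₀, ‖E(t)‖_{L^{m+3}(ℝ³)} ≤ C (1+T)^{max(2, 3m/(3+m))} + C ‖ ∫₀ᵗ s ∫_{ℝ³} (|E_int + F_int| f)(t−s, X(s,·,v), V(s,·,v)) dv ds ‖_{L^{m+3}(ℝ³)}, where C depends only on m, 𝓗(0), M₀, ‖f₀‖_{L∞}, (1−M₀)⁻¹ and the initial moments H_k(0) for k < m₀ (and not on T). -/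

import Mathlib

open MeasureTheory Set Filter
open scoped ENNReal

noncomputable section

/-- Three-dimensional Euclidean space. -/
abbrev E3 : Type := EuclideanSpace ℝ (Fin 3)

/-- Spatial density `ρ(t,x) = ∫ f(t,x,v) dv`. -/
def rho (f : ℝ → E3 → E3 → ℝ) (t : ℝ) (x : E3) : ℝ := ∫ v : E3, f t x v

/-- Self-induced electric field `E(t,x) = ∫ (x-y)/|x-y|³ ρ(t,y) dy`. -/
def Efield (f : ℝ → E3 → E3 → ℝ) (t : ℝ) (x : E3) : E3 :=
  ∫ y : E3, (rho f t y / ‖x - y‖ ^ 3) • (x - y)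

/-- Singular field generated by the point charge located at `ξ t`:
`F(t,x) = (x-ξ(t))/|x-ξ(t)|³`. -/
def Fpt (ξ : ℝ → E3) (t : ℝ) (x : E3) : E3 := (‖x - ξ t‖ ^ 3)⁻¹ • (x - ξ t)

/-- Total mass `M(t) = ∬ f(t,x,v) dx dv`. -/
def mass (f : ℝ → E3 → E3 → ℝ) (t : ℝ) : ℝ := ∫ p : E3 × E3, f t p.1 p.2

/-- Total energy `𝓗(t)`. -/
def energy (f : ℝ → E3 → E3 → ℝ) (ξ η : ℝ → E3) (t : ℝ) : ℝ :=
    (1 / 2) * ∫ p : E3 × E3, ‖p.2‖ ^ 2 * f t p.1 p.2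
  + (1 / 2) * ‖η t‖ ^ 2
  + (1 / 2) * ∫ x : E3, ∫ y : E3, rho f t x * rho f t y / ‖x - y‖
  + ∫ x : E3, rho f t x / ‖x - ξ t‖

/-- `L^∞` norm of the initial datum `‖f₀‖_{L^∞}`. -/
def supf0 (f : ℝ → E3 → E3 → ℝ) : ℝ :=
  (eLpNorm (fun p : E3 × E3 => f 0 p.1 p.2) ⊤ volume).toReal

/-- A classical solution of the Vlasov–Poisson system with point charge on `[0,T]`:
`f` is a nonnegative `C¹` compactly supported density whose initial datum vanishes
in a neighborhood of the charge `ξ 0`, `ξ ∈ C²` with `ξ' = η`, `η' = E(t,ξ(t))`,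
and the Vlasov equation holds pointwise (away from the charge). -/
structure VPClassicalSolution (T : ℝ) where
  f : ℝ → E3 → E3 → ℝ
  ξ : ℝ → E3
  η : ℝ → E3
  T_pos : 0 < T
  f_nonneg : ∀ t x v, 0 ≤ f t x v
  f_c1 : ContDiff ℝ 1 (fun p : ℝ × E3 × E3 => f p.1 p.2.1 p.2.2)
  f_cpt : HasCompactSupport (fun p : ℝ × E3 × E3 => f p.1 p.2.1 p.2.2)
  f0_vanishes_near_charge : ∃ ε > 0, ∀ x v, ‖x - ξ 0‖ < ε → f 0 x v = 0
  ξ_c2 : ContDiff ℝ 2 ξ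
  ξ_ode : ∀ t, HasDerivAt ξ (η t) t
  η_ode : ∀ t ∈ Icc (0 : ℝ) T, HasDerivAt η (Efield f t (ξ t)) t
  vlasov : ∀ t ∈ Icc (0 : ℝ) T, ∀ x v, x ≠ ξ t →
      deriv (fun τ : ℝ => f τ x v) t
      + fderiv ℝ (fun y : E3 => f t y v) x v
      + fderiv ℝ (fun w : E3 => f t x w) v (Efield f t x + Fpt ξ t x) = 0

/-- The microscopic energy function
`h(t,x,v) = |v-η(t)|²/2 + 1/|x-ξ(t)| + 𝓗(0) + M₀⁻¹ + 1`. -/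
def hEnergy (f : ℝ → E3 → E3 → ℝ) (ξ η : ℝ → E3) (t : ℝ) (x v : E3) : ℝ :=
  ‖v - η t‖ ^ 2 / 2 + ‖x - ξ t‖⁻¹ + energy f ξ η 0 + (mass f 0)⁻¹ + 1

/-- The energy moment `H̃_k(t) = ∬ h(t,x,v)^{k/2} f(t,x,v) dx dv`. -/
def Htilde (f : ℝ → E3 → E3 → ℝ) (ξ η : ℝ → E3) (k t : ℝ) : ℝ :=
  ∫ p : E3 × E3, hEnergy f ξ η t p.1 p.2 ^ (k / 2) * f t p.1 p.2

/-- The running supremum of the energy moments `H_k(t) = sup_{0≤s≤t} H̃_k(s)`. -/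
def Hmom (f : ℝ → E3 → E3 → ℝ) (ξ η : ℝ → E3) (k t : ℝ) : ℝ :=
  sSup (Htilde f ξ η k '' Icc 0 t)

/-- Data of a smooth cutoff function `χ₀` together with the constant `K₀ ≥ 100`. -/
structure CutoffData where
  χ : E3 → ℝ
  K0 : ℝ
  K0_ge : 100 ≤ K0
  smooth : ContDiff ℝ (⊤ : ℕ∞) χ
  mem_Icc : ∀ z, χ z ∈ Icc (0 : ℝ) 1
  eq_one : ∀ z, ‖z‖ ≤ 1 → χ z = 1
  eq_zero : ∀ z, 2 ≤ ‖z‖ → χ z = 0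
  grad_le : ∀ z, ‖fderiv ℝ χ z‖ ≤ 2
  hess_le : ∀ z, ‖fderiv ℝ (fderiv ℝ χ) z‖ ≤ 20

/-- The cutoff radius `R = (24 K₀ (1+‖f₀‖_{L¹}))^{1/3} (1+T)`. -/
def Rcut (T : ℝ) (f : ℝ → E3 → E3 → ℝ) (K0 : ℝ) : ℝ :=
  (24 * K0 * (1 + mass f 0)) ^ ((1 : ℝ) / 3) * (1 + T)

/-- The rescaled cutoff `χ_R(z) = χ₀(z/R)`. -/
def chiR (T : ℝ) (f : ℝ → E3 → E3 → ℝ) (c : CutoffData) (z : E3) : ℝ :=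
  c.χ ((Rcut T f c.K0)⁻¹ • z)

/-- Internal part of the self-induced field: `E_int = ρ ∗ (χ_R(x) x/|x|³)`. -/
def Eint (T : ℝ) (f : ℝ → E3 → E3 → ℝ) (c : CutoffData) (t : ℝ) (x : E3) : E3 :=
  ∫ y : E3, (chiR T f c (x - y) * rho f t y / ‖x - y‖ ^ 3) • (x - y)

/-- Internal part of the point-charge field: `F_int(t,x) = F(t,x) χ_R(x-ξ(t))`. -/
def Fint (T : ℝ) (f : ℝ → E3 → E3 → ℝ) (ξ : ℝ → E3) (c : CutoffData) (t : ℝ) (x : E3) : E3 :=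
  chiR T f c (x - ξ t) • Fpt ξ t x

/-- External part of the self-induced field. -/
def Eext (T : ℝ) (f : ℝ → E3 → E3 → ℝ) (c : CutoffData) (t : ℝ) (x : E3) : E3 :=
  Efield f t x - Eint T f c t x

/-- External part of the point-charge field. -/
def Fext (T : ℝ) (f : ℝ → E3 → E3 → ℝ) (ξ : ℝ → E3) (c : CutoffData) (t : ℝ) (x : E3) : E3 :=
  Fpt ξ t x - Fint T f ξ c t x

/-- The backward flow of the field `E_ext + F_ext` associated with the time `t`:
`dX/ds = -V`, `dV/ds = -(E_ext+F_ext)(t-s, X)`, `(X,V)(0,x,v) = (x,v)`. -/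
structure BackwardFlow (T : ℝ) (S : VPClassicalSolution T) (c : CutoffData) (t : ℝ) where
  X : ℝ → E3 → E3 → E3
  V : ℝ → E3 → E3 → E3
  init_X : ∀ x v, X 0 x v = x
  init_V : ∀ x v, V 0 x v = v
  ode_X : ∀ x v, ∀ s ∈ Icc (0 : ℝ) t, HasDerivAt (fun s => X s x v) (-(V s x v)) s
  ode_V : ∀ x v, ∀ s ∈ Icc (0 : ℝ) t, HasDerivAt (fun s => V s x v)
      (-(Eext T S.f c (t - s) (X s x v) + Fext T S.f S.ξ c (t - s) (X s x v))) s

/-- The Duhamel term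
`x ↦ ∫₀ᵗ s ∫ (|E_int + F_int| f)(t-s, X(s,x,v), V(s,x,v)) dv ds`. -/
def Dterm (T : ℝ) (S : VPClassicalSolution T) (c : CutoffData) (t : ℝ)
    (Φ : BackwardFlow T S c t) (x : E3) : ℝ :=
  ∫ s in (0 : ℝ)..t, s * ∫ v : E3,
    ‖Eint T S.f c (t - s) (Φ.X s x v) + Fint T S.f S.ξ c (t - s) (Φ.X s x v)‖
      * S.f (t - s) (Φ.X s x v) (Φ.V s x v)

section Bellman

variable {F : Type*} [NormedAddCommGroup F] [InnerProductSpace ℝ F]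

/-- Two-uniform smoothness of the `p`-th power of a Hilbert norm. -/
theorem exists_two_smooth {p : ℝ} (hp : 2 ≤ p) : ∃ C : ℝ, 1 ≤ C ∧ ∀ a b : F,
    (‖a + b‖ ^ p + ‖a - b‖ ^ p) / 2 ≤ (‖a‖ ^ 2 + C * ‖b‖ ^ 2) ^ (p / 2) := by
  set r := p / 2 with hr
  have hr1 : 1 ≤ r := by rw [hr]; linarith
  refine ⟨1 + 4 * (r / 2 * Real.exp (r / 2)), by have := Real.exp_pos (r / 2); nlinarith [mul_pos (by linarith : (0:ℝ) < r / 2) this], fun a b => ?_⟩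
  set s := ‖a‖ ^ 2 + ‖b‖ ^ 2 with hs
  have key : ∀ x : F, ‖x‖ ^ p = (‖x‖ ^ 2) ^ r := fun x => by
    rw [← Real.rpow_natCast, ← Real.rpow_mul (norm_nonneg _)]; congr 1; rw [hr]; push_cast; ring
  have h1 : ‖a + b‖ ^ 2 = s + 2 * inner ℝ a b := by rw [norm_add_sq_real]; ring
  have h2 : ‖a - b‖ ^ 2 = s - 2 * inner ℝ a b := by rw [norm_sub_sq_real]; ring
  have hs0 : 0 ≤ s := by positivity
  have hin := abs_real_inner_le_norm a b
  rcases hs0.eq_or_lt with h0 | hpos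
  · have ha : ‖a‖ = 0 := by nlinarith [sq_nonneg ‖a‖, sq_nonneg ‖b‖]
    have hb : ‖b‖ = 0 := by nlinarith [sq_nonneg ‖a‖, sq_nonneg ‖b‖]
    rw [norm_eq_zero] at ha hb
    subst ha hb
    simp only [add_zero, sub_zero, norm_zero]
    rw [Real.zero_rpow (by linarith)]
    norm_num
    positivity
  set τ := 2 * inner ℝ a b / s with hτ
  have ht : 2 * inner ℝ a b = s * τ := by rw [hτ]; field_simp
  have habs : |τ| ≤ 1 := by
    rw [hτ, abs_div, abs_of_pos hpos, div_le_one hpos, abs_mul, abs_two]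
    nlinarith [sq_nonneg (‖a‖ - ‖b‖)]
  obtain ⟨hτ1, hτ2⟩ := abs_le.1 habs
  have hsτ : s * τ ^ 2 ≤ 4 * ‖b‖ ^ 2 := by
    have : s * (s * τ ^ 2) ≤ s * (4 * ‖b‖ ^ 2) := by
      have h3 : (s * τ) ^ 2 ≤ 4 * ‖a‖ ^ 2 * ‖b‖ ^ 2 := by
        rw [← ht]
        nlinarith [sq_le_sq' (abs_le.1 hin).1 (abs_le.1 hin).2]
      nlinarith [sq_nonneg ‖a‖, sq_nonneg ‖b‖, mul_nonneg (sq_nonneg ‖b‖) (sq_nonneg ‖b‖)]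
    exact le_of_mul_le_mul_left this hpos
  have hexp : ∀ x : ℝ, -1 ≤ x → (s * (1 + x)) ^ r ≤ s ^ r * Real.exp (r * x) := fun x hx => by
    rw [Real.mul_rpow hs0 (by linarith), mul_comm r x, Real.exp_mul]
    gcongr
    · linarith
    · linarith [Real.add_one_le_exp x]
  have e1 := hexp τ hτ1
  have e2 := hexp (-τ) (by linarith)
  have hcosh := Real.cosh_le_exp_half_sq (r * τ)
  rw [Real.cosh_eq] at hcosh
  have e3 : (‖a + b‖ ^ p + ‖a - b‖ ^ p) / 2 ≤ s ^ r * Real.exp ((r * τ) ^ 2 / 2) := by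
    rw [key, key, h1, h2, ht]
    have : s - s * τ = s * (1 + -τ) := by ring
    rw [this, show s + s * τ = s * (1 + τ) by ring]
    have hsr : 0 ≤ s ^ r := by positivity
    have := mul_le_mul_of_nonneg_left hcosh hsr
    rw [show r * -τ = -(r * τ) by ring] at e2
    linarith
  refine e3.trans ?_
  have e4 : Real.exp ((r * τ) ^ 2 / 2) = Real.exp (r / 2 * τ ^ 2) ^ r := by
    rw [← Real.exp_mul]; congr 1; ring
  rw [e4, ← Real.mul_rpow hs0 (Real.exp_pos _).le]
  have hy : ∀ y : ℝ, 0 ≤ y → y ≤ r / 2 → Real.exp y ≤ 1 + y * Real.exp (r / 2) := fun y hy0 hy => by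
    have h1 := Real.add_one_le_exp (-y)
    have h2 : Real.exp y * Real.exp (-y) = 1 := by rw [← Real.exp_add]; simp
    have h3 := Real.exp_le_exp.2 hy
    nlinarith [Real.exp_pos y]
  have hτsq : τ ^ 2 ≤ 1 := by nlinarith
  have e5 := hy (r / 2 * τ ^ 2) (by positivity) (by nlinarith)
  apply Real.rpow_le_rpow (by positivity) _ (by linarith)
  have hK : 0 ≤ r / 2 * Real.exp (r / 2) := by positivity
  calc s * Real.exp (r / 2 * τ ^ 2) ≤ s * (1 + r / 2 * τ ^ 2 * Real.exp (r / 2)) := by gcongr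
    _ = s + (s * τ ^ 2) * (r / 2 * Real.exp (r / 2)) := by ring
    _ ≤ s + (4 * ‖b‖ ^ 2) * (r / 2 * Real.exp (r / 2)) := by gcongr
    _ = _ := by rw [hs]; ring

/-- A Burkholder-type function, midpoint concave in directions subordinated to its first argument. -/
def burkholder (p : ℝ) (u a : F) : ℝ :=
  2 * ‖a‖ ^ p - (‖u‖ ^ 2 + ‖a‖ ^ 2) ^ (p / 2)

theorem rpow_midpoint_le {r x y : ℝ} (hr : 1 ≤ r) (hx : 0 ≤ x) (hy : 0 ≤ y) :
    ((x + y) / 2) ^ r ≤ (x ^ r + y ^ r) / 2 := by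
  have := (convexOn_rpow hr).2 hx hy (by norm_num : (0:ℝ) ≤ 1 / 2) (by norm_num : (0:ℝ) ≤ 1 / 2) (by norm_num)
  simp only [smul_eq_mul] at this
  calc ((x + y) / 2) ^ r = (1 / 2 * x + 1 / 2 * y) ^ r := by congr 1; ring
    _ ≤ _ := this
    _ = _ := by ring

theorem rpow_add_sub_rpow_mono {r x y e : ℝ} (hr : 1 ≤ r) (hx : 0 ≤ x) (hxy : x ≤ y) (he : 0 ≤ e) :
    (x + e) ^ r - x ^ r ≤ (y + e) ^ r - y ^ r := by
  rcases (by linarith : 0 ≤ y + e - x).eq_or_lt with h | h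
  · have h1 : x = y := by linarith
    rw [h1]
  set l := (y - x) / (y + e - x) with hl
  have hl0 : 0 ≤ l := div_nonneg (by linarith) h.le
  have hl1 : l ≤ 1 := by rw [hl, div_le_one h]; linarith
  have hle : l * (y + e - x) = y - x := by rw [hl]; field_simp
  have hx' : x ∈ Ici (0:ℝ) := hx
  have hy' : y + e ∈ Ici (0:ℝ) := by simp only [mem_Ici]; linarith
  have c1 := (convexOn_rpow hr).2 hx' hy' hl0 (by linarith : 0 ≤ 1 - l) (by ring)
  have c2 := (convexOn_rpow hr).2 hx' hy' (by linarith : 0 ≤ 1 - l) hl0 (by ring)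
  simp only [smul_eq_mul] at c1 c2
  rw [show l * x + (1 - l) * (y + e) = x + e by linear_combination -hle] at c1
  rw [show (1 - l) * x + l * (y + e) = y by linear_combination hle] at c2
  linarith

theorem exists_burkholder_zigzag {p : ℝ} (hp : 2 ≤ p) : ∃ ε : ℝ, 0 < ε ∧ ∀ u a e b : F,
    ‖b‖ ≤ ε * ‖e‖ →
      (burkholder p (u + e) (a + b) + burkholder p (u - e) (a - b)) / 2 ≤ burkholder p u a := by
  obtain ⟨C, hC1, hC⟩ := exists_two_smooth (F := F) hp
  have hr1 : 1 ≤ p / 2 := by linarith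
  refine ⟨Real.sqrt (1 / (2 * C)), Real.sqrt_pos.2 (by positivity), fun u a e b hb => ?_⟩
  have hb2 : C * ‖b‖ ^ 2 ≤ ‖e‖ ^ 2 / 2 := by
    have : ‖b‖ ^ 2 ≤ (1 / (2 * C)) * ‖e‖ ^ 2 := by
      calc ‖b‖ ^ 2 ≤ (Real.sqrt (1 / (2 * C)) * ‖e‖) ^ 2 := by gcongr
        _ = _ := by rw [mul_pow, Real.sq_sqrt (by positivity)]
    calc C * ‖b‖ ^ 2 ≤ C * ((1 / (2 * C)) * ‖e‖ ^ 2) := by gcongr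
      _ = _ := by field_simp
  have h1 := hC a b
  have h2 : (‖a‖ ^ 2 + C * ‖b‖ ^ 2) ^ (p / 2) ≤ (‖a‖ ^ 2 + ‖e‖ ^ 2 / 2) ^ (p / 2) := by gcongr
  have h3 := rpow_midpoint_le hr1 (by positivity : 0 ≤ ‖a‖ ^ 2)
    (by positivity : 0 ≤ ‖a‖ ^ 2 + ‖e‖ ^ 2)
  rw [show (‖a‖ ^ 2 + (‖a‖ ^ 2 + ‖e‖ ^ 2)) / 2 = ‖a‖ ^ 2 + ‖e‖ ^ 2 / 2 by ring] at h3
  have h4 := rpow_add_sub_rpow_mono hr1 (by positivity : 0 ≤ ‖a‖ ^ 2)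
    (by nlinarith [sq_nonneg ‖u‖] : ‖a‖ ^ 2 ≤ ‖u‖ ^ 2 + ‖a‖ ^ 2) (by positivity : 0 ≤ ‖e‖ ^ 2)
  have h5 := rpow_midpoint_le hr1 (by positivity : 0 ≤ ‖u + e‖ ^ 2 + ‖a + b‖ ^ 2)
    (by positivity : 0 ≤ ‖u - e‖ ^ 2 + ‖a - b‖ ^ 2)
  have h6 : (‖u‖ ^ 2 + ‖a‖ ^ 2 + ‖e‖ ^ 2) ^ (p / 2) ≤
      ((‖u + e‖ ^ 2 + ‖a + b‖ ^ 2 + (‖u - e‖ ^ 2 + ‖a - b‖ ^ 2)) / 2) ^ (p / 2) := by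
    apply Real.rpow_le_rpow (by positivity) _ (by linarith)
    rw [norm_add_sq_real, norm_sub_sq_real, norm_add_sq_real, norm_sub_sq_real]
    nlinarith [sq_nonneg ‖b‖]
  have h7 : ‖a‖ ^ p = (‖a‖ ^ 2) ^ (p / 2) := by
    rw [← Real.rpow_natCast, ← Real.rpow_mul (norm_nonneg _)]; congr 1; push_cast; ring
  simp only [burkholder]
  rw [h7]
  linarith

theorem exists_burkholder_lower {F : Type*} [NormedAddCommGroup F] {p : ℝ} (hp : 2 ≤ p) :
    ∃ C : ℝ, 0 ≤ C ∧ ∀ u a : F, ‖a‖ ^ p / 2 - C * ‖u‖ ^ p ≤ burkholder p u a := by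
  have hr1 : 1 ≤ p / 2 := by linarith
  set r := p / 2 with hr
  have key : ∀ x : F, ‖x‖ ^ p = (‖x‖ ^ 2) ^ r := fun x => by
    rw [← Real.rpow_natCast, ← Real.rpow_mul (norm_nonneg _)]; congr 1; rw [hr]; push_cast; ring
  set c : ℝ := (3 / 2) ^ (1 / r) with hc
  have hc1 : 1 < c := Real.one_lt_rpow (by norm_num) (by positivity)
  have hcr : c ^ r = 3 / 2 := by
    rw [hc, ← Real.rpow_mul (by norm_num), one_div_mul_cancel (by linarith), Real.rpow_one]
  set η := c - 1 with hη
  have hη0 : 0 < η := by linarith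
  refine ⟨(1 + 1 / η) ^ r, by positivity, fun u a => ?_⟩
  simp only [burkholder, key, ← hr]
  have ha : 0 ≤ ‖a‖ ^ 2 := by positivity
  have hu : 0 ≤ ‖u‖ ^ 2 := by positivity
  have hu' : 0 ≤ (1 + 1 / η) ^ r * (‖u‖ ^ 2) ^ r := by positivity
  have ha' : 0 ≤ (‖a‖ ^ 2) ^ r := by positivity
  rcases le_total (‖u‖ ^ 2) (η * ‖a‖ ^ 2) with h | h
  · have : (‖u‖ ^ 2 + ‖a‖ ^ 2) ^ r ≤ (c * ‖a‖ ^ 2) ^ r := by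
      apply Real.rpow_le_rpow (by positivity) _ (by linarith)
      rw [hη] at h; linarith
    rw [Real.mul_rpow (by linarith) ha, hcr] at this
    linarith
  · have : (‖u‖ ^ 2 + ‖a‖ ^ 2) ^ r ≤ ((1 + 1 / η) * ‖u‖ ^ 2) ^ r := by
      apply Real.rpow_le_rpow (by positivity) _ (by linarith)
      have : ‖a‖ ^ 2 ≤ 1 / η * ‖u‖ ^ 2 := by
        rw [one_div, inv_mul_eq_div, le_div_iff₀ hη0]; linarith
      linarith
    rw [Real.mul_rpow (by positivity) hu] at this
    linarith

/-- The Bellman function of the bilinear embedding, the partial Legendre transform of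
`burkholder`. -/
def bellman (p : ℝ) (u w : F) : ℝ := ⨆ a : F, (inner ℝ a w - burkholder p u a)

theorem exists_bellman_bound {p q : ℝ} (hp : 2 ≤ p) (hpq : p.HolderConjugate q) :
    ∃ C : ℝ, 0 ≤ C ∧ ∀ u w a : F, inner ℝ a w - burkholder p u a ≤ C * (‖u‖ ^ p + ‖w‖ ^ q) := by
  obtain ⟨C, hC0, hC⟩ := exists_burkholder_lower (F := F) hp
  refine ⟨C + 1, by linarith, fun u w a => ?_⟩
  have h1 := Real.young_inequality_of_nonneg (norm_nonneg a) (norm_nonneg w) hpq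
  have h2 : ‖a‖ ^ p / p ≤ ‖a‖ ^ p / 2 := by gcongr
  have h3 : ‖w‖ ^ q / q ≤ ‖w‖ ^ q := div_le_self (by positivity) hpq.symm.lt.le
  have h4 := real_inner_le_norm a w
  have h5 := hC u a
  have h6 : 0 ≤ ‖u‖ ^ p := by positivity
  have h7 : 0 ≤ ‖w‖ ^ q := by positivity
  nlinarith [mul_nonneg hC0 h7]

end Bellman

section BellmanLegendre

variable {F : Type*} [NormedAddCommGroup F] [InnerProductSpace ℝ F]

theorem bddAbove_bellman {p : ℝ} (hp : 2 ≤ p) (u w : F) :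
    BddAbove (range fun a : F => inner ℝ a w - burkholder p u a) := by
  have hpq := Real.HolderConjugate.conjExponent (by linarith : 1 < p)
  obtain ⟨C, -, hC⟩ := exists_bellman_bound (F := F) hp hpq
  exact ⟨_, by rintro _ ⟨a, rfl⟩; exact hC u w a⟩

theorem le_bellman {p : ℝ} (hp : 2 ≤ p) (u w a : F) :
    inner ℝ a w - burkholder p u a ≤ bellman p u w :=
  le_ciSup (bddAbove_bellman hp u w) a

theorem bellman_nonneg {p : ℝ} (hp : 2 ≤ p) (u w : F) : 0 ≤ bellman p u w := by
  refine le_trans ?_ (le_bellman hp u w 0)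
  simp only [inner_zero_left, burkholder, norm_zero]
  rw [Real.zero_rpow (by linarith)]
  have : 0 ≤ (‖u‖ ^ 2 + 0 ^ 2) ^ (p / 2) := by positivity
  linarith

theorem exists_bellman_le {p q : ℝ} (hp : 2 ≤ p) (hpq : p.HolderConjugate q) :
    ∃ C : ℝ, 0 ≤ C ∧ ∀ u w : F, bellman p u w ≤ C * (‖u‖ ^ p + ‖w‖ ^ q) := by
  obtain ⟨C, hC0, hC⟩ := exists_bellman_bound (F := F) hp hpq
  exact ⟨C, hC0, fun u w => ciSup_le (hC u w)⟩

theorem exists_bellman_gap {p : ℝ} (hp : 2 ≤ p) : ∃ δ : ℝ, 0 < δ ∧ ∀ u u' w w' a : F,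
    inner ℝ a ((1 / 2 : ℝ) • (w + w')) - burkholder p ((1 / 2 : ℝ) • (u + u')) a
      + δ * (‖u - u'‖ * ‖w - w'‖) ≤ (bellman p u w + bellman p u' w') / 2 := by
  obtain ⟨ε, hε, hz⟩ := exists_burkholder_zigzag (F := F) hp
  refine ⟨ε / 4, by positivity, fun u u' w w' a => ?_⟩
  set e := (1 / 2 : ℝ) • (u - u') with he
  set d := (1 / 2 : ℝ) • (w - w') with hd
  set b := (ε * ‖e‖ / ‖d‖) • d with hb
  set um := (1 / 2 : ℝ) • (u + u') with hum
  set wm := (1 / 2 : ℝ) • (w + w') with hwm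
  have hu : um + e = u := by rw [hum, he]; module
  have hu' : um - e = u' := by rw [hum, he]; module
  have hw : wm + d = w := by rw [hwm, hd]; module
  have hw' : wm - d = w' := by rw [hwm, hd]; module
  have hbn : ‖b‖ ≤ ε * ‖e‖ := by
    rw [hb, norm_smul, Real.norm_of_nonneg (by positivity)]
    rcases (norm_nonneg d).eq_or_lt with h | h
    · rw [← h]; simp; positivity
    · rw [div_mul_cancel₀ _ h.ne']
  have hbd : inner ℝ b d = ε / 4 * (‖u - u'‖ * ‖w - w'‖) := by
    have h1 : ‖u - u'‖ = 2 * ‖e‖ := by rw [he, norm_smul]; norm_num; ring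
    have h2 : ‖w - w'‖ = 2 * ‖d‖ := by rw [hd, norm_smul]; norm_num; ring
    rw [h1, h2, hb, inner_smul_left, real_inner_self_eq_norm_sq]
    simp only [conj_trivial]
    rcases (norm_nonneg d).eq_or_lt with h | h
    · rw [← h]; simp
    · field_simp
      ring
  have h1 := le_bellman hp (um + e) (wm + d) (a + b)
  have h2 := le_bellman hp (um - e) (wm - d) (a - b)
  have h3 := hz um a e b hbn
  rw [hu, hw] at h1
  rw [hu', hw'] at h2
  rw [hu, hu'] at h3
  have h4 : inner ℝ (a + b) w + inner ℝ (a - b) w' = 2 * inner ℝ a wm + 2 * inner ℝ b d := by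
    rw [← hw, ← hw']
    simp only [inner_add_left, inner_sub_left, inner_add_right, inner_sub_right]
    ring
  linarith

theorem convexOn_sq_add_rpow {p : ℝ} (hp : 2 ≤ p) (a : F) :
    ConvexOn ℝ univ fun u : F => (‖u‖ ^ 2 + ‖a‖ ^ 2) ^ (p / 2) := by
  refine ⟨convex_univ, fun x _ y _ s t hs ht hst => ?_⟩
  have hq : ∀ z : F, (‖z‖ ^ 2 + ‖a‖ ^ 2) ^ (p / 2) = ‖WithLp.toLp 2 (z, a)‖ ^ p := fun z => by
    have h := WithLp.prod_norm_sq_eq_of_L2 (WithLp.toLp 2 (z, a))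
    change ‖WithLp.toLp 2 (z, a)‖ ^ 2 = ‖z‖ ^ 2 + ‖a‖ ^ 2 at h
    rw [← h]
    rw [← Real.rpow_natCast, ← Real.rpow_mul (norm_nonneg _)]; congr 1; push_cast; ring
  simp only [hq]
  have h1 : WithLp.toLp 2 (s • x + t • y, a)
      = s • WithLp.toLp 2 (x, a) + t • WithLp.toLp 2 (y, a) := by
    rw [← WithLp.toLp_smul, ← WithLp.toLp_smul, ← WithLp.toLp_add]
    simp only [Prod.smul_mk, Prod.mk_add_mk, ← add_smul, hst, one_smul]
  rw [h1]
  have h2 := (convexOn_rpow (by linarith : 1 ≤ p)).2 (norm_nonneg (WithLp.toLp 2 (x, a)) : _ ∈ Ici (0:ℝ))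
    (norm_nonneg (WithLp.toLp 2 (y, a)) : _ ∈ Ici (0:ℝ)) hs ht hst
  refine le_trans ?_ h2
  apply Real.rpow_le_rpow (norm_nonneg _) _ (by linarith)
  refine (norm_add_le _ _).trans ?_
  rw [norm_smul, norm_smul, Real.norm_of_nonneg hs, Real.norm_of_nonneg ht]
  rfl

end BellmanLegendre

theorem continuous_burkholder {F : Type*} [NormedAddCommGroup F] {p : ℝ} (hp : 2 ≤ p) (a : F) :
    Continuous fun u : F => burkholder p u a := by
  unfold burkholder
  exact continuous_const.sub ((by fun_prop : Continuous fun u : F => ‖u‖ ^ 2 + ‖a‖ ^ 2).rpow_const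
    fun _ => Or.inr (by linarith))


theorem measurable_bellman {p : ℝ} (hp : 2 ≤ p) :
    Measurable fun z : E3 × E3 => bellman p z.1 z.2 := by
  apply LowerSemicontinuous.measurable
  unfold bellman
  apply lowerSemicontinuous_ciSup
  · intro z; exact bddAbove_bellman hp _ _
  · intro a
    exact ((by fun_prop : Continuous fun z : E3 × E3 => inner ℝ a z.2).sub
      ((continuous_burkholder hp a).comp continuous_fst)).lowerSemicontinuous

theorem measurable_bellman_comp {p : ℝ} (hp : 2 ≤ p) {X : Type*} [MeasurableSpace X]
    {u w : X → E3} (hu : Measurable u) (hw : Measurable w) :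
    Measurable fun x => bellman p (u x) (w x) := by
  have h := measurable_bellman hp
  generalize (bellman p : E3 → E3 → ℝ) = B at h ⊢
  exact h.comp (hu.prodMk hw)

section ProductMean

variable {X : Type*} [MeasurableSpace X] {μ : Measure X} [IsProbabilityMeasure μ]

theorem integral_comp_fst_of_isProbabilityMeasure {G : Type*} [NormedAddCommGroup G]
    [NormedSpace ℝ G] (g : X → G) : ∫ z : X × X, g z.1 ∂(μ.prod μ) = ∫ x, g x ∂μ := by
  rw [integral_fun_fst]; simp

theorem integral_comp_snd_of_isProbabilityMeasure {G : Type*} [NormedAddCommGroup G]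
    [NormedSpace ℝ G] (g : X → G) : ∫ z : X × X, g z.2 ∂(μ.prod μ) = ∫ x, g x ∂μ := by
  rw [integral_fun_snd]; simp

theorem integral_midpoint_of_isProbabilityMeasure {G : Type*} [NormedAddCommGroup G]
    [NormedSpace ℝ G] {g : X → G} (hg : Integrable g μ) :
    ∫ z : X × X, (1 / 2 : ℝ) • (g z.1 + g z.2) ∂(μ.prod μ) = ∫ x, g x ∂μ := by
  rw [integral_smul, integral_add (hg.comp_fst μ) (hg.comp_snd μ),
    integral_comp_fst_of_isProbabilityMeasure g, integral_comp_snd_of_isProbabilityMeasure g]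
  module

end ProductMean

theorem inner_sub_burkholder_integral_le {p δ M : ℝ} (hp : 2 ≤ p) {X : Type*}
    [MeasurableSpace X] {μ : Measure X} [IsProbabilityMeasure μ] {u w : X → E3} {a : E3}
    (hgap : ∀ u u' w w' : E3, inner ℝ a ((1 / 2 : ℝ) • (w + w'))
      - burkholder p ((1 / 2 : ℝ) • (u + u')) a
      + δ * (‖u - u'‖ * ‖w - w'‖) ≤ (bellman p u w + bellman p u' w') / 2)
    (hu : Measurable u) (hw : Integrable w μ) (hMu : ∀ x, ‖u x‖ ≤ M)
    (hB : Integrable (fun x => bellman p (u x) (w x)) μ)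
    (hN : Integrable (fun z : X × X => ‖u z.1 - u z.2‖ * ‖w z.1 - w z.2‖) (μ.prod μ)) :
    inner ℝ a (∫ x, w x ∂μ) - burkholder p (∫ x, u x ∂μ) a
      ≤ ∫ x, bellman p (u x) (w x) ∂μ
        - δ * ∫ z : X × X, ‖u z.1 - u z.2‖ * ‖w z.1 - w z.2‖ ∂(μ.prod μ) := by
  have hmm : Measurable fun z : X × X => (1 / 2 : ℝ) • (u z.1 + u z.2) :=
    ((hu.comp measurable_fst).add (hu.comp measurable_snd)).const_smul (1 / 2 : ℝ)
  have hmM : ∀ z : X × X, ‖(1 / 2 : ℝ) • (u z.1 + u z.2)‖ ≤ M := fun z => by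
    rw [norm_smul]
    have := (norm_add_le (u z.1) (u z.2)).trans (add_le_add (hMu _) (hMu _))
    norm_num
    linarith
  have hcc : Continuous fun v : E3 => (‖v‖ ^ 2 + ‖a‖ ^ 2) ^ (p / 2) :=
    (by fun_prop : Continuous fun u : E3 => ‖u‖ ^ 2 + ‖a‖ ^ 2).rpow_const
    fun _ => Or.inr (by linarith)
  have hic : Integrable (fun z : X × X =>
      (‖(1 / 2 : ℝ) • (u z.1 + u z.2)‖ ^ 2 + ‖a‖ ^ 2) ^ (p / 2)) (μ.prod μ) := by
    refine Integrable.of_bound (hcc.measurable.comp hmm).aestronglyMeasurable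
      ((M ^ 2 + ‖a‖ ^ 2) ^ (p / 2)) (ae_of_all _ fun z => ?_)
    rw [Real.norm_of_nonneg (by positivity)]
    have := hmM z
    gcongr
  have him : Integrable (fun z : X × X => (1 / 2 : ℝ) • (u z.1 + u z.2)) (μ.prod μ) :=
    Integrable.of_bound hmm.aestronglyMeasurable M (ae_of_all _ hmM)
  have hiu : Integrable u μ := Integrable.of_bound hu.aestronglyMeasurable M (ae_of_all _ hMu)
  have hjen := (convexOn_sq_add_rpow hp a).map_integral_le (μ := μ.prod μ)
    hcc.continuousOn isClosed_univ (ae_of_all _ fun _ => mem_univ _) him hic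
  rw [integral_midpoint_of_isProbabilityMeasure hiu] at hjen
  have hiw2 : Integrable (fun z : X × X => (1 / 2 : ℝ) • (w z.1 + w z.2)) (μ.prod μ) :=
    ((hw.comp_fst μ).add (hw.comp_snd μ)).smul (1 / 2 : ℝ)
  have hi1 : Integrable (fun z : X × X => (inner ℝ a ((1 / 2 : ℝ) • (w z.1 + w z.2)) : ℝ))
    (μ.prod μ) := hiw2.const_inner a
  have hi2 := hic.sub (integrable_const (2 * ‖a‖ ^ p))
  have hint := integral_mono (hi1.add (hi2.add (hN.const_mul δ)))
    (((hB.comp_fst μ).add (hB.comp_snd μ)).div_const 2) (fun z => by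
      have := hgap (u z.1) (u z.2) (w z.1) (w z.2)
      simp only [burkholder] at this
      simp only [Pi.add_apply, Pi.sub_apply]
      linarith)
  rw [integral_add' hi1 (hi2.add (hN.const_mul δ)), integral_add' hi2 (hN.const_mul δ),
    integral_sub' hic (integrable_const _), integral_inner hiw2,
    integral_midpoint_of_isProbabilityMeasure hw, integral_div,
    integral_add' (hB.comp_fst μ) (hB.comp_snd μ),
    integral_comp_fst_of_isProbabilityMeasure (fun x => bellman p (u x) (w x)),
    integral_comp_snd_of_isProbabilityMeasure (fun x => bellman p (u x) (w x)),
    integral_const_mul δ] at hint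
  simp only [integral_const, probReal_univ, one_smul] at hint
  simp only [burkholder]
  linarith

theorem bellman_integral_add_lintegral_le {p δ M : ℝ} (hp : 2 ≤ p) (hδ : 0 ≤ δ)
    (hgap : ∀ u u' w w' a : E3, inner ℝ a ((1 / 2 : ℝ) • (w + w'))
      - burkholder p ((1 / 2 : ℝ) • (u + u')) a
      + δ * (‖u - u'‖ * ‖w - w'‖) ≤ (bellman p u w + bellman p u' w') / 2)
    {X : Type*} [MeasurableSpace X] (μ : Measure X) [IsProbabilityMeasure μ] {u w : X → E3}
    (hu : Measurable u) (hw : Measurable w) (hMu : ∀ x, ‖u x‖ ≤ M) (hMw : ∀ x, ‖w x‖ ≤ M) :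
    ENNReal.ofReal (bellman p (∫ x, u x ∂μ) (∫ x, w x ∂μ))
        + ENNReal.ofReal δ * ∫⁻ y, ∫⁻ z, ‖u y - u z‖ₑ * ‖w y - w z‖ₑ ∂μ ∂μ
      ≤ ∫⁻ x, ENNReal.ofReal (bellman p (u x) (w x)) ∂μ := by
  have hpq := Real.HolderConjugate.conjExponent (by linarith : 1 < p)
  obtain ⟨C, hC0, hC⟩ := exists_bellman_le (F := E3) hp hpq
  have hiw : Integrable w μ := Integrable.of_bound hw.aestronglyMeasurable M (ae_of_all _ hMw)
  have hBm := measurable_bellman_comp hp hu hw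
  have hq0 : 0 ≤ p.conjExponent := hpq.symm.nonneg
  have hiB : Integrable (fun x => bellman p (u x) (w x)) μ := by
    refine Integrable.of_bound hBm.aestronglyMeasurable
      (C * (M ^ p + M ^ p.conjExponent)) (ae_of_all _ fun x => ?_)
    rw [Real.norm_of_nonneg (bellman_nonneg hp _ _)]
    refine (hC _ _).trans ?_
    gcongr
    · exact hMu x
    · exact hMw x
  have hNm : Measurable fun z : X × X => ‖u z.1 - u z.2‖ * ‖w z.1 - w z.2‖ := by
    have h1 : Measurable fun z : X × X => u z.1 - u z.2 :=
      (hu.comp measurable_fst).sub (hu.comp measurable_snd)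
    have h2 : Measurable fun z : X × X => w z.1 - w z.2 :=
      (hw.comp measurable_fst).sub (hw.comp measurable_snd)
    exact h1.norm.mul h2.norm
  have hN0 : ∀ z : X × X, 0 ≤ ‖u z.1 - u z.2‖ * ‖w z.1 - w z.2‖ := fun z => by positivity
  have hiN : Integrable (fun z : X × X => ‖u z.1 - u z.2‖ * ‖w z.1 - w z.2‖) (μ.prod μ) := by
    refine Integrable.of_bound hNm.aestronglyMeasurable ((M + M) * (M + M)) (ae_of_all _ fun z => ?_)
    rw [Real.norm_of_nonneg (hN0 z)]
    have h1 := (norm_sub_le (u z.1) (u z.2)).trans (add_le_add (hMu _) (hMu _))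
    have h2 := (norm_sub_le (w z.1) (w z.2)).trans (add_le_add (hMw _) (hMw _))
    exact mul_le_mul h1 h2 (norm_nonneg _) ((norm_nonneg _).trans h1)
  have hfin : bellman p (∫ x, u x ∂μ) (∫ x, w x ∂μ)
      + δ * ∫ z : X × X, ‖u z.1 - u z.2‖ * ‖w z.1 - w z.2‖ ∂(μ.prod μ)
      ≤ ∫ x, bellman p (u x) (w x) ∂μ := by
    have := ciSup_le fun a => inner_sub_burkholder_integral_le hp
      (fun u u' w w' => hgap u u' w w' a) hu hiw hMu hiB hiN
    change bellman p _ _ ≤ _ at this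
    linarith
  have hNl : ∫⁻ y, ∫⁻ z, ‖u y - u z‖ₑ * ‖w y - w z‖ₑ ∂μ ∂μ
      = ENNReal.ofReal (∫ z : X × X, ‖u z.1 - u z.2‖ * ‖w z.1 - w z.2‖ ∂(μ.prod μ)) := by
    rw [ofReal_integral_eq_lintegral_ofReal hiN (ae_of_all _ hN0),
      lintegral_prod _ hNm.ennreal_ofReal.aemeasurable]
    refine lintegral_congr fun y => lintegral_congr fun z => ?_
    rw [ENNReal.ofReal_mul (norm_nonneg _), ofReal_norm, ofReal_norm]
  rw [hNl, ← ENNReal.ofReal_mul hδ, ← ENNReal.ofReal_add (bellman_nonneg hp _ _)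
    (mul_nonneg hδ (integral_nonneg hN0)),
    ← ofReal_integral_eq_lintegral_ofReal hiB (ae_of_all _ fun _ => bellman_nonneg hp _ _)]
  exact ENNReal.ofReal_le_ofReal hfin

/-- The heat kernel on `ℝ³`. -/
def heatKernel (t : ℝ) (z : E3) : ℝ :=
  (4 * Real.pi * t) ^ (-(3 / 2) : ℝ) * Real.exp (-(4 * t)⁻¹ * ‖z‖ ^ 2)

theorem heatKernel_nonneg {t : ℝ} (ht : 0 ≤ t) (z : E3) : 0 ≤ heatKernel t z := by
  unfold heatKernel; positivity

theorem contDiff_heatKernel (t : ℝ) : ContDiff ℝ 1 (heatKernel t) := by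
  unfold heatKernel
  exact contDiff_const.mul (contDiff_const.mul (contDiff_norm_sq ℝ)).exp

theorem continuous_heatKernel (t : ℝ) : Continuous (heatKernel t) :=
  (contDiff_heatKernel t).continuous

theorem integral_heatKernel {t : ℝ} (ht : 0 < t) : ∫ z, heatKernel t z = 1 := by
  unfold heatKernel
  rw [integral_const_mul, GaussianFourier.integral_rexp_neg_mul_sq_norm (by positivity)]
  rw [finrank_euclideanSpace, Fintype.card_fin, div_inv_eq_mul, Real.rpow_neg (by positivity)]
  have : Real.pi * (4 * t) = 4 * Real.pi * t := by ring
  rw [this]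
  push_cast
  exact inv_mul_cancel₀ (by positivity)

theorem integrable_heatKernel {t : ℝ} (ht : 0 < t) : Integrable (heatKernel t) := by
  by_contra h
  have := integral_heatKernel ht
  rw [integral_undef h] at this
  norm_num at this

/-- The Gaussian probability measure with density `heatKernel t`. -/
def gaussianMeasure (t : ℝ) : Measure E3 :=
  volume.withDensity fun z => ENNReal.ofReal (heatKernel t z)

theorem isProbabilityMeasure_gaussianMeasure {t : ℝ} (ht : 0 < t) :
    IsProbabilityMeasure (gaussianMeasure t) := by
  refine ⟨?_⟩
  rw [gaussianMeasure, withDensity_apply _ MeasurableSet.univ, setLIntegral_univ,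
    ← ofReal_integral_eq_lintegral_ofReal (integrable_heatKernel ht)
      (ae_of_all _ fun z => heatKernel_nonneg ht.le z), integral_heatKernel ht, ENNReal.ofReal_one]

theorem integral_gaussianMeasure {t : ℝ} (ht : 0 ≤ t) {G : Type*} [NormedAddCommGroup G]
    [NormedSpace ℝ G] (g : E3 → G) :
    ∫ z, g z ∂(gaussianMeasure t) = ∫ z, heatKernel t z • g z := by
  rw [gaussianMeasure, integral_withDensity_eq_integral_toReal_smul
    (continuous_heatKernel t).measurable.ennreal_ofReal (ae_of_all _ fun _ => ENNReal.ofReal_lt_top)]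
  simp only [ENNReal.toReal_ofReal (heatKernel_nonneg ht _)]

theorem lintegral_gaussianMeasure {t : ℝ} {g : E3 → ℝ≥0∞} :
    ∫⁻ z, g z ∂(gaussianMeasure t) = ∫⁻ z, ENNReal.ofReal (heatKernel t z) * g z := by
  rw [gaussianMeasure, lintegral_withDensity_eq_lintegral_mul_non_measurable₀]
  · rfl
  · exact (continuous_heatKernel t).measurable.ennreal_ofReal.aemeasurable
  · exact ae_of_all _ fun _ => ENNReal.ofReal_lt_top

theorem integrable_gaussianMeasure_iff {t : ℝ} (ht : 0 ≤ t) {G : Type*} [NormedAddCommGroup G]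
    [NormedSpace ℝ G] {g : E3 → G} :
    Integrable g (gaussianMeasure t) ↔ Integrable fun z => heatKernel t z • g z := by
  rw [gaussianMeasure, integrable_withDensity_iff_integrable_smul'
    (continuous_heatKernel t).measurable.ennreal_ofReal (ae_of_all _ fun _ => ENNReal.ofReal_lt_top)]
  simp only [ENNReal.toReal_ofReal (heatKernel_nonneg ht _)]

theorem charFun_gaussianMeasure {t : ℝ} (ht : 0 < t) (w : E3) :
    charFun (gaussianMeasure t) w = Complex.exp (-(t * ‖w‖ ^ 2 : ℝ)) := by
  rw [charFun_apply, integral_gaussianMeasure ht.le]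
  have hb : 0 < (((4 * t)⁻¹ : ℝ) : ℂ).re := by rw [Complex.ofReal_re]; positivity
  have h1 : ∀ c : ℂ, ∫ z : E3, (((4 * Real.pi * t) ^ (-(3 / 2) : ℝ) : ℝ) : ℂ) *
      Complex.exp (-(((4 * t)⁻¹ : ℝ) : ℂ) * ‖z‖ ^ 2 + c * (inner ℝ w z : ℝ))
      = Complex.exp (c ^ 2 * ‖w‖ ^ 2 / (4 * (((4 * t)⁻¹ : ℝ) : ℂ))) := fun c => by
    have h0 := integral_heatKernel ht
    unfold heatKernel at h0
    have h2 := GaussianFourier.integral_cexp_neg_mul_sq_norm_add hb 0 w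
    have h3 := GaussianFourier.integral_cexp_neg_mul_sq_norm_add hb c w
    have h4 : (((4 * Real.pi * t) ^ (-(3 / 2) : ℝ) : ℝ) : ℂ) *
        (Real.pi / (((4 * t)⁻¹ : ℝ) : ℂ)) ^ (Module.finrank ℝ E3 / 2 : ℂ) = 1 := by
      have h5 : ∫ v : E3, Complex.exp (-(((4 * t)⁻¹ : ℝ) : ℂ) * ‖v‖ ^ 2 + 0 * (inner ℝ w v : ℝ))
          = ((∫ v : E3, Real.exp (-(4 * t)⁻¹ * ‖v‖ ^ 2) : ℝ) : ℂ) := by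
        rw [← integral_complex_ofReal]
        congr 1; ext v; push_cast; simp
      rw [h5] at h2
      simp only [ne_eq, OfNat.ofNat_ne_zero, not_false_eq_true, zero_pow, zero_mul, zero_div,
        Complex.exp_zero, mul_one] at h2
      rw [← h2, ← Complex.ofReal_mul, ← integral_const_mul, h0, Complex.ofReal_one]
    rw [integral_const_mul, h3, ← mul_assoc, h4, one_mul]
  have h2 := h1 Complex.I
  have h3 : Complex.exp (-(t * ‖w‖ ^ 2 : ℝ))
      = Complex.exp (Complex.I ^ 2 * ‖w‖ ^ 2 / (4 * (((4 * t)⁻¹ : ℝ) : ℂ))) := by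
    congr 1
    rw [Complex.I_sq]
    push_cast
    have : (t : ℂ) ≠ 0 := by exact_mod_cast ht.ne'
    field_simp
  rw [h3, ← h2]
  congr 1; ext z
  rw [Complex.exp_add, heatKernel, real_inner_comm, mul_comm Complex.I, Complex.real_smul]
  push_cast
  ring

theorem gaussianMeasure_conv {s t : ℝ} (hs : 0 < s) (ht : 0 < t) :
    (gaussianMeasure s).conv (gaussianMeasure t) = gaussianMeasure (s + t) := by
  have := isProbabilityMeasure_gaussianMeasure hs
  have := isProbabilityMeasure_gaussianMeasure ht
  have := isProbabilityMeasure_gaussianMeasure (add_pos hs ht)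
  apply Measure.ext_of_charFun
  ext w
  rw [charFun_conv, charFun_gaussianMeasure hs, charFun_gaussianMeasure ht,
    charFun_gaussianMeasure (add_pos hs ht), ← Complex.exp_add]
  congr 1; push_cast; ring

theorem map_neg_gaussianMeasure {t : ℝ} (ht : 0 < t) :
    (gaussianMeasure t).map (fun z => -z) = gaussianMeasure t := by
  have := isProbabilityMeasure_gaussianMeasure ht
  have := Measure.isProbabilityMeasure_map (μ := gaussianMeasure t)
    (measurable_neg (G := E3)).aemeasurable
  apply Measure.ext_of_charFun
  ext w
  rw [charFun_apply, integral_map measurable_neg.aemeasurable (by fun_prop)]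
  simp only [inner_neg_left, Complex.ofReal_neg]
  have := charFun_gaussianMeasure ht (-w)
  rw [norm_neg, ← charFun_gaussianMeasure ht, charFun_apply] at this
  simpa only [inner_neg_right, Complex.ofReal_neg] using this

theorem heatKernel_mul_le {t : ℝ} (ht : 0 < t) (z : E3) :
    (‖z‖ ^ 2 / (4 * t ^ 2) + 1 / (2 * t)) * heatKernel t z ≤ 6 / t * heatKernel (2 * t) z := by
  have h1 : (4 * Real.pi * (2 * t)) ^ (-(3 / 2) : ℝ)
      = 2 ^ (-(3 / 2) : ℝ) * (4 * Real.pi * t) ^ (-(3 / 2) : ℝ) := by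
    rw [← Real.mul_rpow (by norm_num) (by positivity)]; congr 1; ring
  have h2 : (1 : ℝ) / 3 ≤ 2 ^ (-(3 / 2) : ℝ) := by
    have : (2 : ℝ) ^ (-(3 / 2) : ℝ) = (Real.sqrt 8)⁻¹ := by
      rw [Real.sqrt_eq_rpow, ← Real.rpow_neg (by norm_num), show (8 : ℝ) = 2 ^ (3 : ℝ) by norm_num,
        ← Real.rpow_mul (by norm_num)]
      norm_num
    rw [this, one_div]
    apply inv_anti₀ (by positivity)
    rw [Real.sqrt_le_left (by norm_num)]; norm_num
  set r := (4 * (2 * t))⁻¹ * ‖z‖ ^ 2 with hr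
  have h3 : Real.exp (-(4 * t)⁻¹ * ‖z‖ ^ 2) = Real.exp (-r) * Real.exp (-r) := by
    rw [← Real.exp_add, hr]; congr 1; field_simp; ring
  have h4 : ‖z‖ ^ 2 / (4 * t ^ 2) + 1 / (2 * t) ≤ 2 / t * Real.exp r := by
    have : ‖z‖ ^ 2 / (4 * t ^ 2) + 1 / (2 * t) = 2 / t * (r + 1 / 4) := by
      rw [hr]; field_simp; ring
    rw [this]
    gcongr
    linarith [Real.add_one_le_exp r]
  have h5 : Real.exp r * Real.exp (-r) = 1 := by rw [← Real.exp_add]; simp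
  unfold heatKernel
  rw [h1, h3, neg_mul, ← hr]
  set A := (4 * Real.pi * t) ^ (-(3 / 2) : ℝ)
  have hA : 0 ≤ A := by positivity
  calc _ ≤ 2 / t * Real.exp r * (A * (Real.exp (-r) * Real.exp (-r))) := by gcongr
    _ = 2 / t * (A * Real.exp (-r)) * (Real.exp r * Real.exp (-r)) := by ring
    _ = 6 / t * ((1 / 3) * A * Real.exp (-r)) := by rw [h5]; ring
    _ ≤ _ := by gcongr

theorem integrable_norm_sq_gaussianMeasure {t : ℝ} (ht : 0 < t) :
    Integrable (fun z : E3 => ‖z‖ ^ 2) (gaussianMeasure t) := by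
  rw [integrable_gaussianMeasure_iff ht.le]
  refine ((integrable_heatKernel (by positivity : 0 < 2 * t)).const_mul (4 * t ^ 2 * (6 / t))).mono'
    (by have := continuous_heatKernel t; fun_prop) (ae_of_all _ fun z => ?_)
  have h0 := heatKernel_nonneg ht.le z
  rw [smul_eq_mul, Real.norm_of_nonneg (by positivity)]
  have h := heatKernel_mul_le ht z
  rw [mul_assoc, ← div_le_iff₀' (by positivity)]
  refine le_trans ?_ h
  rw [add_mul]
  have : 0 ≤ 1 / (2 * t) * heatKernel t z := by positivity
  have h3 : heatKernel t z * ‖z‖ ^ 2 / (4 * t ^ 2) = ‖z‖ ^ 2 / (4 * t ^ 2) * heatKernel t z := by ring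
  linarith

theorem integrable_norm_gaussianMeasure {t : ℝ} (ht : 0 < t) :
    Integrable (fun z : E3 => ‖z‖) (gaussianMeasure t) := by
  have := isProbabilityMeasure_gaussianMeasure ht
  refine ((integrable_norm_sq_gaussianMeasure ht).add (integrable_const 1)).mono'
    (by fun_prop) (ae_of_all _ fun z => ?_)
  simp only [Pi.add_apply, norm_norm]
  nlinarith [sq_nonneg (‖z‖ - 1)]

/-- The quadratic form `D²p_t / p_t` of the heat kernel `p_t`. -/
def heatHessian (t : ℝ) (z a b : E3) : ℝ :=
  inner ℝ z a * inner ℝ z b / (4 * t ^ 2) - inner ℝ a b / (2 * t)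

theorem abs_heatHessian_le {t : ℝ} (ht : 0 < t) (z a b : E3) :
    |heatHessian t z a b| ≤ (‖z‖ ^ 2 / (4 * t ^ 2) + 1 / (2 * t)) * (‖a‖ * ‖b‖) := by
  unfold heatHessian
  refine (abs_sub _ _).trans ?_
  rw [abs_div, abs_div, abs_mul, abs_of_pos (by positivity : 0 < 4 * t ^ 2),
    abs_of_pos (by positivity : 0 < 2 * t), add_mul, div_mul_eq_mul_div, div_mul_eq_mul_div, one_mul]
  have h1 := abs_real_inner_le_norm z a
  have h2 := abs_real_inner_le_norm z b
  have h3 := abs_real_inner_le_norm a b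
  refine add_le_add (div_le_div_of_nonneg_right ?_ (by positivity)) (by gcongr)
  calc _ ≤ (‖z‖ * ‖a‖) * (‖z‖ * ‖b‖) := by gcongr
    _ = _ := by ring

theorem fderiv_heatKernel (t : ℝ) (z e : E3) :
    fderiv ℝ (heatKernel t) z e = -(inner ℝ z e / (2 * t)) * heatKernel t z := by
  have h := (((hasStrictFDerivAt_norm_sq z).hasFDerivAt.const_mul (-(4 * t)⁻¹)).exp).const_mul
    ((4 * Real.pi * t) ^ (-(3 / 2) : ℝ))
  change HasFDerivAt (heatKernel t) _ z at h
  rw [h.fderiv]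
  simp only [heatKernel, smul_apply, smul_eq_mul, innerSL_apply_apply, nsmul_eq_mul, mul_inv]
  push_cast
  ring

theorem integral_inner_fderiv_gaussianMeasure {t : ℝ} (ht : 0 < t) {w : E3 → E3} {M : ℝ} (e : E3)
    (hw : ContDiff ℝ 1 w) (hM : ∀ z, ‖w z‖ ≤ M) (hM' : ∀ z, ‖fderiv ℝ w z‖ ≤ M) :
    ∫ z, inner ℝ z (fderiv ℝ w z e) / (2 * t) ∂(gaussianMeasure t)
      = ∫ z, heatHessian t z e (w z) ∂(gaussianMeasure t) := by
  have := isProbabilityMeasure_gaussianMeasure ht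
  have hwc := hw.continuous
  have hwc' : Continuous fun z => fderiv ℝ w z e :=
    (hw.continuous_fderiv one_ne_zero).clm_apply continuous_const
  have hdiff : Differentiable ℝ fun z => (inner ℝ z (w z) : ℝ) :=
    differentiable_id.inner ℝ (hw.differentiable one_ne_zero)
  have hder : ∀ z, fderiv ℝ (fun z => (inner ℝ z (w z) : ℝ)) z e
      = inner ℝ z (fderiv ℝ w z e) + inner ℝ e (w z) := fun z => by
    rw [fderiv_inner_apply ℝ differentiableAt_fun_id ((hw.differentiable one_ne_zero) z)]
    simp
  have hn := integrable_norm_gaussianMeasure ht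
  have hn2 := integrable_norm_sq_gaussianMeasure ht
  have hM0 : 0 ≤ M := (norm_nonneg _).trans (hM 0)
  have i1 : Integrable (fun z => (inner ℝ z (w z) : ℝ)) (gaussianMeasure t) := by
    refine (hn.mul_const M).mono' (by fun_prop) (ae_of_all _ fun z => ?_)
    exact (norm_inner_le_norm _ _).trans (by gcongr; exact hM z)
  have i2 : Integrable (fun z => (inner ℝ z (fderiv ℝ w z e) : ℝ)) (gaussianMeasure t) := by
    refine (hn.mul_const (M * ‖e‖)).mono' (by fun_prop) (ae_of_all _ fun z => ?_)
    refine (norm_inner_le_norm _ _).trans ?_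
    gcongr
    exact (ContinuousLinearMap.le_opNorm _ _).trans (by gcongr; exact hM' z)
  have i3 : Integrable (fun z => (inner ℝ e (w z) : ℝ)) (gaussianMeasure t) := by
    refine Integrable.of_bound (by fun_prop) (‖e‖ * M) (ae_of_all _ fun z => ?_)
    exact (norm_inner_le_norm _ _).trans (by gcongr; exact hM z)
  have i4 : Integrable (fun z => (inner ℝ z e / (2 * t) * inner ℝ z (w z) : ℝ))
      (gaussianMeasure t) := by
    refine (hn2.mul_const (‖e‖ / (2 * t) * M)).mono' (by fun_prop) (ae_of_all _ fun z => ?_)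
    rw [norm_mul, norm_div, Real.norm_of_nonneg (by positivity : 0 ≤ 2 * t)]
    calc _ ≤ (‖z‖ * ‖e‖) / (2 * t) * (‖z‖ * M) := by
          gcongr
          · exact norm_inner_le_norm _ _
          · exact (norm_inner_le_norm _ _).trans (by gcongr; exact hM z)
      _ = _ := by ring
  have key := integral_mul_fderiv_eq_neg_fderiv_mul_of_integrable (μ := (volume : Measure E3))
    (f := heatKernel t) (g := fun z => (inner ℝ z (w z) : ℝ)) (v := e)
    (by
      have := ((integrable_gaussianMeasure_iff ht.le).1 i4).neg
      refine this.congr (ae_of_all _ fun z => ?_)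
      simp only [fderiv_heatKernel, Pi.neg_apply, smul_eq_mul]; ring)
    (by
      have := ((integrable_gaussianMeasure_iff ht.le).1 (i2.add i3))
      simpa only [hder, smul_eq_mul, Pi.add_apply] using this)
    ((integrable_gaussianMeasure_iff ht.le).1 i1)
    (fun z _ => ((contDiff_heatKernel t).differentiable one_ne_zero) z) (fun z _ => hdiff z)
  have e1 : ∫ z, inner ℝ z (fderiv ℝ w z e) + inner ℝ e (w z) ∂(gaussianMeasure t)
      = ∫ z, inner ℝ z e / (2 * t) * inner ℝ z (w z) ∂(gaussianMeasure t) := by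
    rw [integral_gaussianMeasure ht.le, integral_gaussianMeasure ht.le]
    simp only [smul_eq_mul, ← hder]
    rw [key, ← integral_neg]
    congr 1; ext z; rw [fderiv_heatKernel]; ring
  rw [integral_add i2 i3] at e1
  have e2 : ∫ z, heatHessian t z e (w z) ∂(gaussianMeasure t)
      = (∫ z, inner ℝ z e / (2 * t) * inner ℝ z (w z) ∂(gaussianMeasure t)
        - ∫ z, inner ℝ e (w z) ∂(gaussianMeasure t)) / (2 * t) := by
    rw [← integral_sub i4 i3, ← integral_div]
    congr 1; ext z; unfold heatHessian; field_simp; ring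
  rw [e2, integral_div, ← e1]
  ring

theorem integral_heatHessian {t : ℝ} (ht : 0 < t) (a b : E3) :
    ∫ z, heatHessian t z a b ∂(gaussianMeasure t) = 0 := by
  rw [← integral_inner_fderiv_gaussianMeasure (w := fun _ => b) (M := ‖b‖) ht a contDiff_const
    (fun _ => le_rfl) (fun z => by simp)]
  simp

theorem integral_gaussianMeasure_add {s t : ℝ} (hs : 0 < s) (ht : 0 < t) {G : Type*}
    [NormedAddCommGroup G] [NormedSpace ℝ G] {g : E3 → G} (hg : StronglyMeasurable g)
    (hi : Integrable g (gaussianMeasure (s + t))) :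
    ∫ z, g z ∂(gaussianMeasure (s + t))
      = ∫ z, ∫ y, g (z + y) ∂(gaussianMeasure t) ∂(gaussianMeasure s) := by
  have := isProbabilityMeasure_gaussianMeasure hs
  have := isProbabilityMeasure_gaussianMeasure ht
  rw [← gaussianMeasure_conv hs ht, Measure.conv] at hi ⊢
  rw [integral_map (by fun_prop) hg.aestronglyMeasurable]
  rw [integrable_map_measure hg.aestronglyMeasurable (by fun_prop)] at hi
  exact integral_prod _ hi

theorem integral_gaussianMeasure_neg {t : ℝ} (ht : 0 < t) {G : Type*}
    [NormedAddCommGroup G] [NormedSpace ℝ G] (g : E3 → G) :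
    ∫ z, g (-z) ∂(gaussianMeasure t) = ∫ z, g z ∂(gaussianMeasure t) := by
  conv_rhs => rw [← map_neg_gaussianMeasure ht]
  exact ((MeasurableEquiv.neg E3).measurableEmbedding.integral_map g).symm

theorem lintegral_gaussianMeasure_neg {t : ℝ} (ht : 0 < t) (g : E3 → ℝ≥0∞) :
    ∫⁻ z, g (-z) ∂(gaussianMeasure t) = ∫⁻ z, g z ∂(gaussianMeasure t) := by
  conv_rhs => rw [← map_neg_gaussianMeasure ht]
  exact ((MeasurableEquiv.neg E3).measurableEmbedding.lintegral_map g).symm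

theorem lintegral_gaussianMeasure_add {s t : ℝ} (hs : 0 < s) (ht : 0 < t) {g : E3 → ℝ≥0∞}
    (hg : Measurable g) :
    ∫⁻ z, g z ∂(gaussianMeasure (s + t))
      = ∫⁻ z, ∫⁻ y, g (z + y) ∂(gaussianMeasure t) ∂(gaussianMeasure s) := by
  have := isProbabilityMeasure_gaussianMeasure hs
  have := isProbabilityMeasure_gaussianMeasure ht
  rw [← gaussianMeasure_conv hs ht, Measure.conv, lintegral_map hg (by fun_prop)]
  exact lintegral_prod _ (hg.comp (by fun_prop)).aemeasurable

/-- The heat semigroup on vector fields. -/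
def heatAvg (t : ℝ) (u : E3 → E3) (x : E3) : E3 := ∫ y, u (x + y) ∂(gaussianMeasure t)

theorem measurable_heatAvg {t : ℝ} (ht : 0 < t) {u : E3 → E3} (hu : Measurable u) :
    Measurable (heatAvg t u) := by
  have := isProbabilityMeasure_gaussianMeasure ht
  have : StronglyMeasurable fun z : E3 × E3 => u (z.1 + z.2) :=
    (hu.comp (by fun_prop)).stronglyMeasurable
  exact this.integral_prod_right'.measurable

theorem norm_heatAvg_le {t M : ℝ} (ht : 0 < t) {u : E3 → E3} (hM : ∀ x, ‖u x‖ ≤ M) (x : E3) :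
    ‖heatAvg t u x‖ ≤ M := by
  have := isProbabilityMeasure_gaussianMeasure ht
  have h := norm_integral_le_of_norm_le_const (μ := gaussianMeasure t)
    (ae_of_all _ fun y => hM (x + y))
  rwa [probReal_univ, mul_one] at h

theorem integrable_comp_add_gaussianMeasure {t M : ℝ} (ht : 0 < t) {u : E3 → E3}
    (hu : Measurable u) (hM : ∀ x, ‖u x‖ ≤ M) (x : E3) :
    Integrable (fun y => u (x + y)) (gaussianMeasure t) := by
  have := isProbabilityMeasure_gaussianMeasure ht
  exact Integrable.of_bound (hu.comp (by fun_prop)).aestronglyMeasurable M (ae_of_all _ fun y => hM _)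

theorem heatAvg_heatAvg {s t M : ℝ} (hs : 0 < s) (ht : 0 < t) {u : E3 → E3} (hu : Measurable u)
    (hM : ∀ x, ‖u x‖ ≤ M) : heatAvg s (heatAvg t u) = heatAvg (s + t) u := by
  ext1 x
  unfold heatAvg
  have hm : Measurable fun y => u (x + y) := hu.comp (by fun_prop)
  rw [integral_gaussianMeasure_add hs ht hm.stronglyMeasurable
    (integrable_comp_add_gaussianMeasure (add_pos hs ht) hu hM x)]
  simp only [add_assoc]

theorem lintegral_bellman_heatAvg_le {p δ M h : ℝ} (hp : 2 ≤ p) (hδ : 0 ≤ δ) (hh : 0 < h)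
    (hgap : ∀ u u' w w' a : E3, inner ℝ a ((1 / 2 : ℝ) • (w + w'))
      - burkholder p ((1 / 2 : ℝ) • (u + u')) a
      + δ * (‖u - u'‖ * ‖w - w'‖) ≤ (bellman p u w + bellman p u' w') / 2)
    {u w : E3 → E3}
    (hu : Measurable u) (hw : Measurable w) (hMu : ∀ x, ‖u x‖ ≤ M) (hMw : ∀ x, ‖w x‖ ≤ M) :
    ENNReal.ofReal δ * (∫⁻ x, ∫⁻ z, ‖u x - u (x + z)‖ₑ * ‖w x - w (x + z)‖ₑ
        ∂(gaussianMeasure (2 * h)))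
      + ∫⁻ x, ENNReal.ofReal (bellman p (heatAvg h u x) (heatAvg h w x))
      ≤ ∫⁻ x, ENNReal.ofReal (bellman p (u x) (w x)) := by
  have := isProbabilityMeasure_gaussianMeasure hh
  have h2 : (0 : ℝ) < 2 * h := by positivity
  have := isProbabilityMeasure_gaussianMeasure h2
  set k : E3 → ℝ≥0∞ := fun z => ∫⁻ x, ‖u x - u (x + z)‖ₑ * ‖w x - w (x + z)‖ₑ with hk
  have hG1 : Measurable fun q : E3 × E3 => ‖u q.1 - u (q.1 + q.2)‖ₑ * ‖w q.1 - w (q.1 + q.2)‖ₑ := by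
    have a1 : Measurable fun q : E3 × E3 => u q.1 - u (q.1 + q.2) :=
      (hu.comp measurable_fst).sub (hu.comp (by fun_prop))
    have a2 : Measurable fun q : E3 × E3 => w q.1 - w (q.1 + q.2) :=
      (hw.comp measurable_fst).sub (hw.comp (by fun_prop))
    exact a1.enorm.mul a2.enorm
  have hkm : Measurable k := hG1.lintegral_prod_left'
  have hG3 : Measurable fun q : E3 × E3 × E3 =>
      ‖u (q.1 + q.2.1) - u (q.1 + q.2.2)‖ₑ * ‖w (q.1 + q.2.1) - w (q.1 + q.2.2)‖ₑ := by
    have a1 : Measurable fun q : E3 × E3 × E3 => u (q.1 + q.2.1) - u (q.1 + q.2.2) :=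
      (hu.comp (by fun_prop)).sub (hu.comp (by fun_prop))
    have a2 : Measurable fun q : E3 × E3 × E3 => w (q.1 + q.2.1) - w (q.1 + q.2.2) :=
      (hw.comp (by fun_prop)).sub (hw.comp (by fun_prop))
    exact a1.enorm.mul a2.enorm
  have hBm : Measurable fun x => ENNReal.ofReal (bellman p (u x) (w x)) :=
    (measurable_bellman_comp hp hu hw).ennreal_ofReal
  have e1 : ∫⁻ x, ∫⁻ y, ENNReal.ofReal (bellman p (u (x + y)) (w (x + y))) ∂(gaussianMeasure h)
      = ∫⁻ x, ENNReal.ofReal (bellman p (u x) (w x)) := by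
    rw [lintegral_lintegral_swap]
    · simp_rw [lintegral_add_right_eq_self (fun x => ENNReal.ofReal (bellman p (u x) (w x)))]
      simp
    · exact (hBm.comp (by fun_prop : Measurable fun q : E3 × E3 => q.1 + q.2)).aemeasurable
  have e2 : ∫⁻ x, ∫⁻ y, ∫⁻ z, ‖u (x + y) - u (x + z)‖ₑ * ‖w (x + y) - w (x + z)‖ₑ
        ∂(gaussianMeasure h) ∂(gaussianMeasure h)
      = ∫⁻ x, ∫⁻ z, ‖u x - u (x + z)‖ₑ * ‖w x - w (x + z)‖ₑ ∂(gaussianMeasure (2 * h)) := by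
    have s1 : ∀ x, ∫⁻ y, ∫⁻ z, ‖u (x + y) - u (x + z)‖ₑ * ‖w (x + y) - w (x + z)‖ₑ
        ∂(gaussianMeasure h) ∂(gaussianMeasure h)
        = ∫⁻ q : E3 × E3, ‖u (x + q.1) - u (x + q.2)‖ₑ * ‖w (x + q.1) - w (x + q.2)‖ₑ
          ∂((gaussianMeasure h).prod (gaussianMeasure h)) := fun x =>
      (lintegral_prod _ (hG3.comp (by fun_prop : Measurable fun q : E3 × E3 =>
        (x, q.1, q.2))).aemeasurable).symm
    simp_rw [s1]
    rw [lintegral_lintegral_swap]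
    · have s2 : ∀ q : E3 × E3, ∫⁻ x, ‖u (x + q.1) - u (x + q.2)‖ₑ * ‖w (x + q.1) - w (x + q.2)‖ₑ
          = k (-q.1 + q.2) := fun q => by
        simp only [hk]
        rw [← lintegral_add_right_eq_self
          (fun x => ‖u x - u (x + (-q.1 + q.2))‖ₑ * ‖w x - w (x + (-q.1 + q.2))‖ₑ) q.1]
        simp only [add_assoc, add_neg_cancel_left]
      simp_rw [s2]
      have hkm' : Measurable fun q : E3 × E3 => k (-q.1 + q.2) := hkm.comp (by fun_prop)
      rw [lintegral_prod _ hkm'.aemeasurable]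
      simp only
      rw [lintegral_gaussianMeasure_neg hh (fun y => ∫⁻ z, k (y + z) ∂(gaussianMeasure h)),
        ← lintegral_gaussianMeasure_add hh hh hkm, ← two_mul, hk, lintegral_lintegral_swap]
      exact (hG1.comp measurable_swap).aemeasurable
    · exact (hG3.comp (by fun_prop : Measurable fun q : E3 × E3 × E3 => (q.1, q.2.1, q.2.2))).aemeasurable
  rw [← e1, ← e2, ← lintegral_const_mul' _ _ ENNReal.ofReal_ne_top]
  refine (le_lintegral_add _ _).trans (lintegral_mono fun x => ?_)
  rw [add_comm]
  exact bellman_integral_add_lintegral_le hp hδ hgap (gaussianMeasure h)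
    (hu.comp (by fun_prop : Measurable fun y => x + y))
    (hw.comp (by fun_prop : Measurable fun y => x + y)) (fun y => hMu _) (fun y => hMw _)

theorem sum_lintegral_heatAvg_gap_le {p δ M τ : ℝ} (hp : 2 ≤ p) (hδ : 0 ≤ δ) (hτ : 0 < τ)
    (hgap : ∀ u u' w w' a : E3, inner ℝ a ((1 / 2 : ℝ) • (w + w'))
      - burkholder p ((1 / 2 : ℝ) • (u + u')) a
      + δ * (‖u - u'‖ * ‖w - w'‖) ≤ (bellman p u w + bellman p u' w') / 2)
    {u w : E3 → E3}
    (hu : Measurable u) (hw : Measurable w) (hMu : ∀ x, ‖u x‖ ≤ M) (hMw : ∀ x, ‖w x‖ ≤ M) (n : ℕ) :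
    (∑ k ∈ Finset.range n, ENNReal.ofReal δ * (∫⁻ x, ∫⁻ z,
        ‖heatAvg (2 ^ k * τ) u x - heatAvg (2 ^ k * τ) u (x + z)‖ₑ
        * ‖heatAvg (2 ^ k * τ) w x - heatAvg (2 ^ k * τ) w (x + z)‖ₑ
        ∂(gaussianMeasure (2 * (2 ^ k * τ)))))
      + ∫⁻ x, ENNReal.ofReal (bellman p (heatAvg (2 ^ n * τ) u x) (heatAvg (2 ^ n * τ) w x))
      ≤ ∫⁻ x, ENNReal.ofReal (bellman p (u x) (w x)) := by
  induction n with
  | zero =>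
    simp only [Finset.range_zero, Finset.sum_empty, zero_add, pow_zero, one_mul]
    exact le_trans le_add_self (lintegral_bellman_heatAvg_le hp hδ hτ hgap hu hw hMu hMw)
  | succ n ih =>
    refine le_trans ?_ ih
    rw [Finset.sum_range_succ, add_assoc]
    gcongr
    have hn : 0 < 2 ^ n * τ := by positivity
    have := lintegral_bellman_heatAvg_le hp hδ hn hgap (measurable_heatAvg hn hu)
      (measurable_heatAvg hn hw) (norm_heatAvg_le hn hMu) (norm_heatAvg_le hn hMw)
    rw [heatAvg_heatAvg hn hn hu hMu, heatAvg_heatAvg hn hn hw hMw] at this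
    rwa [pow_succ, show (2 : ℝ) ^ n * 2 * τ = 2 ^ n * τ + 2 ^ n * τ by ring]

/-- The first moment of a vector field against the Gaussian centred at a point. -/
def heatMoment (t : ℝ) (h : E3 → E3) (x : E3) : ℝ :=
  ∫ z, inner ℝ z (h (x + z)) ∂(gaussianMeasure t)

theorem integrable_inner_gaussianMeasure {t M : ℝ} (ht : 0 < t) {h : E3 → E3}
    (hh : Measurable h) (hM : ∀ x, ‖h x‖ ≤ M) :
    Integrable (fun z => (inner ℝ z (h z) : ℝ)) (gaussianMeasure t) := by
  refine ((integrable_norm_gaussianMeasure ht).mul_const M).mono'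
    (by fun_prop) (ae_of_all _ fun z => ?_)
  rw [Real.norm_eq_abs]
  exact (abs_real_inner_le_norm _ _).trans (by gcongr; exact hM z)

theorem heatMoment_add {s t M : ℝ} (hs : 0 < s) (ht : 0 < t) {h : E3 → E3}
    (hh : Measurable h) (hM : ∀ x, ‖h x‖ ≤ M) (x : E3) :
    heatMoment (s + t) h x = heatMoment s (heatAvg t h) x + heatMoment t (heatAvg s h) x := by
  have := isProbabilityMeasure_gaussianMeasure hs
  have := isProbabilityMeasure_gaussianMeasure ht
  have hx : Measurable fun z => h (x + z) := hh.comp (by fun_prop)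
  have hx2 : Measurable fun q : E3 × E3 => h (x + (q.1 + q.2)) := hh.comp (by fun_prop)
  unfold heatMoment
  have i1 : Integrable (fun q : E3 × E3 => (inner ℝ q.1 (h (x + (q.1 + q.2))) : ℝ))
      ((gaussianMeasure s).prod (gaussianMeasure t)) := by
    refine (((integrable_norm_gaussianMeasure hs).mul_const M).comp_fst _).mono'
      (by fun_prop) (ae_of_all _ fun z => ?_)
    rw [Real.norm_eq_abs]
    exact (abs_real_inner_le_norm _ _).trans (by gcongr; exact hM _)
  have i2 : Integrable (fun q : E3 × E3 => (inner ℝ q.2 (h (x + (q.1 + q.2))) : ℝ))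
      ((gaussianMeasure s).prod (gaussianMeasure t)) := by
    refine (((integrable_norm_gaussianMeasure ht).mul_const M).comp_snd _).mono'
      (by fun_prop) (ae_of_all _ fun z => ?_)
    rw [Real.norm_eq_abs]
    exact (abs_real_inner_le_norm _ _).trans (by gcongr; exact hM _)
  rw [integral_gaussianMeasure_add hs ht (by fun_prop)
    (integrable_inner_gaussianMeasure (add_pos hs ht) hx fun _ => hM _)]
  have i3 := i1.add i2
  rw [← integral_prod (fun q : E3 × E3 => (inner ℝ (q.1 + q.2) (h (x + (q.1 + q.2))) : ℝ))
    (i3.congr (ae_of_all _ fun q => (inner_add_left _ _ _).symm))]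
  simp only [inner_add_left]
  rw [integral_add i1 i2, integral_prod _ i1, integral_prod_symm _ i2]
  congr 1
  · refine integral_congr_ae (ae_of_all _ fun z => ?_)
    have : Integrable (fun y => h (x + (z + y))) (gaussianMeasure t) :=
      Integrable.of_bound (hh.comp (by fun_prop)).aestronglyMeasurable M (ae_of_all _ fun y => hM _)
    simp only [heatAvg, add_assoc]
    exact integral_inner this z
  · refine integral_congr_ae (ae_of_all _ fun z => ?_)
    have : Integrable (fun y => h (x + (y + z))) (gaussianMeasure s) :=
      Integrable.of_bound (hh.comp (by fun_prop)).aestronglyMeasurable M (ae_of_all _ fun y => hM _)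
    simp only [heatAvg, add_assoc, add_comm z]
    exact integral_inner this z

theorem heatMoment_three_mul {t M : ℝ} (ht : 0 < t) {h : E3 → E3}
    (hh : Measurable h) (hM : ∀ x, ‖h x‖ ≤ M) (x : E3) :
    heatMoment (3 * t) h x = 3 * heatMoment t (heatAvg (t + t) h) x := by
  have e1 := heatMoment_add (by positivity : 0 < t + t) ht hh hM x
  have e2 := heatMoment_add ht ht (measurable_heatAvg ht hh) (norm_heatAvg_le ht hM) x
  rw [heatAvg_heatAvg ht ht hh hM] at e2
  rw [show 3 * t = t + t + t by ring, e1, e2]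
  ring

section Derivative

variable {φ : E3 → E3} {M t : ℝ}

theorem hasFDerivAt_heatAvg (ht : 0 < t) (hφ : ContDiff ℝ 1 φ) (hM : ∀ x, ‖φ x‖ ≤ M)
    (hM' : ∀ x, ‖fderiv ℝ φ x‖ ≤ M) (x : E3) :
    HasFDerivAt (heatAvg t φ) (∫ y, fderiv ℝ φ (x + y) ∂(gaussianMeasure t)) x := by
  have := isProbabilityMeasure_gaussianMeasure ht
  have hφc := hφ.continuous
  have hφc' := hφ.continuous_fderiv one_ne_zero
  refine hasFDerivAt_integral_of_dominated_of_fderiv_le (bound := fun _ => M)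
    (F' := fun x y => fderiv ℝ φ (x + y)) univ_mem
    (Eventually.of_forall fun x => (by fun_prop)) ?_ (by fun_prop)
    (ae_of_all _ fun y x _ => hM' _) (integrable_const _) (ae_of_all _ fun y x _ => ?_)
  · exact Integrable.of_bound (by fun_prop) M (ae_of_all _ fun y => hM _)
  · exact (hasFDerivAt_comp_add_right y).2 (hφ.differentiable one_ne_zero _).hasFDerivAt

theorem fderiv_heatAvg_apply (ht : 0 < t) (hφ : ContDiff ℝ 1 φ) (hM : ∀ x, ‖φ x‖ ≤ M)
    (hM' : ∀ x, ‖fderiv ℝ φ x‖ ≤ M) (x e : E3) :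
    fderiv ℝ (heatAvg t φ) x e = heatAvg t (fun y => fderiv ℝ φ y e) x := by
  have := isProbabilityMeasure_gaussianMeasure ht
  have hφc' := hφ.continuous_fderiv one_ne_zero
  rw [(hasFDerivAt_heatAvg ht hφ hM hM' x).fderiv, heatAvg, ContinuousLinearMap.integral_apply]
  exact Integrable.of_bound (by fun_prop) M (ae_of_all _ fun y => hM' _)

theorem contDiff_heatAvg (ht : 0 < t) (hφ : ContDiff ℝ 1 φ) (hM : ∀ x, ‖φ x‖ ≤ M)
    (hM' : ∀ x, ‖fderiv ℝ φ x‖ ≤ M) : ContDiff ℝ 1 (heatAvg t φ) := by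
  have := isProbabilityMeasure_gaussianMeasure ht
  have hφc' := hφ.continuous_fderiv one_ne_zero
  rw [contDiff_one_iff_hasFDerivAt]
  refine ⟨_, ?_, hasFDerivAt_heatAvg ht hφ hM hM'⟩
  refine continuous_of_dominated (bound := fun _ => M) (fun x => by fun_prop)
    (fun x => ae_of_all _ fun y => hM' _) (integrable_const _) (ae_of_all _ fun y => by fun_prop)

theorem norm_fderiv_heatAvg_le (ht : 0 < t) (hφ : ContDiff ℝ 1 φ) (hM : ∀ x, ‖φ x‖ ≤ M)
    (hM' : ∀ x, ‖fderiv ℝ φ x‖ ≤ M) (x : E3) : ‖fderiv ℝ (heatAvg t φ) x‖ ≤ M := by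
  have := isProbabilityMeasure_gaussianMeasure ht
  rw [(hasFDerivAt_heatAvg ht hφ hM hM' x).fderiv]
  have h := norm_integral_le_of_norm_le_const (μ := gaussianMeasure t)
    (ae_of_all _ fun y => hM' (x + y))
  rwa [probReal_univ, mul_one] at h

theorem heatMoment_fderiv (ht : 0 < t) (hφ : ContDiff ℝ 1 φ) (hM : ∀ x, ‖φ x‖ ≤ M)
    (hM' : ∀ x, ‖fderiv ℝ φ x‖ ≤ M) (x e : E3) :
    heatMoment (3 * t) (fun y => fderiv ℝ φ y e) x / (6 * t)
      = ∫ z, heatHessian t z e (heatAvg (t + t) φ (x + z)) ∂(gaussianMeasure t) := by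
  have htt : 0 < t + t := by positivity
  have hφc' := hφ.continuous_fderiv one_ne_zero
  have hw := contDiff_heatAvg htt hφ hM hM'
  rw [heatMoment_three_mul ht (M := M * ‖e‖) (by fun_prop)
    fun y => ((fderiv ℝ φ y).le_opNorm e).trans (by gcongr; exact hM' y)]
  have key := integral_inner_fderiv_gaussianMeasure ht e
    (w := fun z => heatAvg (t + t) φ (x + z)) (M := M) (hw.comp (contDiff_const.add contDiff_id))
    (fun z => norm_heatAvg_le htt hM _) (fun z => by
      rw [fderiv_comp_add_left]; exact norm_fderiv_heatAvg_le htt hφ hM hM' _)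
  rw [← key, integral_div, heatMoment]
  simp_rw [fderiv_comp_add_left, fderiv_heatAvg_apply htt hφ hM hM']
  field_simp
  ring

end Derivative

/-- The second argument of `heatHessian` as a linear map. -/
def heatHessianMap (t : ℝ) (z : E3) : E3 →L[ℝ] E3 :=
  (4 * t ^ 2)⁻¹ • (innerSL ℝ z).smulRight z - (2 * t)⁻¹ • ContinuousLinearMap.id ℝ E3

theorem inner_heatHessianMap (t : ℝ) (z a b : E3) :
    inner ℝ a (heatHessianMap t z b) = heatHessian t z a b := by
  simp only [heatHessianMap, heatHessian, sub_apply,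
    smul_apply, ContinuousLinearMap.smulRight_apply, innerSL_apply_apply,
    ContinuousLinearMap.id_apply, inner_sub_right, inner_smul_right]
  rw [real_inner_comm z a]
  ring

theorem measurable_heatHessian_comp {α : Type*} [MeasurableSpace α] {t : ℝ} {a b c : α → E3}
    (ha : Measurable a) (hb : Measurable b) (hc : Measurable c) :
    Measurable fun x => heatHessian t (a x) (b x) (c x) := by
  unfold heatHessian
  exact (((ha.inner hb).mul (ha.inner hc)).div_const _).sub ((hb.inner hc).div_const _)

theorem integrable_heatWeight {t : ℝ} (ht : 0 < t) :
    Integrable (fun z : E3 => ‖z‖ ^ 2 / (4 * t ^ 2) + 1 / (2 * t)) (gaussianMeasure t) := by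
  have := isProbabilityMeasure_gaussianMeasure ht
  exact ((integrable_norm_sq_gaussianMeasure ht).div_const _).add (integrable_const _)

theorem integrable_comp_add_prod_gaussianMeasure {t : ℝ} (ht : 0 < t) {g : E3 → E3}
    (hi : Integrable g) :
    Integrable (fun q : E3 × E3 => g (q.2 + q.1)) ((gaussianMeasure t).prod volume) := by
  have := isProbabilityMeasure_gaussianMeasure ht
  have hmp : MeasurePreserving (fun q : E3 × E3 => (q.1, q.2 + q.1))
      ((gaussianMeasure t).prod volume) ((gaussianMeasure t).prod volume) :=
    (MeasurePreserving.id _).skew_product (g := fun a b => b + a) (by fun_prop)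
      (ae_of_all _ fun a => map_add_right_eq_self _ a)
  exact hmp.integrable_comp_of_integrable (hi.comp_snd _)

theorem integrable_heatAvg {t : ℝ} (ht : 0 < t) {g : E3 → E3} (hi : Integrable g) :
    Integrable (heatAvg t g) := by
  have := isProbabilityMeasure_gaussianMeasure ht
  exact (integrable_comp_add_prod_gaussianMeasure ht hi).integral_prod_right

theorem integral_inner_heatAvg {t M : ℝ} (ht : 0 < t) {g k : E3 → E3} (hi : Integrable g)
    (hg : Measurable g) (hMg : ∀ x, ‖g x‖ ≤ M)
    (hk : Measurable k) (hM : ∀ x, ‖k x‖ ≤ M) :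
    ∫ x, (inner ℝ (heatAvg t g x) (k x) : ℝ) = ∫ x, (inner ℝ (g x) (heatAvg t k x) : ℝ) := by
  have := isProbabilityMeasure_gaussianMeasure ht
  have e1 : ∀ x, (inner ℝ (heatAvg t g x) (k x) : ℝ)
      = ∫ y, (inner ℝ (g (x + y)) (k x) : ℝ) ∂(gaussianMeasure t) := fun x => by
    rw [real_inner_comm, heatAvg, ← integral_inner (integrable_comp_add_gaussianMeasure ht hg hMg x)]
    simp only [real_inner_comm]
  have e2 : ∀ x, (inner ℝ (g x) (heatAvg t k x) : ℝ)
      = ∫ y, (inner ℝ (g x) (k (x + y)) : ℝ) ∂(gaussianMeasure t) := fun x =>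
    (integral_inner (integrable_comp_add_gaussianMeasure ht hk hM x) _).symm
  have i1 : Integrable (fun q : E3 × E3 => (inner ℝ (g (q.1 + q.2)) (k q.1) : ℝ))
      (volume.prod (gaussianMeasure t)) := by
    refine ((integrable_comp_add_prod_gaussianMeasure ht hi).swap.norm.mul_const M).mono' ?_
      (ae_of_all _ fun q => ?_)
    · exact ((hg.comp (measurable_fst.add measurable_snd)).inner
        (hk.comp measurable_fst)).aestronglyMeasurable
    · exact (norm_inner_le_norm _ _).trans (mul_le_mul_of_nonneg_left (hM _) (norm_nonneg _))
  have i2 : Integrable (fun q : E3 × E3 => (inner ℝ (g q.1) (k (q.1 + q.2)) : ℝ))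
      (volume.prod (gaussianMeasure t)) := by
    refine ((hi.norm.mul_const M).comp_fst (gaussianMeasure t)).mono' ?_ (ae_of_all _ fun q => ?_)
    · exact ((hg.comp measurable_fst).inner
        (hk.comp (measurable_fst.add measurable_snd))).aestronglyMeasurable
    · exact (norm_inner_le_norm _ _).trans (mul_le_mul_of_nonneg_left (hM _) (norm_nonneg _))
  simp_rw [e1, e2]
  refine (integral_integral_swap i1).trans (Eq.trans ?_ (integral_integral_swap i2).symm)
  rw [← integral_gaussianMeasure_neg ht]
  refine integral_congr_ae (ae_of_all _ fun y => ?_)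
  simp only
  rw [← integral_add_right_eq_self _ y]
  simp only [add_neg_cancel_right]

theorem integral_sub_sub_add {α : Type*} [MeasurableSpace α] {μ : Measure α} {f₁ f₂ f₃ f₄ : α → ℝ}
    (h₁ : Integrable f₁ μ) (h₂ : Integrable f₂ μ) (h₃ : Integrable f₃ μ) (h₄ : Integrable f₄ μ) :
    ∫ x, (f₁ x - f₂ x - f₃ x + f₄ x) ∂μ
      = ∫ x, f₁ x ∂μ - ∫ x, f₂ x ∂μ - ∫ x, f₃ x ∂μ + ∫ x, f₄ x ∂μ := by
  have h₁₂ : Integrable (fun x => f₁ x - f₂ x) μ := h₁.sub h₂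
  have h₁₃ : Integrable (fun x => f₁ x - f₂ x - f₃ x) μ := h₁₂.sub h₃
  rw [integral_add h₁₃ h₄, integral_sub h₁₂ h₃, integral_sub h₁ h₂]

theorem integral_heatHessian_heatAvg {t M : ℝ} (ht : 0 < t) {g φ : E3 → E3} (hi : Integrable g)
    (hg : Measurable g) (hMg : ∀ x, ‖g x‖ ≤ M)
    (hφ : Measurable φ) (hM : ∀ x, ‖φ x‖ ≤ M) (z : E3) :
    ∫ x, heatHessian t z (heatAvg t g x) (φ (x + z))
      = ∫ x, heatHessian t z (g x) (heatAvg t φ (x + z)) := by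
  have := isProbabilityMeasure_gaussianMeasure ht
  simp_rw [← inner_heatHessianMap]
  have hm : Measurable fun x => heatHessianMap t z (φ (x + z)) :=
    (heatHessianMap t z).continuous.measurable.comp (hφ.comp (by fun_prop))
  rw [integral_inner_heatAvg ht (M := max M (‖heatHessianMap t z‖ * M)) hi hg
    (fun x => (hMg x).trans (le_max_left _ _)) hm fun x => le_max_of_le_right
      (((heatHessianMap t z).le_opNorm _).trans (by gcongr; exact hM _))]
  congr 1
  ext x
  congr 1
  rw [heatAvg, heatAvg, (heatHessianMap t z).integral_comp_comm
    (by simpa only [add_right_comm] using integrable_comp_add_gaussianMeasure ht hφ hM (x + z))]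
  simp only [add_right_comm]

theorem integral_heatHessian_polarization {t M : ℝ} (ht : 0 < t) {u w : E3 → E3} (hi : Integrable u)
    (hu : Measurable u) (hw : Measurable w) (hM : ∀ x, ‖w x‖ ≤ M) :
    ∫ z, ∫ x, heatHessian t z (u x) (w (x + z)) ∂volume ∂(gaussianMeasure t)
      = -(1 / 2) * ∫ z, ∫ x, heatHessian t z (u x - u (x + z)) (w x - w (x + z))
          ∂volume ∂(gaussianMeasure t) := by
  have := isProbabilityMeasure_gaussianMeasure ht
  have hM0 : 0 ≤ M := (norm_nonneg _).trans (hM 0)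
  set J : E3 → ℝ := fun z => ∫ x, heatHessian t z (u x) (w (x + z)) with hJ
  set D : E3 → ℝ := fun z => ∫ x, heatHessian t z (u x) (w x) with hD
  have bnd : ∀ z a b, ‖b‖ ≤ M → ‖heatHessian t z a b‖ ≤
      (‖z‖ ^ 2 / (4 * t ^ 2) + 1 / (2 * t)) * (‖a‖ * M) := fun z a b hb =>
    (abs_heatHessian_le ht z a b).trans (by gcongr)
  have iP : ∀ b : E3 × E3 → E3, Measurable b → (∀ q, ‖b q‖ ≤ M) →
      Integrable (fun q : E3 × E3 => heatHessian t q.1 (u q.2) (b q))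
        ((gaussianMeasure t).prod volume) := fun b hb hbM =>
    ((integrable_heatWeight ht).mul_prod (hi.norm.mul_const M)).mono'
      (measurable_heatHessian_comp measurable_fst (hu.comp measurable_snd) hb).aestronglyMeasurable
      (ae_of_all _ fun q => bnd _ _ _ (hbM q))
  have iF : ∀ z, ∀ a b : E3 → E3, Integrable a → Measurable a → Measurable b → (∀ q, ‖b q‖ ≤ M) →
      Integrable (fun x => heatHessian t z (a x) (b x)) := fun z a b ha ham hb hbM =>
    ((ha.norm.mul_const M).const_mul _).mono'
      (measurable_heatHessian_comp measurable_const ham hb).aestronglyMeasurable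
      (ae_of_all _ fun q => bnd _ _ _ (hbM q))
  have hwa : ∀ z, Measurable fun x => w (x + z) := fun z => hw.comp (by fun_prop)
  have hua : ∀ z, Measurable fun x => u (x + z) := fun z => hu.comp (by fun_prop)
  have iJ : Integrable J (gaussianMeasure t) :=
    (iP (fun q => w (q.2 + q.1)) (hw.comp (by fun_prop)) fun _ => hM _).integral_prod_left
  have iDp := iP (fun q => w q.2) (hw.comp (by fun_prop)) fun _ => hM _
  have iD : Integrable D (gaussianMeasure t) := iDp.integral_prod_left
  have hD0 : ∫ z, D z ∂(gaussianMeasure t) = 0 := by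
    simp only [hD]
    rw [integral_integral_swap iDp]
    simp only [integral_heatHessian ht, integral_zero]
  have key : ∀ z, ∫ x, heatHessian t z (u x - u (x + z)) (w x - w (x + z))
      = D z - J z - J (-z) + D z := fun z => by
    have h1 : ∀ x, heatHessian t z (u x - u (x + z)) (w x - w (x + z))
        = heatHessian t z (u x) (w x) - heatHessian t z (u x) (w (x + z))
          - heatHessian t z (u (x + z)) (w x) + heatHessian t z (u (x + z)) (w (x + z)) := fun x => by
      simp only [← inner_heatHessianMap, map_sub, inner_sub_left, inner_sub_right]
      ring
    have i1 := iF z _ _ hi hu hw hM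
    have i2 := iF z _ _ hi hu (hwa z) (fun _ => hM _)
    have i3 := iF z _ _ (hi.comp_add_right z) (hua z) hw hM
    have i4 := iF z _ _ (hi.comp_add_right z) (hua z) (hwa z) (fun _ => hM _)
    simp_rw [h1]
    rw [integral_sub_sub_add i1 i2 i3 i4]
    congr 1
    · congr 1
      simp only [hJ]
      rw [← integral_add_right_eq_self (fun x => heatHessian t (-z) (u x) (w (x + -z))) z]
      simp only [add_neg_cancel_right]
      simp [heatHessian]
    · exact integral_add_right_eq_self (fun x => heatHessian t z (u x) (w x)) z
  have iJn : Integrable (fun z => J (-z)) (gaussianMeasure t) := by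
    have : MeasurePreserving (fun z : E3 => -z) (gaussianMeasure t) (gaussianMeasure t) :=
      ⟨measurable_neg, map_neg_gaussianMeasure ht⟩
    exact this.integrable_comp_of_integrable iJ
  simp_rw [key]
  rw [integral_sub_sub_add iD iJ iJn iD, hD0,
    integral_gaussianMeasure_neg ht J]
  ring

theorem enorm_integral_heatHessian_le {t M : ℝ} (ht : 0 < t) {u w : E3 → E3} (hi : Integrable u)
    (hu : Measurable u) (hw : Measurable w) (hM : ∀ x, ‖w x‖ ≤ M) :
    ‖∫ z, ∫ x, heatHessian t z (u x) (w (x + z)) ∂volume ∂(gaussianMeasure t)‖ₑ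
      ≤ ENNReal.ofReal (3 / t) * ∫⁻ x, ∫⁻ z, ‖u x - u (x + z)‖ₑ * ‖w x - w (x + z)‖ₑ
          ∂(gaussianMeasure (2 * t)) := by
  have := isProbabilityMeasure_gaussianMeasure ht
  have := isProbabilityMeasure_gaussianMeasure (by positivity : 0 < 2 * t)
  have hG : Measurable fun q : E3 × E3 => ‖u q.1 - u (q.1 + q.2)‖ₑ * ‖w q.1 - w (q.1 + q.2)‖ₑ := by
    have a1 : Measurable fun q : E3 × E3 => u q.1 - u (q.1 + q.2) :=
      (hu.comp measurable_fst).sub (hu.comp (by fun_prop))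
    have a2 : Measurable fun q : E3 × E3 => w q.1 - w (q.1 + q.2) :=
      (hw.comp measurable_fst).sub (hw.comp (by fun_prop))
    exact a1.enorm.mul a2.enorm
  rw [lintegral_lintegral_swap hG.aemeasurable, lintegral_gaussianMeasure,
    integral_heatHessian_polarization ht hi hu hw hM, enorm_mul]
  have h1 : ‖(-(1 / 2) : ℝ)‖ₑ = ENNReal.ofReal (1 / 2) := by
    rw [enorm_neg, Real.enorm_of_nonneg (by norm_num)]
  set k : E3 → ℝ≥0∞ := fun z => ∫⁻ x, ‖u x - u (x + z)‖ₑ * ‖w x - w (x + z)‖ₑ with hk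
  have h2 : ‖∫ z, ∫ x, heatHessian t z (u x - u (x + z)) (w x - w (x + z))
          ∂volume ∂(gaussianMeasure t)‖ₑ
      ≤ ∫⁻ z, ENNReal.ofReal (‖z‖ ^ 2 / (4 * t ^ 2) + 1 / (2 * t)) * k z ∂(gaussianMeasure t) := by
    refine (enorm_integral_le_lintegral_enorm _).trans (lintegral_mono fun z => ?_)
    refine (enorm_integral_le_lintegral_enorm _).trans ?_
    rw [hk, ← lintegral_const_mul' _ _ ENNReal.ofReal_ne_top]
    refine lintegral_mono fun x => ?_
    rw [← ofReal_norm, ← ofReal_norm, ← ofReal_norm,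
      ← ENNReal.ofReal_mul (norm_nonneg _), ← ENNReal.ofReal_mul (by positivity)]
    exact ENNReal.ofReal_le_ofReal (abs_heatHessian_le ht _ _ _)
  rw [h1]
  refine (mul_le_mul_right h2 _).trans ?_
  rw [lintegral_gaussianMeasure, ← lintegral_const_mul' _ _ ENNReal.ofReal_ne_top,
    ← lintegral_const_mul' _ _ ENNReal.ofReal_ne_top]
  refine lintegral_mono fun z => ?_
  simp only [← mul_assoc]
  refine mul_le_mul_left ?_ _
  have h0 := heatKernel_nonneg ht.le z
  rw [← ENNReal.ofReal_mul (by norm_num), ← ENNReal.ofReal_mul (by positivity),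
    ← ENNReal.ofReal_mul (by positivity)]
  refine ENNReal.ofReal_le_ofReal ?_
  have h3 := heatKernel_mul_le ht z
  have h4 : 3 / t * heatKernel (2 * t) z = 1 / 2 * (6 / t * heatKernel (2 * t) z) := by ring
  rw [h4]
  nlinarith

theorem enorm_integral_heatMoment_le {t M : ℝ} (ht : 0 < t) {g φ : E3 → E3} (hi : Integrable g)
    (hg : Measurable g) (hMg : ∀ x, ‖g x‖ ≤ M) (hφ : ContDiff ℝ 1 φ) (hM : ∀ x, ‖φ x‖ ≤ M)
    (hM' : ∀ x, ‖fderiv ℝ φ x‖ ≤ M) :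
    ‖∫ x, heatMoment (3 * t) (fun y => fderiv ℝ φ y (g x)) x / (6 * t)‖ₑ
      ≤ ENNReal.ofReal (3 / t) * ∫⁻ x, ∫⁻ z,
          ‖heatAvg t g x - heatAvg t g (x + z)‖ₑ * ‖heatAvg t φ x - heatAvg t φ (x + z)‖ₑ
          ∂(gaussianMeasure (2 * t)) := by
  have := isProbabilityMeasure_gaussianMeasure ht
  have hφm := hφ.continuous.measurable
  have htt : 0 < t + t := by positivity
  refine le_trans (le_of_eq ?_) (enorm_integral_heatHessian_le ht (integrable_heatAvg ht hi)
    (measurable_heatAvg ht hg) (measurable_heatAvg ht hφm) (norm_heatAvg_le ht hM))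
  congr 1
  simp_rw [integral_heatHessian_heatAvg ht hi hg hMg (measurable_heatAvg ht hφm)
    (norm_heatAvg_le ht hM), heatAvg_heatAvg ht ht hφm hM, heatMoment_fderiv ht hφ hM hM']
  refine integral_integral_swap ?_
  have hw := measurable_heatAvg htt hφm
  refine ((hi.norm.mul_const M).mul_prod (integrable_heatWeight ht)).mono'
    (measurable_heatHessian_comp measurable_snd (hg.comp measurable_fst)
      (hw.comp (measurable_fst.add measurable_snd))).aestronglyMeasurable
    (ae_of_all _ fun q => ?_)
  refine (abs_heatHessian_le ht _ _ _).trans ?_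
  rw [mul_comm]
  gcongr
  exact norm_heatAvg_le htt hM _

theorem integrableOn_ball_norm_rpow {a : ℝ} (ha : -3 < a) (r : ℝ) :
    IntegrableOn (fun z : E3 => ‖z‖ ^ a) (Metric.ball 0 r) := by
  rw [integrableOn_fun_norm_addHaar (f := fun y => y ^ a) volume]
  rcases le_or_gt r 0 with hr | hr
  · rw [Ioo_eq_empty (not_lt.2 hr)]; exact integrableOn_empty
  have h := (intervalIntegral.integrableOn_Ioo_rpow_iff (s := 2 + a) hr).2 (by linarith)
  refine h.congr_fun (fun y hy => ?_) measurableSet_Ioo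
  simp only [finrank_euclideanSpace, Fintype.card_fin, smul_eq_mul]
  rw [Real.rpow_add hy.1]
  norm_num

theorem integrableOn_compl_ball_norm_rpow {a r : ℝ} (ha : a < -3) (hr : 0 < r) :
    IntegrableOn (fun z : E3 => ‖z‖ ^ a) (Metric.ball 0 r)ᶜ := by
  rw [← integrable_indicator_iff measurableSet_ball.compl]
  have e : (Metric.ball (0 : E3) r)ᶜ.indicator (fun z : E3 => ‖z‖ ^ a)
      = fun z => (Ici r).indicator (fun y => y ^ a) ‖z‖ := by
    ext z
    simp [indicator]
  rw [e, integrable_fun_norm_addHaar (f := (Ici r).indicator fun y => y ^ a) volume]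
  have h := (integrableOn_Ioi_rpow_iff (s := 2 + a) hr).2 (by linarith)
  rw [← integrableOn_Ici_iff_integrableOn_Ioi, ← integrable_indicator_iff measurableSet_Ici] at h
  refine h.integrableOn.congr_fun (fun y hy => ?_) measurableSet_Ioi
  rw [finrank_euclideanSpace, Fintype.card_fin, smul_eq_mul]
  by_cases hyr : y ∈ Ici r
  · rw [indicator_of_mem hyr, indicator_of_mem hyr, Real.rpow_add hy]
    norm_num
  · rw [indicator_of_notMem hyr, indicator_of_notMem hyr, mul_zero]

theorem lintegral_Ioc_two_pow_mul {h : ℝ → ℝ≥0∞} (hh : Measurable h) {a : ℝ} (ha : 0 < a) (n : ℕ) :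
    ∫⁻ τ in Ioc a (2 ^ n * a), h τ
      = ∫⁻ τ in Ioc a (2 * a), ∑ k ∈ Finset.range n, ENNReal.ofReal (2 ^ k) * h (2 ^ k * τ) := by
  induction n with
  | zero => simp
  | succ n ih =>
    have h1 : a ≤ 2 ^ n * a := le_mul_of_one_le_left ha.le (one_le_pow₀ (by norm_num))
    have h2 : (2 : ℝ) ^ n * a ≤ 2 ^ (n + 1) * a := by
      gcongr
      · norm_num
      · omega
    rw [← Ioc_union_Ioc_eq_Ioc h1 h2, lintegral_union measurableSet_Ioc
      (Ioc_disjoint_Ioc_of_le le_rfl), ih]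
    have hm : ∀ k : ℕ, Measurable fun τ => h (2 ^ k * τ) := fun k => hh.comp (by fun_prop)
    simp_rw [Finset.sum_range_succ]
    rw [lintegral_add_right _ ((hm n).const_mul _)]
    congr 1
    have hp : (0 : ℝ) < 2 ^ n := by positivity
    have key := Real.smul_map_volume_mul_left hp.ne'
    conv_lhs => rw [← key]
    rw [Measure.restrict_smul, lintegral_smul_measure, setLIntegral_map measurableSet_Ioc hh
      (by fun_prop), lintegral_const_mul _ (hm n), abs_of_pos hp, smul_eq_mul]
    congr 2
    congr 1
    ext τ
    simp only [mem_preimage, mem_Ioc, pow_succ, mul_assoc, mul_lt_mul_iff_right₀ hp,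
      mul_le_mul_iff_right₀ hp]

theorem lintegral_Ioi_le_of_dyadic {h : ℝ → ℝ≥0∞} (hh : Measurable h) {A : ℝ≥0∞}
    (hA : ∀ τ, 0 < τ → ∀ n, ∑ k ∈ Finset.range n,
      ENNReal.ofReal (2 ^ k * τ) * h (2 ^ k * τ) ≤ A) :
    ∫⁻ τ in Ioi 0, h τ ≤ A := by
  have step : ∀ a, 0 < a → ∀ n, ∫⁻ τ in Ioc a (2 ^ n * a), h τ ≤ A := fun a ha n => by
    rw [lintegral_Ioc_two_pow_mul hh ha]
    calc _ ≤ ∫⁻ _ in Ioc a (2 * a), ENNReal.ofReal a⁻¹ * A := by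
          refine setLIntegral_mono' measurableSet_Ioc fun τ hτ => ?_
          have hτ0 := ha.trans hτ.1
          refine le_trans ?_ (mul_le_mul_right (hA τ hτ0 n) _)
          rw [Finset.mul_sum]
          refine Finset.sum_le_sum fun k _ => ?_
          rw [← mul_assoc, ← ENNReal.ofReal_mul (by positivity)]
          gcongr
          rw [mul_comm, mul_assoc]
          refine le_mul_of_one_le_right (by positivity) ?_
          rw [← div_eq_mul_inv, one_le_div ha]
          exact hτ.1.le
      _ = A := by
          rw [setLIntegral_const, Real.volume_Ioc, mul_right_comm,
            ← ENNReal.ofReal_mul (by positivity)]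
          rw [show a⁻¹ * (2 * a - a) = 1 by field_simp; ring, ENNReal.ofReal_one, one_mul]
  have hU : Ioi (0 : ℝ) = ⋃ n : ℕ, Ioc ((2 : ℝ) ^ n)⁻¹ (2 ^ (2 * n) * ((2 : ℝ) ^ n)⁻¹) := by
    ext x
    simp only [mem_Ioi, mem_iUnion, mem_Ioc]
    constructor
    · intro hx
      obtain ⟨n, hn⟩ := pow_unbounded_of_one_lt (max x x⁻¹) (one_lt_two (α := ℝ))
      refine ⟨n, ?_, ?_⟩
      · exact inv_lt_of_inv_lt₀ hx ((le_max_right _ _).trans_lt hn)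
      · rw [two_mul, pow_add, mul_inv_cancel_right₀ (by positivity)]
        exact (le_max_left _ _).trans hn.le
    · rintro ⟨n, hn, -⟩
      exact lt_trans (by positivity) hn
  rw [hU, setLIntegral_iUnion_of_directed]
  · exact iSup_le fun n => step _ (by positivity) _
  · refine directed_of_isDirected_le fun m n hmn => Ioc_subset_Ioc ?_ ?_
    · gcongr; norm_num
    · rw [two_mul, two_mul, pow_add, pow_add, mul_inv_cancel_right₀ (by positivity),
        mul_inv_cancel_right₀ (by positivity)]
      gcongr; norm_num

theorem integrableOn_rpow_mul_exp_neg_inv {b : ℝ} (hb : 0 < b) :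
    IntegrableOn (fun τ : ℝ => τ ^ (-(5 / 2) : ℝ) * Real.exp (-(b / τ))) (Ioi 0) := by
  rw [← integrableOn_Ioi_comp_rpow_iff _ (p := -1) (by norm_num)]
  have h := integrableOn_rpow_mul_exp_neg_mul_rpow (p := 1) (s := 1 / 2) (by norm_num)
    one_pos hb
  refine h.congr_fun (fun s hs => ?_) measurableSet_Ioi
  have hs' : (0 : ℝ) < s := hs
  simp only [abs_neg, abs_one, one_mul, smul_eq_mul, Real.rpow_one]
  rw [← Real.rpow_mul hs'.le, ← mul_assoc, ← Real.rpow_add hs', Real.rpow_neg_one, div_inv_eq_mul]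
  norm_num

theorem exists_integral_heatKernel_eq :
    ∃ c : ℝ, 0 < c ∧ ∀ z : E3, z ≠ 0 →
      IntegrableOn (fun τ => heatKernel (3 * τ) z / (6 * τ)) (Ioi 0) ∧
      ∫ τ in Ioi 0, heatKernel (3 * τ) z / (6 * τ) = c * (‖z‖ ^ 3)⁻¹ := by
  set k : ℝ → ℝ := fun τ => (12 * Real.pi) ^ (-(3 / 2) : ℝ) / 6 *
    (τ ^ (-(5 / 2) : ℝ) * Real.exp (-((1 / 12) / τ))) with hk
  have hki : IntegrableOn k (Ioi 0) := (integrableOn_rpow_mul_exp_neg_inv (by norm_num)).const_mul _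
  have hpos : ∀ τ ∈ Ioi (0 : ℝ), 0 < k τ := fun τ hτ => by
    have : (0 : ℝ) < τ := hτ
    simp only [hk]; positivity
  have hheat : ∀ z : E3, z ≠ 0 → ∀ τ ∈ Ioi (0 : ℝ), (‖z‖ ^ 3)⁻¹ * ((‖z‖ ^ 2)⁻¹ * k ((‖z‖ ^ 2)⁻¹ * τ))
      = heatKernel (3 * τ) z / (6 * τ) := fun z hz τ hτ => by
    have hτ0 : (0 : ℝ) < τ := hτ
    have hz0 : 0 < ‖z‖ := norm_pos_iff.2 hz
    simp only [hk, heatKernel]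
    have e1 : (4 * Real.pi * (3 * τ)) ^ (-(3 / 2) : ℝ)
        = (12 * Real.pi) ^ (-(3 / 2) : ℝ) * τ ^ (-(3 / 2) : ℝ) := by
      rw [← Real.mul_rpow (by positivity) hτ0.le]; congr 1; ring
    have e2 : ((‖z‖ ^ 2)⁻¹ * τ) ^ (-(5 / 2) : ℝ) = ‖z‖ ^ 5 * (τ ^ (-(3 / 2) : ℝ) / τ) := by
      rw [Real.mul_rpow (by positivity) hτ0.le, ← Real.rpow_natCast ‖z‖ 2,
        ← Real.rpow_neg hz0.le, ← Real.rpow_mul hz0.le, ← Real.rpow_sub_one hτ0.ne', ← Real.rpow_natCast ‖z‖ 5]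
      norm_num
    have e3 : -(1 / 12 / ((‖z‖ ^ 2)⁻¹ * τ)) = -(4 * (3 * τ))⁻¹ * ‖z‖ ^ 2 := by
      field_simp; ring
    rw [e1, e2, e3]
    field_simp
  refine ⟨∫ τ in Ioi 0, k τ, ?_, fun z hz => ⟨?_, ?_⟩⟩
  · rw [setIntegral_pos_iff_support_of_nonneg_ae _ hki]
    · refine lt_of_lt_of_le ?_ (measure_mono (subset_inter (fun τ hτ => (hpos τ hτ).ne') subset_rfl))
      simp
    · filter_upwards [ae_restrict_mem measurableSet_Ioi] with τ hτ using (hpos τ hτ).le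
  · have hz0 : 0 < ‖z‖ := norm_pos_iff.2 hz
    have h := (integrableOn_Ioi_comp_mul_left_iff k 0 (a := (‖z‖ ^ 2)⁻¹) (by positivity)).2
      (by simpa using hki)
    exact IntegrableOn.congr_fun ((h.const_mul (‖z‖ ^ 2)⁻¹).const_mul (‖z‖ ^ 3)⁻¹) (hheat z hz)
      measurableSet_Ioi
  · have hz0 : 0 < ‖z‖ := norm_pos_iff.2 hz
    rw [← setIntegral_congr_fun measurableSet_Ioi (hheat z hz), integral_const_mul,
      integral_const_mul, integral_comp_mul_left_Ioi k 0 (by positivity), mul_zero, smul_eq_mul,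
      inv_inv, inv_mul_cancel_left₀ (by positivity), mul_comm]

theorem integrable_norm_mul_norm_comp_add {g : E3 → E3} {G : Type*} [NormedAddCommGroup G]
    {h : E3 → G} (hg : Integrable g) (hh : Integrable h) :
    Integrable (fun q : E3 × E3 => ‖g q.1‖ * ‖h (q.1 + q.2)‖) (volume.prod volume) :=
  (measurePreserving_prod_add (volume : Measure E3) (volume : Measure E3)).integrable_comp_of_integrable
    (hg.norm.mul_prod hh.norm)

section Pairing

variable {g φ : E3 → E3} {M : ℝ}

theorem measurable_inner_fderiv_pairing (hg : Measurable g) (hφ : ContDiff ℝ 1 φ) :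
    Measurable fun q : E3 × E3 => (inner ℝ q.2 (fderiv ℝ φ (q.1 + q.2) (g q.1)) : ℝ) := by
  have hc := hφ.continuous_fderiv one_ne_zero
  have h1 : Measurable fun q : E3 × E3 => fderiv ℝ φ (q.1 + q.2) :=
    (hc.comp (continuous_fst.add continuous_snd)).measurable
  have h2 : Measurable fun q : E3 × E3 => (fderiv ℝ φ (q.1 + q.2), g q.1) :=
    h1.prodMk (hg.comp measurable_fst)
  have h3 : Continuous fun r : (E3 →L[ℝ] E3) × E3 => r.1 r.2 := isBoundedBilinearMap_apply.continuous
  have h4 : Measurable fun q : E3 × E3 => fderiv ℝ φ (q.1 + q.2) (g q.1) := h3.measurable.comp h2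
  exact measurable_snd.inner h4

theorem abs_inner_fderiv_le (x z : E3) :
    |(inner ℝ z (fderiv ℝ φ (x + z) (g x)) : ℝ)| ≤ ‖z‖ * (‖fderiv ℝ φ (x + z)‖ * ‖g x‖) :=
  (abs_real_inner_le_norm _ _).trans (by gcongr; exact ContinuousLinearMap.le_opNorm _ _)

theorem integrable_inner_fderiv_div_norm (hi : Integrable g) (hg : Measurable g)
    (hφ : ContDiff ℝ 1 φ) (hφc : HasCompactSupport φ) :
    Integrable (fun q : E3 × E3 => (‖q.2‖ ^ 3)⁻¹ *
      (inner ℝ q.2 (fderiv ℝ φ (q.1 + q.2) (g q.1)) : ℝ)) (volume.prod volume) := by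
  have hc := hφ.continuous_fderiv one_ne_zero
  have hcs := hφc.fderiv (𝕜 := ℝ)
  obtain ⟨M, hM⟩ := hcs.exists_bound_of_continuous hc
  have hM0 : 0 ≤ M := (norm_nonneg _).trans (hM 0)
  have hball := (integrable_indicator_iff measurableSet_ball).2
    (integrableOn_ball_norm_rpow (a := -2) (by norm_num) 1)
  refine ((hi.norm.mul_prod (hball.const_mul M)).add
    (integrable_norm_mul_norm_comp_add (g := g) (h := fderiv ℝ φ) hi
      (hc.integrable_of_hasCompactSupport hcs))).mono' ?_ (ae_of_all _ fun q => ?_)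
  · exact (((measurable_snd.norm.pow_const 3).inv).mul
      (measurable_inner_fderiv_pairing hg hφ)).aestronglyMeasurable
  simp only [Pi.add_apply]
  rcases eq_or_ne q.2 0 with hz | hz
  · rw [hz]
    simp only [norm_zero, ne_eq, OfNat.ofNat_ne_zero, not_false_eq_true, zero_pow, inv_zero,
      zero_mul]
    have : 0 ≤ (Metric.ball (0 : E3) 1).indicator (fun z : E3 => ‖z‖ ^ (-2 : ℝ)) 0 :=
      indicator_nonneg (fun z _ => by positivity) _
    positivity
  have hz0 : 0 < ‖q.2‖ := norm_pos_iff.2 hz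
  rw [norm_mul, norm_inv, norm_pow, norm_norm, Real.norm_eq_abs]
  have h1 := abs_inner_fderiv_le (g := g) (φ := φ) q.1 q.2
  have h2 : (‖q.2‖ ^ 3)⁻¹ * |(inner ℝ q.2 (fderiv ℝ φ (q.1 + q.2) (g q.1)) : ℝ)|
      ≤ (‖q.2‖ ^ 2)⁻¹ * (‖fderiv ℝ φ (q.1 + q.2)‖ * ‖g q.1‖) := by
    refine (mul_le_mul_of_nonneg_left h1 (by positivity)).trans_eq ?_
    field_simp
  refine h2.trans ?_
  by_cases hb : q.2 ∈ Metric.ball (0 : E3) 1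
  · rw [indicator_of_mem hb, Real.rpow_neg hz0.le, Real.rpow_two]
    have h3 : (‖q.2‖ ^ 2)⁻¹ * (‖fderiv ℝ φ (q.1 + q.2)‖ * ‖g q.1‖)
        ≤ ‖g q.1‖ * (M * (‖q.2‖ ^ 2)⁻¹) := by
      rw [mul_comm]
      calc _ ≤ M * ‖g q.1‖ * (‖q.2‖ ^ 2)⁻¹ := by gcongr; exact hM _
        _ = _ := by ring
    have : 0 ≤ ‖g q.1‖ * ‖fderiv ℝ φ (q.1 + q.2)‖ := by positivity
    linarith
  · rw [indicator_of_notMem hb, mul_zero, mul_zero, zero_add, mul_comm ‖g q.1‖]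
    refine mul_le_of_le_one_left (by positivity) (inv_le_one_of_one_le₀ ?_)
    rw [Metric.mem_ball, dist_zero_right, not_lt] at hb
    exact one_le_pow₀ hb

theorem measurable_heatKernel_div :
    Measurable fun r : E3 × ℝ => heatKernel (3 * r.2) r.1 / (6 * r.2) := by
  unfold heatKernel
  fun_prop

theorem integral_prod_heatKernel_eq {τ : ℝ} (hτ : 0 < τ) (hi : Integrable g) (hg : Measurable g)
    (hφ : ContDiff ℝ 1 φ) (hM : ∀ x, ‖fderiv ℝ φ x‖ ≤ M) :
    ∫ q : E3 × E3, heatKernel (3 * τ) q.2 / (6 * τ) *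
        (inner ℝ q.2 (fderiv ℝ φ (q.1 + q.2) (g q.1)) : ℝ) ∂(volume.prod volume)
      = ∫ x, heatMoment (3 * τ) (fun y => fderiv ℝ φ y (g x)) x / (6 * τ) := by
  have h3 : 0 < 3 * τ := by positivity
  rw [integral_prod]
  · refine integral_congr_ae (ae_of_all _ fun x => ?_)
    simp only
    rw [heatMoment, integral_gaussianMeasure h3.le, ← integral_div]
    congr 1
    ext z
    rw [smul_eq_mul]
    ring
  · have h1 := (integrable_gaussianMeasure_iff h3.le).1 (integrable_norm_gaussianMeasure h3)
    refine ((hi.norm.mul_const M).mul_prod (h1.div_const (6 * τ))).mono' ?_ (ae_of_all _ fun q => ?_)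
    · exact ((((continuous_heatKernel (3 * τ)).measurable.comp measurable_snd).div_const _).mul
        (measurable_inner_fderiv_pairing hg hφ)).aestronglyMeasurable
    · have h0 := heatKernel_nonneg h3.le q.2
      rw [norm_mul, Real.norm_of_nonneg (by positivity), Real.norm_eq_abs, smul_eq_mul]
      calc _ ≤ heatKernel (3 * τ) q.2 / (6 * τ) * (‖q.2‖ * (M * ‖g q.1‖)) := by
            gcongr
            exact (abs_inner_fderiv_le q.1 q.2).trans (by gcongr; exact hM _)
        _ = _ := by ring

theorem enorm_pairing_le_lintegral {c : ℝ} (hc : 0 < c)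
    (hker : ∀ z : E3, z ≠ 0 →
      IntegrableOn (fun τ => heatKernel (3 * τ) z / (6 * τ)) (Ioi 0) ∧
      ∫ τ in Ioi 0, heatKernel (3 * τ) z / (6 * τ) = c * (‖z‖ ^ 3)⁻¹)
    (hi : Integrable g) (hg : Measurable g) (hφ : ContDiff ℝ 1 φ) (hφc : HasCompactSupport φ)
    {A : ℝ≥0∞} (hA : ∀ τ, 0 < τ → ∀ n, ∑ k ∈ Finset.range n, ENNReal.ofReal (2 ^ k * τ) *
      ‖∫ x, heatMoment (3 * (2 ^ k * τ)) (fun y => fderiv ℝ φ y (g x)) x / (6 * (2 ^ k * τ))‖ₑ ≤ A) :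
    ENNReal.ofReal c * ‖∫ x, ∫ z, (‖z‖ ^ 3)⁻¹ * (inner ℝ z (fderiv ℝ φ (x + z) (g x)) : ℝ)‖ₑ ≤ A := by
  have hcd := hφ.continuous_fderiv one_ne_zero
  obtain ⟨M, hM⟩ := (hφc.fderiv (𝕜 := ℝ)).exists_bound_of_continuous hcd
  set m : E3 × E3 → ℝ := fun q => inner ℝ q.2 (fderiv ℝ φ (q.1 + q.2) (g q.1)) with hm
  have hmm : Measurable m := measurable_inner_fderiv_pairing hg hφ
  set N : (E3 × E3) × ℝ → ℝ := fun r => heatKernel (3 * r.2) r.1.2 / (6 * r.2) * m r.1 with hN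
  have hNm : Measurable N := by
    have h1 : Measurable fun r : (E3 × E3) × ℝ => (r.1.2, r.2) := by fun_prop
    exact (measurable_heatKernel_div.comp h1).mul (hmm.comp measurable_fst)
  have hmi : Integrable (fun q => (‖q.2‖ ^ 3)⁻¹ * m q) (volume.prod volume) :=
    integrable_inner_fderiv_div_norm hi hg hφ hφc
  have hNq : ∀ q, Integrable (fun τ => N (q, τ)) (volume.restrict (Ioi 0)) ∧
      ∫ τ in Ioi 0, N (q, τ) = c * ((‖q.2‖ ^ 3)⁻¹ * m q) ∧
      ∫ τ in Ioi 0, ‖N (q, τ)‖ = c * ‖(‖q.2‖ ^ 3)⁻¹ * m q‖ := fun q => by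
    rcases eq_or_ne q.2 0 with hz | hz
    · have : m q = 0 := by simp only [hm, hz, inner_zero_left]
      simp [hN, this]
    · obtain ⟨h1, h2⟩ := hker q.2 hz
      refine ⟨by simpa only [hN] using h1.mul_const (m q), ?_, ?_⟩
      · simp only [hN]
        rw [integral_mul_const, h2]; ring
      · have : ∀ τ ∈ Ioi (0 : ℝ), ‖N (q, τ)‖ = heatKernel (3 * τ) q.2 / (6 * τ) * ‖m q‖ := fun τ hτ => by
          have hτ0 : (0 : ℝ) < τ := hτ
          have h3 := heatKernel_nonneg (by positivity : 0 ≤ 3 * τ) q.2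
          simp only [hN]
          rw [norm_mul, Real.norm_of_nonneg (by positivity)]
        rw [setIntegral_congr_fun measurableSet_Ioi this, integral_mul_const, h2, norm_mul,
          norm_inv, norm_pow, norm_norm]
        ring
  have hNi : Integrable N ((volume.prod volume).prod (volume.restrict (Ioi 0))) := by
    rw [integrable_prod_iff hNm.aestronglyMeasurable]
    refine ⟨ae_of_all _ fun q => (hNq q).1, ?_⟩
    simp only [fun q => (hNq q).2.2]
    exact hmi.norm.const_mul c
  have e1 : c * ∫ x, ∫ z, (‖z‖ ^ 3)⁻¹ * (inner ℝ z (fderiv ℝ φ (x + z) (g x)) : ℝ)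
      = ∫ τ in Ioi 0, ∫ q, N (q, τ) ∂(volume.prod volume) := by
    rw [← integral_prod_symm _ hNi, integral_prod _ hNi]
    simp only [fun q => (hNq q).2.1]
    rw [integral_const_mul, integral_prod _ hmi]
  have hFm : Measurable fun τ => ∫ q, N (q, τ) ∂(volume.prod volume) :=
    (hNm.stronglyMeasurable.integral_prod_left').measurable
  rw [← Real.enorm_of_nonneg hc.le, ← enorm_mul, e1]
  refine (enorm_integral_le_lintegral_enorm _).trans
    (lintegral_Ioi_le_of_dyadic hFm.enorm fun τ hτ n => ?_)
  refine le_trans (le_of_eq (Finset.sum_congr rfl fun k _ => ?_)) (hA τ hτ n)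
  rw [← integral_prod_heatKernel_eq (by positivity) hi hg hφ hM]

end Pairing

theorem exists_pairing_le {p q : ℝ} (hp : 2 ≤ p) (hpq : p.HolderConjugate q) :
    ∃ C : ℝ, 0 ≤ C ∧ ∀ (g φ : E3 → E3) (M : ℝ), Integrable g → Measurable g → (∀ x, ‖g x‖ ≤ M) →
      ContDiff ℝ 1 φ → HasCompactSupport φ →
      ‖∫ x, ∫ z, (‖z‖ ^ 3)⁻¹ * (inner ℝ z (fderiv ℝ φ (x + z) (g x)) : ℝ)‖ₑ
        ≤ ENNReal.ofReal C * ∫⁻ x, ENNReal.ofReal (‖g x‖ ^ p + ‖φ x‖ ^ q) := by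
  obtain ⟨c, hc, hker⟩ := exists_integral_heatKernel_eq
  obtain ⟨δ, hδ, hgap⟩ := exists_bellman_gap (F := E3) hp
  obtain ⟨B, hB0, hB⟩ := exists_bellman_le (F := E3) hp hpq
  refine ⟨3 / δ * B / c, by positivity, fun g φ M hi hg hMg hφ hφc => ?_⟩
  obtain ⟨M₁, hM₁⟩ := hφc.exists_bound_of_continuous hφ.continuous
  obtain ⟨M₂, hM₂⟩ := (hφc.fderiv (𝕜 := ℝ)).exists_bound_of_continuous
    (hφ.continuous_fderiv one_ne_zero)
  set M' := max M (max M₁ M₂)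
  have b0 : ∀ x, ‖g x‖ ≤ M' := fun x => (hMg x).trans (le_max_left _ _)
  have b1 : ∀ x, ‖φ x‖ ≤ M' := fun x => (hM₁ x).trans ((le_max_left _ _).trans (le_max_right _ _))
  have b2 : ∀ x, ‖fderiv ℝ φ x‖ ≤ M' := fun x =>
    (hM₂ x).trans ((le_max_right _ _).trans (le_max_right _ _))
  have key := enorm_pairing_le_lintegral hc hker hi hg hφ hφc
    (A := ENNReal.ofReal (3 / δ) * ∫⁻ x, ENNReal.ofReal (bellman p (g x) (φ x))) fun τ hτ n => by
    have h := le_trans le_self_add (sum_lintegral_heatAvg_gap_le hp hδ.le hτ hgap hg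
      hφ.continuous.measurable b0 b1 n)
    refine le_trans ?_ (mul_le_mul_right h _)
    rw [Finset.mul_sum]
    refine Finset.sum_le_sum fun k _ => ?_
    have hs : 0 < 2 ^ k * τ := by positivity
    refine (mul_le_mul_right (enorm_integral_heatMoment_le hs hi hg b0 hφ b1 b2) _).trans_eq ?_
    generalize (∫⁻ x, ∫⁻ z, ‖heatAvg (2 ^ k * τ) g x - heatAvg (2 ^ k * τ) g (x + z)‖ₑ *
      ‖heatAvg (2 ^ k * τ) φ x - heatAvg (2 ^ k * τ) φ (x + z)‖ₑ
        ∂gaussianMeasure (2 * (2 ^ k * τ))) = Z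
    rw [← mul_assoc, ← mul_assoc, ← ENNReal.ofReal_mul hs.le, ← ENNReal.ofReal_mul (by positivity)]
    congr 2
    field_simp
  have h2 : ∫⁻ x, ENNReal.ofReal (bellman p (g x) (φ x))
      ≤ ENNReal.ofReal B * ∫⁻ x, ENNReal.ofReal (‖g x‖ ^ p + ‖φ x‖ ^ q) := by
    rw [← lintegral_const_mul' _ _ ENNReal.ofReal_ne_top]
    refine lintegral_mono fun x => ?_
    rw [← ENNReal.ofReal_mul hB0]
    exact ENNReal.ofReal_le_ofReal (hB _ _)
  have h3 := key.trans (mul_le_mul_right h2 _)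
  rw [← mul_assoc, ← ENNReal.ofReal_mul (by positivity)] at h3
  rw [div_eq_inv_mul (3 / δ * B), ENNReal.ofReal_mul (by positivity), mul_assoc,
    ENNReal.ofReal_inv_of_pos hc]
  exact (ENNReal.mul_le_iff_le_inv (ENNReal.ofReal_pos.2 hc).ne' ENNReal.ofReal_ne_top).1 h3

def coulomb (z : E3) : E3 := (‖z‖ ^ 3)⁻¹ • z

theorem coulomb_neg (z : E3) : coulomb (-z) = -coulomb z := by
  simp [coulomb]

theorem measurable_coulomb : Measurable coulomb := by
  unfold coulomb
  fun_prop

theorem norm_coulomb (z : E3) : ‖coulomb z‖ = ‖z‖ ^ (-2 : ℝ) := by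
  rcases eq_or_ne z 0 with rfl | hz
  · simp [coulomb]
  have : 0 < ‖z‖ := norm_pos_iff.2 hz
  rw [coulomb, norm_smul, norm_inv, norm_pow, norm_norm, Real.rpow_neg this.le, Real.rpow_two]
  field_simp

theorem integrableOn_coulomb_ball (r : ℝ) : IntegrableOn coulomb (Metric.ball 0 r) := by
  refine (integrableOn_ball_norm_rpow (a := -2) (by norm_num) r).mono'
    measurable_coulomb.aestronglyMeasurable (ae_of_all _ fun z => (norm_coulomb z).le)

theorem locallyIntegrable_coulomb : LocallyIntegrable coulomb := by
  rw [locallyIntegrable_iff]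
  intro k hk
  obtain ⟨r, hr⟩ := hk.isBounded.subset_ball 0
  exact (integrableOn_coulomb_ball r).mono_set hr

def coulombAdjoint (φ : E3 → E3) (y : E3) : ℝ := ∫ z, inner ℝ (coulomb z) (φ (y + z))

theorem coulombAdjoint_eq_convolution (φ : E3 → E3) :
    coulombAdjoint φ = convolution (fun z => -coulomb z) φ (innerSL ℝ) := by
  ext y
  rw [coulombAdjoint, convolution, ← integral_neg_eq_self]
  simp only [coulomb_neg, sub_eq_add_neg, inner_neg_left, map_neg]
  rfl

section

variable {φ : E3 → E3}

theorem contDiff_coulombAdjoint (hφ : ContDiff ℝ 1 φ) (hφc : HasCompactSupport φ) :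
    ContDiff ℝ 1 (coulombAdjoint φ) := by
  rw [coulombAdjoint_eq_convolution]
  exact hφc.contDiff_convolution_right _ locallyIntegrable_coulomb.neg hφ

theorem fderiv_coulombAdjoint (hφ : ContDiff ℝ 1 φ) (hφc : HasCompactSupport φ) (y e : E3) :
    fderiv ℝ (coulombAdjoint φ) y e
      = ∫ z, (‖z‖ ^ 3)⁻¹ * (inner ℝ z (fderiv ℝ φ (y + z) e) : ℝ) := by
  have h := (hφc.hasFDerivAt_convolution_right (μ := volume) (innerSL ℝ)
    locallyIntegrable_coulomb.neg hφ y).fderiv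
  rw [coulombAdjoint_eq_convolution]
  refine (congrArg (fun L : E3 →L[ℝ] ℝ => L e) h).trans ?_
  refine (convolution_precompR_apply (innerSL ℝ) locallyIntegrable_coulomb.neg
    (hφc.fderiv (𝕜 := ℝ)) (hφ.continuous_fderiv one_ne_zero) y e).trans ?_
  rw [convolution, ← integral_neg_eq_self]
  simp [coulomb, sub_eq_add_neg]
  rfl

end

theorem exists_lintegral_mul_fderiv_coulombAdjoint_le {p q : ℝ} (hp : 2 ≤ p)
    (hpq : p.HolderConjugate q) :
    ∃ C : ℝ, 0 ≤ C ∧ ∀ (D : E3 → ℝ) (M : ℝ) (φ : E3 → E3), Measurable D → Integrable D →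
      (∀ x, 0 ≤ D x) → (∀ x, D x ≤ M) → ContDiff ℝ 1 φ → HasCompactSupport φ →
      ‖∫ x, D x * ‖fderiv ℝ (coulombAdjoint φ) x‖‖ₑ
        ≤ ENNReal.ofReal C * ((∫⁻ x, ENNReal.ofReal (D x ^ p)) + ∫⁻ x, ENNReal.ofReal (‖φ x‖ ^ q)) := by
  obtain ⟨C, hC, h⟩ := exists_pairing_le hp hpq
  refine ⟨C, hC, fun D M φ hDm hDi hD0 hDM hφ hφc => ?_⟩
  have hψ := contDiff_coulombAdjoint hφ hφc
  set G : E3 → E3 := fun x => (InnerProductSpace.toDual ℝ E3).symm (fderiv ℝ (coulombAdjoint φ) x)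
    with hG
  have hGc : Continuous G := by
    have := hψ.continuous_fderiv one_ne_zero
    exact (LinearIsometryEquiv.continuous _).comp this
  have hGn : ∀ x, ‖G x‖ = ‖fderiv ℝ (coulombAdjoint φ) x‖ := fun x => LinearIsometryEquiv.norm_map _ _
  set g : E3 → E3 := fun x => D x • ‖G x‖⁻¹ • G x with hg
  have hgm : Measurable g := hDm.smul (hGc.norm.measurable.inv.smul hGc.measurable)
  have hgn : ∀ x, ‖g x‖ ≤ D x := fun x => by
    rw [hg, norm_smul, norm_smul, Real.norm_of_nonneg (hD0 x), norm_inv, norm_norm]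
    refine mul_le_of_le_one_right (hD0 x) ?_
    exact inv_mul_le_one
  have hgi : Integrable g := hDi.mono' hgm.aestronglyMeasurable (ae_of_all _ hgn)
  have key := h g φ M hgi hgm (fun x => (hgn x).trans (hDM x)) hφ hφc
  have e : ∀ x, ∫ z, (‖z‖ ^ 3)⁻¹ * (inner ℝ z (fderiv ℝ φ (x + z) (g x)) : ℝ)
      = D x * ‖fderiv ℝ (coulombAdjoint φ) x‖ := fun x => by
    rw [← fderiv_coulombAdjoint hφ hφc, ← hGn]
    have : ∀ w, fderiv ℝ (coulombAdjoint φ) x w = inner ℝ (G x) w := fun w => by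
      rw [hG, InnerProductSpace.toDual_symm_apply]
    rw [this, hg, real_inner_smul_right, real_inner_smul_right, real_inner_self_eq_norm_sq]
    rcases eq_or_ne ‖G x‖ 0 with h0 | h0
    · simp [h0]
    · field_simp
  simp only [e] at key
  refine key.trans (mul_le_mul_right ?_ _)
  rw [← lintegral_add_left (by fun_prop)]
  refine lintegral_mono fun x => ?_
  rw [← ENNReal.ofReal_add (Real.rpow_nonneg (hD0 x) p) (by positivity)]
  refine ENNReal.ofReal_le_ofReal ?_
  gcongr
  exact hgn x

theorem integral_rpow_mul_le_of_dual {p q : ℝ} (hp : 3 < p) (hpq : p.HolderConjugate q) {E : E3 → E3}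
    (hE : ContDiff ℝ 1 E) {A : ℝ} (hA0 : 0 ≤ A)
    (h : ∀ φ : E3 → E3, ContDiff ℝ 1 φ → HasCompactSupport φ →
      ∫⁻ x, ENNReal.ofReal (‖φ x‖ ^ q) ≤ 1 → ∫ x, (inner ℝ (E x) (φ x) : ℝ) ≤ A)
    {θ : E3 → ℝ} (hθ : ContDiff ℝ 1 θ) (hθc : HasCompactSupport θ) (hθ0 : ∀ x, 0 ≤ θ x)
    (hθ1 : ∀ x, θ x ≤ 1) : ∫ x, ‖E x‖ ^ p * θ x ≤ A ^ p := by
  have hp0 : 0 < p := by linarith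
  have hq0 : 0 < q := hpq.symm.pos
  have hq1 : 1 < q := hpq.symm.lt
  set J := ∫ x, ‖E x‖ ^ p * θ x with hJ
  have hJ0 : 0 ≤ J := integral_nonneg fun x => mul_nonneg (by positivity) (hθ0 x)
  rcases hJ0.eq_or_lt with hJe | hJp
  · rw [← hJe]; positivity
  have hJi : Integrable fun x => ‖E x‖ ^ p * θ x :=
    ((hE.continuous.norm.rpow_const fun _ => Or.inr hp0.le).mul
      hθ.continuous).integrable_of_hasCompactSupport hθc.mul_left
  set w : E3 → ℝ := fun x => J ^ (-(1 / q)) * (θ x * ‖E x‖ ^ (p - 2)) with hw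
  have hw0 : ∀ x, 0 ≤ w x := fun x => by have := hθ0 x; positivity
  have hw1 : ContDiff ℝ 1 w := by
    have : ContDiff ℝ 1 fun x => ‖E x‖ ^ (p - 2) := (contDiff_norm_rpow (by linarith)).comp hE
    exact contDiff_const.mul (hθ.mul this)
  have hwc : HasCompactSupport w := by
    have : HasCompactSupport fun x => θ x * ‖E x‖ ^ (p - 2) := hθc.mul_right
    exact this.mul_left (f := fun _ => J ^ (-(1 / q)))
  set φ : E3 → E3 := fun x => w x • E x with hφ
  have hφ1 : ContDiff ℝ 1 φ := hw1.smul hE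
  have hφc : HasCompactSupport φ := hwc.mono fun x hx h0 => hx (by simp only [hφ, h0, zero_smul])
  have hEp : ∀ x, ‖E x‖ ^ (p - 2) * ‖E x‖ ^ (2 : ℕ) = ‖E x‖ ^ p := fun x => by
    rw [← Real.rpow_natCast, ← Real.rpow_add_of_nonneg (by positivity) (by linarith) (by norm_num)]
    norm_num
  have hEq : ∀ x, (‖E x‖ ^ (p - 2) * ‖E x‖) ^ q = ‖E x‖ ^ p := fun x => by
    rw [← Real.rpow_add_one' (by positivity) (by linarith), ← Real.rpow_mul (by positivity)]
    congr 1
    have := hpq.sub_one_mul_conj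
    linarith
  have e1 : ∫ x, (inner ℝ (E x) (φ x) : ℝ) = J ^ (1 / p) := by
    have : ∀ x, (inner ℝ (E x) (φ x) : ℝ) = J ^ (-(1 / q)) * (‖E x‖ ^ p * θ x) := fun x => by
      simp only [hφ, hw, real_inner_smul_right, real_inner_self_eq_norm_sq]
      rw [← hEp]; ring
    simp only [this]
    rw [integral_const_mul, ← hJ]
    nth_rw 2 [← Real.rpow_one J]
    rw [← Real.rpow_add hJp]
    congr 1
    have := hpq.inv_add_inv_eq_one
    rw [one_div, one_div]; linarith
  have e2 : ∫⁻ x, ENNReal.ofReal (‖φ x‖ ^ q) ≤ 1 := by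
    have : ∀ x, ENNReal.ofReal (‖φ x‖ ^ q) ≤ ENNReal.ofReal (J⁻¹ * (‖E x‖ ^ p * θ x)) := fun x => by
      refine ENNReal.ofReal_le_ofReal ?_
      simp only [hφ, norm_smul]
      rw [Real.norm_of_nonneg (hw0 x)]
      simp only [hw]
      rw [mul_assoc, mul_assoc, Real.mul_rpow (by positivity)
          (mul_nonneg (hθ0 x) (by positivity)), Real.mul_rpow (hθ0 x) (by positivity), hEq,
        ← Real.rpow_mul hJ0, mul_comm (θ x ^ q)]
      have h1 : -(1 / q) * q = -1 := by field_simp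
      rw [h1, Real.rpow_neg_one]
      gcongr
      exact (Real.rpow_le_rpow_of_exponent_ge' (hθ0 x) (hθ1 x) zero_le_one hq1.le).trans_eq
        (Real.rpow_one _)
    have hle := lintegral_mono (μ := volume) this
    have he := ofReal_integral_eq_lintegral_ofReal (hJi.const_mul J⁻¹)
      (ae_of_all _ fun x => mul_nonneg (inv_nonneg.2 hJ0) (mul_nonneg (by positivity) (hθ0 x)))
    rw [integral_const_mul, ← hJ, inv_mul_cancel₀ hJp.ne', ENNReal.ofReal_one] at he
    exact hle.trans_eq he.symm
  have := h φ hφ1 hφc e2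
  rw [e1] at this
  calc J = (J ^ (1 / p)) ^ p := by rw [← Real.rpow_mul hJ0]; field_simp; simp
    _ ≤ A ^ p := by gcongr

theorem eLpNorm_le_of_dual {p q : ℝ} (hp : 3 < p) (hpq : p.HolderConjugate q) {E : E3 → E3}
    (hE : ContDiff ℝ 1 E) {A : ℝ} (hA0 : 0 ≤ A)
    (h : ∀ φ : E3 → E3, ContDiff ℝ 1 φ → HasCompactSupport φ →
      ∫⁻ x, ENNReal.ofReal (‖φ x‖ ^ q) ≤ 1 → ∫ x, (inner ℝ (E x) (φ x) : ℝ) ≤ A) :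
    eLpNorm E (ENNReal.ofReal p) volume ≤ ENNReal.ofReal A := by
  have hp0 : 0 < p := by linarith
  rw [eLpNorm_eq_lintegral_rpow_enorm_toReal (by simpa using hp0) ENNReal.ofReal_ne_top,
    ENNReal.toReal_ofReal hp0.le]
  have key : ∫⁻ x, ‖E x‖ₑ ^ p ≤ ENNReal.ofReal A ^ p := by
    refine le_of_tendsto' ((aecover_closedBall (μ := volume) (x := (0 : E3))
      tendsto_natCast_atTop_atTop).lintegral_tendsto_of_countably_generated
        (f := fun x => ‖E x‖ₑ ^ p) (hE.continuous.measurable.enorm.pow_const p).aemeasurable) fun n => ?_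
    let θ : ContDiffBump (0 : E3) := ⟨n + 1, n + 2, by positivity, by linarith⟩
    have h1 := integral_rpow_mul_le_of_dual hp hpq hE hA0 h θ.contDiff θ.hasCompactSupport
      (fun _ => θ.nonneg) fun _ => θ.le_one
    have hJi : Integrable fun x => ‖E x‖ ^ p * θ x :=
      ((hE.continuous.norm.rpow_const fun _ => Or.inr hp0.le).mul
        θ.continuous).integrable_of_hasCompactSupport θ.hasCompactSupport.mul_left
    rw [ENNReal.ofReal_rpow_of_nonneg hA0 hp0.le]
    refine le_trans ?_ (ENNReal.ofReal_le_ofReal h1)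
    rw [ofReal_integral_eq_lintegral_ofReal hJi (ae_of_all _ fun x =>
      mul_nonneg (by positivity) θ.nonneg), ← lintegral_indicator Metric.isClosed_closedBall.measurableSet]
    refine lintegral_mono fun x => ?_
    by_cases hx : x ∈ Metric.closedBall (0 : E3) n
    · have hθ : θ x = 1 := θ.one_of_mem_closedBall
        (Metric.closedBall_subset_closedBall (by simp [θ]) hx)
      rw [indicator_of_mem hx, hθ, mul_one, ← ENNReal.ofReal_rpow_of_nonneg (norm_nonneg _) hp0.le,
        ofReal_norm]
    · rw [indicator_of_notMem hx]; exact zero_le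
  refine (ENNReal.rpow_le_rpow key (by positivity)).trans_eq ?_
  rw [← ENNReal.rpow_mul]
  field_simp
  simp

section

variable {p q r α : ℝ}

theorem mul_mul_le_of_weights (hpq : p.HolderConjugate q) (hr1 : 1 < r) (hrp : r ≤ p)
    (hα : α⁻¹ = 1 / p + 1 - 1 / r) {a b κ : ℝ} (ha : 0 ≤ a) (hb : 0 ≤ b) (hκ : 0 ≤ κ) :
    a * b * κ ≤ a ^ r * b ^ q + κ ^ α * (a ^ r + b ^ q) := by
  have hp0 := hpq.pos
  have hr0 : 0 < r := by linarith
  have hq := hpq.inv_add_inv_eq_one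
  have h2 : 0 < 1 / p := by positivity
  have h3 : 0 < 1 - 1 / r := by
    have : 1 / r < 1 := by rw [div_lt_one hr0]; exact hr1
    linarith
  have h1 : 0 ≤ 1 / r - 1 / p := by
    have := one_div_le_one_div_of_le hr0 hrp
    linarith
  have hα0 : 0 < α := by
    rw [← inv_pos, hα]; linarith
  have e := Real.geom_mean_le_arith_mean3_weighted h1 h2.le h3.le
    (p₁ := a ^ r * b ^ q) (p₂ := a ^ r * κ ^ α) (p₃ := b ^ q * κ ^ α)
    (by positivity) (by positivity) (by positivity) (by ring)
  have hq0 := hpq.symm.pos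
  have hra : (1 / r - 1 / p) ≤ 1 := by
    have : 1 / r ≤ 1 := by linarith
    linarith
  have hpa : 1 / p ≤ 1 := by rw [one_div]; linarith [inv_pos.2 hq0]
  have hrb : 1 - 1 / r ≤ 1 := by linarith [one_div_pos.2 hr0]
  have key : (a ^ r * b ^ q) ^ (1 / r - 1 / p) * (a ^ r * κ ^ α) ^ (1 / p) *
      (b ^ q * κ ^ α) ^ (1 - 1 / r) = a * b * κ := by
    rw [Real.mul_rpow (by positivity) (by positivity), Real.mul_rpow (by positivity) (by positivity),
      Real.mul_rpow (by positivity) (by positivity)]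
    simp only [← Real.rpow_mul ha, ← Real.rpow_mul hb, ← Real.rpow_mul hκ]
    have ea : a ^ (r * (1 / r - 1 / p)) * a ^ (r * (1 / p)) = a := by
      rw [← Real.rpow_add_of_nonneg ha (by positivity) (by positivity), ← mul_add]
      rw [show r * (1 / r - 1 / p + 1 / p) = 1 by field_simp; ring, Real.rpow_one]
    have eb : b ^ (q * (1 / r - 1 / p)) * b ^ (q * (1 - 1 / r)) = b := by
      rw [← Real.rpow_add_of_nonneg hb (by positivity) (by positivity), ← mul_add]
      rw [show q * (1 / r - 1 / p + (1 - 1 / r)) = 1 by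
        rw [show 1 / r - 1 / p + (1 - 1 / r) = q⁻¹ by rw [one_div p]; linarith, mul_inv_cancel₀ hq0.ne'],
        Real.rpow_one]
    have ek : κ ^ (α * (1 / p)) * κ ^ (α * (1 - 1 / r)) = κ := by
      rw [← Real.rpow_add_of_nonneg hκ (by positivity) (by positivity), ← mul_add]
      rw [show α * (1 / p + (1 - 1 / r)) = 1 by
        rw [show 1 / p + (1 - 1 / r) = α⁻¹ by rw [hα]; ring, mul_inv_cancel₀ hα0.ne'], Real.rpow_one]
    calc _ = (a ^ (r * (1 / r - 1 / p)) * a ^ (r * (1 / p))) *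
        (b ^ (q * (1 / r - 1 / p)) * b ^ (q * (1 - 1 / r))) *
        (κ ^ (α * (1 / p)) * κ ^ (α * (1 - 1 / r))) := by ring
      _ = _ := by rw [ea, eb, ek]
  rw [key] at e
  have x1 : 0 ≤ a ^ r * b ^ q := by positivity
  have x2 : 0 ≤ a ^ r * κ ^ α := by positivity
  have x3 : 0 ≤ b ^ q * κ ^ α := by positivity
  nlinarith [mul_le_of_le_one_left x1 hra, mul_le_of_le_one_left x2 hpa,
    mul_le_of_le_one_left x3 hrb]

theorem mul_mul_le_young (hpq : p.HolderConjugate q) {a b κ : ℝ} (ha : 0 ≤ a) (hb : 0 ≤ b)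
    (hκ : 0 ≤ κ) : a * b * κ ≤ a * b ^ q + κ ^ p * a := by
  have h := Real.young_inequality_of_nonneg hκ hb hpq
  have h1 : κ ^ p / p ≤ κ ^ p := div_le_self (by positivity) hpq.lt.le
  have h2 : b ^ q / q ≤ b ^ q := div_le_self (by positivity) hpq.symm.lt.le
  nlinarith [mul_le_mul_of_nonneg_left (h.trans (add_le_add h1 h2)) ha]

theorem exists_integral_mul_coulombAdjoint_le (hpq : p.HolderConjugate q) (hp : 2 ≤ p) (hr1 : 1 < r)
    (hrp : r ≤ p) (hr : 2 / 3 < 1 / p + 1 - 1 / r) :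
    ∃ K : ℝ, 0 ≤ K ∧ ∀ (B : ℝ) (ρ : E3 → ℝ) (φ : E3 → E3), 0 ≤ B → Measurable ρ → (∀ x, 0 ≤ ρ x) →
      Continuous φ → ∫⁻ x, ENNReal.ofReal (ρ x) ≤ 1 →
      ∫⁻ x, ENNReal.ofReal (ρ x ^ r) ≤ ENNReal.ofReal B →
      ∫⁻ x, ENNReal.ofReal (‖φ x‖ ^ q) ≤ 1 →
      ‖∫ x, ρ x * coulombAdjoint φ x‖ₑ ≤ ENNReal.ofReal (K * (1 + B)) := by
  set α := (1 / p + 1 - 1 / r)⁻¹ with hα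
  have hα' : α⁻¹ = 1 / p + 1 - 1 / r := by rw [hα, inv_inv]
  have hα2 : -3 < -2 * α := by
    have : α < 3 / 2 := by
      rw [hα, show (3 / 2 : ℝ) = (2 / 3)⁻¹ by norm_num]
      exact inv_strictAnti₀ (by norm_num) hr
    linarith
  set b1 : E3 → ℝ := (Metric.ball 0 1).indicator fun z => ‖z‖ ^ (-2 * α) with hb1
  set b2 : E3 → ℝ := (Metric.ball 0 1)ᶜ.indicator fun z => ‖z‖ ^ (-2 * p) with hb2
  have b10 : ∀ z, 0 ≤ b1 z := fun z => indicator_nonneg (fun z _ => by positivity) _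
  have b20 : ∀ z, 0 ≤ b2 z := fun z => indicator_nonneg (fun z _ => by positivity) _
  have b1i : Integrable b1 := (integrable_indicator_iff measurableSet_ball).2
    (integrableOn_ball_norm_rpow hα2 1)
  have b2i : Integrable b2 := (integrable_indicator_iff measurableSet_ball.compl).2
    (integrableOn_compl_ball_norm_rpow (by linarith) one_pos)
  have b1m : Measurable b1 := (measurable_norm.pow_const _).indicator measurableSet_ball
  have b2m : Measurable b2 := (measurable_norm.pow_const _).indicator measurableSet_ball.compl
  set K1 := ∫ z, b1 z
  set K2 := ∫ z, b2 z
  have k1 : ∫⁻ z, ENNReal.ofReal (b1 z) = ENNReal.ofReal K1 :=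
    (ofReal_integral_eq_lintegral_ofReal b1i (ae_of_all _ b10)).symm
  have k2 : ∫⁻ z, ENNReal.ofReal (b2 z) = ENNReal.ofReal K2 :=
    (ofReal_integral_eq_lintegral_ofReal b2i (ae_of_all _ b20)).symm
  have K10 : 0 ≤ K1 := integral_nonneg b10
  have K20 : 0 ≤ K2 := integral_nonneg b20
  refine ⟨1 + K1 + K2, by positivity, fun B ρ φ hB hρ hρ0 hφ h1 hBr hq => ?_⟩
  have hpt : ∀ y z, ρ y * ‖φ (y + z)‖ * ‖z‖ ^ (-2 : ℝ) ≤
      (ρ y ^ r * ‖φ (y + z)‖ ^ q + b1 z * (ρ y ^ r + ‖φ (y + z)‖ ^ q))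
        + (ρ y * ‖φ (y + z)‖ ^ q + b2 z * ρ y) := fun y z => by
    have hy := hρ0 y
    by_cases hz : z ∈ Metric.ball (0 : E3) 1
    · have := mul_mul_le_of_weights hpq hr1 hrp hα' (hρ0 y) (norm_nonneg (φ (y + z)))
        (κ := ‖z‖ ^ (-2 : ℝ)) (by positivity)
      rw [← Real.rpow_mul (norm_nonneg _)] at this
      simp only [hb1, indicator_of_mem hz]
      have h2 : 0 ≤ ρ y * ‖φ (y + z)‖ ^ q + b2 z * ρ y := by have := b20 z; positivity
      linarith
    · have := mul_mul_le_young hpq (hρ0 y) (norm_nonneg (φ (y + z)))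
        (κ := ‖z‖ ^ (-2 : ℝ)) (by positivity)
      rw [← Real.rpow_mul (norm_nonneg _)] at this
      simp only [hb2, indicator_of_mem (show z ∈ (Metric.ball (0 : E3) 1)ᶜ from hz)]
      have h2 : 0 ≤ ρ y ^ r * ‖φ (y + z)‖ ^ q + b1 z * (ρ y ^ r + ‖φ (y + z)‖ ^ q) := by
        have := b10 z; positivity
      linarith
  have hin : ∀ y, ‖ρ y * coulombAdjoint φ y‖ₑ ≤ ∫⁻ z,
      ((ENNReal.ofReal (ρ y ^ r) * ENNReal.ofReal (‖φ (y + z)‖ ^ q) +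
        ENNReal.ofReal (b1 z) * (ENNReal.ofReal (ρ y ^ r) + ENNReal.ofReal (‖φ (y + z)‖ ^ q)))
      + (ENNReal.ofReal (ρ y) * ENNReal.ofReal (‖φ (y + z)‖ ^ q) +
        ENNReal.ofReal (b2 z) * ENNReal.ofReal (ρ y))) := fun y => by
    have hy := hρ0 y
    rw [coulombAdjoint, ← integral_const_mul]
    refine (enorm_integral_le_lintegral_enorm _).trans (lintegral_mono fun z => ?_)
    have hz1 := b10 z
    have hz2 := b20 z
    rw [← ENNReal.ofReal_add (by positivity) (by positivity), ← ENNReal.ofReal_mul (by positivity),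
      ← ENNReal.ofReal_mul (by positivity), ← ENNReal.ofReal_mul (by positivity),
      ← ENNReal.ofReal_mul (by positivity), ← ENNReal.ofReal_add (by positivity) (by positivity),
      ← ENNReal.ofReal_add (by positivity) (by positivity),
      ← ENNReal.ofReal_add (by positivity) (by positivity), ← ofReal_norm]
    refine ENNReal.ofReal_le_ofReal (le_trans ?_ (hpt y z))
    rw [norm_mul, Real.norm_of_nonneg hy, mul_assoc, Real.norm_eq_abs]
    refine mul_le_mul_of_nonneg_left ((abs_real_inner_le_norm _ _).trans_eq ?_) hy
    rw [norm_coulomb, mul_comm]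
  have hφq : Measurable fun z => ENNReal.ofReal (‖φ z‖ ^ q) := by
    have := hφ.measurable
    fun_prop
  have hsh : ∀ y, ∫⁻ z, ENNReal.ofReal (‖φ (y + z)‖ ^ q) ≤ 1 := fun y =>
    (lintegral_add_left_eq_self (fun z => ENNReal.ofReal (‖φ z‖ ^ q)) y).trans_le hq
  have hφm : ∀ y, Measurable fun z => ENNReal.ofReal (‖φ (y + z)‖ ^ q) := fun y =>
    hφq.comp (measurable_const_add y)
  have hφm2 : Measurable fun w : E3 × E3 => ENNReal.ofReal (‖φ (w.1 + w.2)‖ ^ q) :=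
    hφq.comp (by fun_prop)
  have hin2 : ∀ y, ‖ρ y * coulombAdjoint φ y‖ₑ ≤
      (ENNReal.ofReal (ρ y ^ r) + (ENNReal.ofReal K1 * ENNReal.ofReal (ρ y ^ r) +
        ∫⁻ z, ENNReal.ofReal (b1 z) * ENNReal.ofReal (‖φ (y + z)‖ ^ q)))
      + (ENNReal.ofReal (ρ y) + ENNReal.ofReal K2 * ENNReal.ofReal (ρ y)) := fun y => by
    have m1 := hφm y
    refine (hin y).trans ?_
    simp only [mul_add]
    rw [lintegral_add_right _ (by fun_prop), lintegral_add_right _ (by fun_prop),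
      lintegral_add_right _ (by fun_prop), lintegral_add_right _ (by fun_prop),
      lintegral_const_mul' _ _ ENNReal.ofReal_ne_top, lintegral_const_mul' _ _ ENNReal.ofReal_ne_top,
      lintegral_mul_const' _ _ ENNReal.ofReal_ne_top, lintegral_mul_const' _ _ ENNReal.ofReal_ne_top,
      k1, k2]
    gcongr
    · exact (mul_le_mul_right (hsh y) _).trans_eq (mul_one _)
    · exact (mul_le_mul_right (hsh y) _).trans_eq (mul_one _)
  have hcross : ∫⁻ y, ∫⁻ z, ENNReal.ofReal (b1 z) * ENNReal.ofReal (‖φ (y + z)‖ ^ q)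
      ≤ ENNReal.ofReal K1 := by
    rw [lintegral_lintegral_swap ((b1m.ennreal_ofReal.comp measurable_snd).mul hφm2).aemeasurable]
    rw [← k1]
    refine lintegral_mono fun z => ?_
    rw [lintegral_const_mul' _ _ ENNReal.ofReal_ne_top]
    refine (mul_le_mul_right ?_ _).trans_eq (mul_one _)
    exact (lintegral_add_right_eq_self (fun y => ENNReal.ofReal (‖φ y‖ ^ q)) z).trans_le hq
  refine (enorm_integral_le_lintegral_enorm _).trans ((lintegral_mono hin2).trans ?_)
  rw [lintegral_add_right _ (by fun_prop), lintegral_add_left (by fun_prop),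
    lintegral_add_left (by fun_prop), lintegral_add_right _ (by fun_prop),
    lintegral_const_mul' _ _ ENNReal.ofReal_ne_top, lintegral_const_mul' _ _ ENNReal.ofReal_ne_top]
  calc _ ≤ (ENNReal.ofReal B + (ENNReal.ofReal K1 * ENNReal.ofReal B + ENNReal.ofReal K1))
        + (1 + ENNReal.ofReal K2 * 1) := by gcongr
    _ = ENNReal.ofReal (B + (K1 * B + K1) + (1 + K2)) := by
        rw [mul_one, ENNReal.ofReal_add (by positivity) (by positivity),
          ENNReal.ofReal_add (by positivity) (by positivity),
          ENNReal.ofReal_add (by positivity) (by positivity),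
          ENNReal.ofReal_add (by positivity) (by positivity), ENNReal.ofReal_mul K10,
          ENNReal.ofReal_one]
    _ ≤ _ := ENNReal.ofReal_le_ofReal (by nlinarith [mul_nonneg K20 hB])

end

theorem exists_rpow_integral_le_lintegral_moment {k Λ : ℝ} (hk : 0 < k) (hΛ : 0 ≤ Λ) :
    ∃ C : ℝ, 0 ≤ C ∧ ∀ (w : E3) (g : E3 → ℝ), Measurable g → (∀ v, 0 ≤ g v) → (∀ v, g v ≤ Λ) → Integrable g →
      ENNReal.ofReal ((∫ v, g v) ^ ((k + 3) / 3))
        ≤ ENNReal.ofReal C * ∫⁻ v, ENNReal.ofReal (‖v - w‖ ^ k * g v) := by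
  set c := (volume (Metric.ball (0 : E3) 1)).toReal with hc
  have hc0 : 0 < c := ENNReal.toReal_pos (Metric.measure_ball_pos _ _ one_pos).ne'
    measure_ball_lt_top.ne
  set L := 2 * (Λ + 1) * c with hL
  have hL0 : 0 < L := by positivity
  refine ⟨2 * L ^ (k / 3), by positivity, fun w g hg hg0 hgΛ hgi => ?_⟩
  set ρ := ∫ v, g v with hρ
  have hρ0 : 0 ≤ ρ := integral_nonneg hg0
  rcases hρ0.eq_or_lt with h0 | hpos
  · rw [← h0, Real.zero_rpow (by positivity), ENNReal.ofReal_zero]; exact zero_le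
  set I := ∫⁻ v, ENNReal.ofReal (‖v - w‖ ^ k * g v) with hI
  set d := (ρ / L) ^ ((1 : ℝ) / 3) with hd
  have hd0 : 0 < d := by positivity
  have hd3 : d ^ (3 : ℕ) = ρ / L := by
    rw [hd, ← Real.rpow_natCast, ← Real.rpow_mul (by positivity)]; norm_num
  have hdk : d ^ k = (ρ / L) ^ (k / 3) := by
    rw [hd, ← Real.rpow_mul (by positivity)]; ring_nf
  have hpt : ∀ v, ENNReal.ofReal (g v) ≤
      (Metric.ball w d).indicator (fun _ => ENNReal.ofReal Λ) v
        + ENNReal.ofReal (d ^ k)⁻¹ * ENNReal.ofReal (‖v - w‖ ^ k * g v) := fun v => by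
    by_cases hv : v ∈ Metric.ball w d
    · rw [indicator_of_mem hv]
      exact (ENNReal.ofReal_le_ofReal (hgΛ v)).trans le_self_add
    · rw [indicator_of_notMem hv, zero_add, ← ENNReal.ofReal_mul (by positivity)]
      refine ENNReal.ofReal_le_ofReal ?_
      rw [Metric.mem_ball, dist_eq_norm, not_lt] at hv
      rw [← mul_assoc]
      refine le_mul_of_one_le_left (hg0 v) ?_
      rw [inv_mul_eq_div, one_le_div (by positivity)]
      exact Real.rpow_le_rpow hd0.le hv hk.le
  have h1 : ENNReal.ofReal ρ ≤ ENNReal.ofReal (ρ / 2) + ENNReal.ofReal (d ^ k)⁻¹ * I := by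
    rw [hρ, ofReal_integral_eq_lintegral_ofReal hgi (ae_of_all _ hg0), ← hρ]
    refine (lintegral_mono hpt).trans ?_
    rw [lintegral_add_left (measurable_const.indicator measurableSet_ball),
      lintegral_const_mul' _ _ ENNReal.ofReal_ne_top, lintegral_indicator measurableSet_ball,
      setLIntegral_const, Measure.addHaar_ball _ _ hd0.le, ← ENNReal.ofReal_toReal
        (measure_ball_lt_top (μ := volume) (x := (0 : E3)) (r := 1)).ne, ← hc,
      finrank_euclideanSpace_fin, hd3, ← ENNReal.ofReal_mul (by positivity),
      ← ENNReal.ofReal_mul hΛ]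
    gcongr
    rw [hL]
    have : Λ * (ρ / (2 * (Λ + 1) * c) * c) = ρ / 2 * (Λ / (Λ + 1)) := by field_simp
    rw [this]
    refine mul_le_of_le_one_right (by positivity) ?_
    rw [div_le_one (by positivity)]; linarith
  have h2 : ENNReal.ofReal (ρ / 2) ≤ ENNReal.ofReal (d ^ k)⁻¹ * I := by
    have e : ENNReal.ofReal ρ = ENNReal.ofReal (ρ / 2) + ENNReal.ofReal (ρ / 2) := by
      rw [← ENNReal.ofReal_add (by positivity) (by positivity), add_halves]
    rw [e] at h1
    exact (ENNReal.add_le_add_iff_left ENNReal.ofReal_ne_top).1 h1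
  have e : ρ ^ ((k + 3) / 3) = (2 * L ^ (k / 3)) * d ^ k * (ρ / 2) := by
    rw [hdk, Real.div_rpow hρ0 hL0.le, show (k + 3) / 3 = k / 3 + 1 by ring, Real.rpow_add_one hpos.ne']
    have : 0 < L ^ (k / 3) := by positivity
    field_simp
  rw [e, ENNReal.ofReal_mul (by positivity)]
  refine (mul_le_mul_right h2 _).trans_eq ?_
  rw [← mul_assoc, ← ENNReal.ofReal_mul (by positivity), mul_assoc _ (d ^ k), mul_inv_cancel₀
    (by positivity), mul_one]

theorem norm_le_of_second_order {u w u' w' : ℝ → E3} {s L : ℝ} (hL : 0 ≤ L) (hLs : L * s ^ 2 ≤ 1 / 2)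
    (hu : ∀ σ ∈ Icc 0 s, HasDerivAt u (u' σ) σ) (hw : ∀ σ ∈ Icc 0 s, HasDerivAt w (w' σ) σ)
    (hu' : ∀ σ ∈ Icc 0 s, ‖u' σ‖ ≤ ‖w σ‖) (hw' : ∀ σ ∈ Icc 0 s, ‖w' σ‖ ≤ L * ‖u σ‖)
    {σ₀ σ : ℝ} (hσ₀ : σ₀ ∈ Icc 0 s) (hσ : σ ∈ Icc 0 s) :
    ‖u σ‖ ≤ 2 * (‖u σ₀‖ + s * ‖w σ₀‖) ∧
      ‖w σ‖ ≤ ‖w σ₀‖ + L * s * (2 * (‖u σ₀‖ + s * ‖w σ₀‖)) := by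
  have hs : 0 ≤ s := hσ.1.trans hσ.2
  have hdist : ∀ τ ∈ Icc 0 s, ‖τ - σ₀‖ ≤ s := fun τ hτ => by
    rw [Real.norm_eq_abs, abs_le]; constructor <;> linarith [hτ.1, hτ.2, hσ₀.1, hσ₀.2]
  obtain ⟨τ, hτ, hmax⟩ := isCompact_Icc.exists_isMaxOn (nonempty_Icc.2 hs)
    (fun r hr => (hu r hr).continuousAt.norm.continuousWithinAt :
      ContinuousOn (fun r => ‖u r‖) (Icc 0 s))
  set M := ‖u τ‖ with hM
  have hM0 : 0 ≤ M := norm_nonneg _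
  have huM : ∀ r ∈ Icc 0 s, ‖u r‖ ≤ M := fun r hr => hmax hr
  have hwB : ∀ r ∈ Icc 0 s, ‖w r‖ ≤ ‖w σ₀‖ + L * s * M := fun r hr => by
    have h := Convex.norm_image_sub_le_of_norm_hasDerivWithin_le (C := L * M)
      (fun x hx => (hw x hx).hasDerivWithinAt)
      (fun x hx => (hw' x hx).trans (mul_le_mul_of_nonneg_left (huM x hx) hL)) (convex_Icc 0 s) hσ₀ hr
    have h2 : L * M * ‖r - σ₀‖ ≤ L * M * s := by gcongr; exact hdist r hr
    have h3 := norm_le_norm_add_norm_sub' (w r) (w σ₀)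
    linarith
  have huB : M ≤ ‖u σ₀‖ + s * (‖w σ₀‖ + L * s * M) := by
    have h := Convex.norm_image_sub_le_of_norm_hasDerivWithin_le (C := ‖w σ₀‖ + L * s * M)
      (fun x hx => (hu x hx).hasDerivWithinAt)
      (fun x hx => (hu' x hx).trans (hwB x hx)) (convex_Icc 0 s) hσ₀ hτ
    have h2 : (‖w σ₀‖ + L * s * M) * ‖τ - σ₀‖ ≤ (‖w σ₀‖ + L * s * M) * s := by
      gcongr; exact hdist τ hτ
    have h3 := norm_le_norm_add_norm_sub' (u τ) (u σ₀)
    linarith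
  have hMle : M ≤ 2 * (‖u σ₀‖ + s * ‖w σ₀‖) := by
    have : s * (L * s * M) ≤ M / 2 := by nlinarith
    linarith
  refine ⟨(huM σ hσ).trans hMle, (hwB σ hσ).trans ?_⟩
  gcongr

structure ForcedFlow (a : ℝ → E3 → E3) (t L A : ℝ) (X V : ℝ → E3 → E3 → E3) : Prop where
  t_nonneg : 0 ≤ t
  L_nonneg : 0 ≤ L
  A_nonneg : 0 ≤ A
  cont : Continuous fun q : ℝ × E3 => a q.1 q.2
  lip : ∀ s ∈ Icc 0 t, ∀ x y, ‖a s x - a s y‖ ≤ L * ‖x - y‖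
  bound : ∀ s ∈ Icc 0 t, ∀ x, ‖a s x‖ ≤ A
  small : L * t ^ 2 ≤ 1 / 2
  init_X : ∀ x v, X 0 x v = x
  init_V : ∀ x v, V 0 x v = v
  ode_X : ∀ x v, ∀ s ∈ Icc 0 t, HasDerivAt (fun s => X s x v) (-(V s x v)) s
  ode_V : ∀ x v, ∀ s ∈ Icc 0 t, HasDerivAt (fun s => V s x v) (-(a s (X s x v))) s

def flowMap (X V : ℝ → E3 → E3 → E3) (s : ℝ) (z : E3 × E3) : E3 × E3 :=
  (X s z.1 z.2, V s z.1 z.2)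

namespace ForcedFlow

variable {a : ℝ → E3 → E3} {t L A : ℝ} {X V : ℝ → E3 → E3 → E3}

theorem norm_X_V_sub_le (h : ForcedFlow a t L A X V) {s σ₀ σ : ℝ} (hs : s ≤ t) (hσ₀ : σ₀ ∈ Icc 0 s)
    (hσ : σ ∈ Icc 0 s) (x v y w : E3) :
    ‖X σ x v - X σ y w‖ ≤ 2 * (‖X σ₀ x v - X σ₀ y w‖ + s * ‖V σ₀ x v - V σ₀ y w‖) ∧
    ‖V σ x v - V σ y w‖ ≤ ‖V σ₀ x v - V σ₀ y w‖ +
      L * s * (2 * (‖X σ₀ x v - X σ₀ y w‖ + s * ‖V σ₀ x v - V σ₀ y w‖)) := by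
  have hsub : ∀ r ∈ Icc 0 s, r ∈ Icc 0 t := fun r hr => ⟨hr.1, hr.2.trans hs⟩
  have hs0 : 0 ≤ s := hσ.1.trans hσ.2
  refine norm_le_of_second_order (u := fun r => X r x v - X r y w)
    (w := fun r => V r x v - V r y w) h.L_nonneg ?_
    (fun r hr => (h.ode_X x v r (hsub r hr)).sub (h.ode_X y w r (hsub r hr)))
    (fun r hr => (h.ode_V x v r (hsub r hr)).sub (h.ode_V y w r (hsub r hr)))
    (fun r _ => ?_) (fun r hr => ?_) hσ₀ hσ
  · refine le_trans ?_ h.small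
    have := h.L_nonneg
    gcongr
  · rw [neg_sub_neg, norm_sub_rev]
  · rw [neg_sub_neg, norm_sub_rev]
    exact h.lip r (hsub r hr) _ _

def lipConst (t L : ℝ) : NNReal :=
  Real.toNNReal (2 * (1 + t) + (1 + L * t * (2 * (1 + t))))

theorem dist_flowMap_le (h : ForcedFlow a t L A X V) {σ₀ σ : ℝ} (hσ₀ : σ₀ ∈ Icc 0 t)
    (hσ : σ ∈ Icc 0 t) (z z' : E3 × E3) :
    dist (flowMap X V σ z) (flowMap X V σ z')
      ≤ lipConst t L * dist (flowMap X V σ₀ z) (flowMap X V σ₀ z') := by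
  have ht := h.t_nonneg
  have hL := h.L_nonneg
  obtain ⟨h1, h2⟩ := h.norm_X_V_sub_le le_rfl hσ₀ hσ z.1 z.2 z'.1 z'.2
  rw [← dist_eq_norm, ← dist_eq_norm, ← dist_eq_norm] at h1 h2
  set d := dist (flowMap X V σ₀ z) (flowMap X V σ₀ z') with hd
  have d0 : 0 ≤ d := dist_nonneg
  have d1 : dist (X σ₀ z.1 z.2) (X σ₀ z'.1 z'.2) ≤ d := le_max_left _ _
  have d2 : dist (V σ₀ z.1 z.2) (V σ₀ z'.1 z'.2) ≤ d := le_max_right _ _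
  have e : dist (X σ₀ z.1 z.2) (X σ₀ z'.1 z'.2) + t * dist (V σ₀ z.1 z.2) (V σ₀ z'.1 z'.2)
      ≤ (1 + t) * d := by nlinarith
  have hK : (lipConst t L : ℝ) = 2 * (1 + t) + (1 + L * t * (2 * (1 + t))) :=
    Real.coe_toNNReal _ (by positivity)
  rw [hK]
  have p1 : 0 ≤ 2 * (1 + t) * d := by positivity
  have p2 : 0 ≤ (1 + L * t * (2 * (1 + t))) * d := by positivity
  refine max_le (h1.trans ?_) (h2.trans ?_)
  · linarith
  · have : L * t * (2 * (dist (X σ₀ z.1 z.2) (X σ₀ z'.1 z'.2) +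
        t * dist (V σ₀ z.1 z.2) (V σ₀ z'.1 z'.2))) ≤ L * t * (2 * ((1 + t) * d)) := by gcongr
    linarith

theorem flowMap_zero (h : ForcedFlow a t L A X V) (z : E3 × E3) : flowMap X V 0 z = z := by
  simp [flowMap, h.init_X, h.init_V]

theorem lipschitzWith_flowMap (h : ForcedFlow a t L A X V) {s : ℝ} (hs : s ∈ Icc 0 t) :
    LipschitzWith (lipConst t L) (flowMap X V s) :=
  LipschitzWith.of_dist_le_mul fun z z' => by
    have := h.dist_flowMap_le (left_mem_Icc.2 h.t_nonneg) hs z z'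
    rwa [h.flowMap_zero, h.flowMap_zero] at this

theorem antilipschitzWith_flowMap (h : ForcedFlow a t L A X V) {s : ℝ} (hs : s ∈ Icc 0 t) :
    AntilipschitzWith (lipConst t L) (flowMap X V s) :=
  AntilipschitzWith.of_le_mul_dist fun z z' => by
    have := h.dist_flowMap_le hs (left_mem_Icc.2 h.t_nonneg) z z'
    rwa [h.flowMap_zero, h.flowMap_zero] at this

theorem norm_fst_sub_le_of_fst_eq (h : ForcedFlow a t L A X V) {s : ℝ} (hs : s ∈ Icc 0 t)
    {z z' : E3 × E3} (he : (flowMap X V s z).1 = (flowMap X V s z').1) :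
    ‖z.1 - z'.1‖ ≤ 2 * s * ‖(flowMap X V s z).2 - (flowMap X V s z').2‖ := by
  have h1 := (h.norm_X_V_sub_le hs.2 (right_mem_Icc.2 hs.1) (left_mem_Icc.2 hs.1) z.1 z.2 z'.1 z'.2).1
  rw [h.init_X, h.init_X] at h1
  have h2 : X s z.1 z.2 - X s z'.1 z'.2 = 0 := sub_eq_zero.2 he
  rw [h2, norm_zero, zero_add] at h1
  exact h1.trans_eq (by simp only [flowMap]; ring)

theorem norm_V_sub_le (h : ForcedFlow a t L A X V) {s : ℝ} (hs : s ∈ Icc 0 t) (x v : E3) :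
    ‖V s x v - v‖ ≤ A * s := by
  have := Convex.norm_image_sub_le_of_norm_hasDerivWithin_le (C := A)
    (fun r hr => (h.ode_V x v r hr).hasDerivWithinAt)
    (fun r hr => by rw [norm_neg]; exact h.bound r hr _) (convex_Icc 0 t)
    (left_mem_Icc.2 h.t_nonneg) hs
  rwa [h.init_V, sub_zero, Real.norm_of_nonneg hs.1] at this

theorem continuousOn_flowMap (h : ForcedFlow a t L A X V) :
    ContinuousOn (fun q : ℝ × E3 × E3 => flowMap X V q.1 q.2) (Icc 0 t ×ˢ univ) :=
  continuousOn_prod_of_continuousOn_lipschitzOnWith' _ (lipConst t L)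
    (fun _ hs => (h.lipschitzWith_flowMap hs).lipschitzOnWith)
    fun z _ s hs => ((h.ode_X z.1 z.2 s hs).continuousAt.prodMk
      (h.ode_V z.1 z.2 s hs).continuousAt).continuousWithinAt

end ForcedFlow

theorem measurePreserving_shear {c : E3 → E3} (hc : Measurable c) :
    MeasurePreserving (fun z : E3 × E3 => (z.1, z.2 + c z.1)) volume volume := by
  refine (MeasurePreserving.id (volume : Measure E3)).skew_product (g := fun x v => v + c x)
    (by fun_prop) (ae_of_all _ fun x => ?_)
  exact map_add_right_eq_self volume (c x)

theorem measurePreserving_drift (h : ℝ) :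
    MeasurePreserving (fun z : E3 × E3 => (z.1 - h • z.2, z.2)) volume volume := by
  have h1 : MeasurePreserving (Prod.swap : E3 × E3 → E3 × E3) volume volume :=
    Measure.measurePreserving_swap
  have := h1.comp ((measurePreserving_shear (c := fun v => -(h • v)) (by fun_prop)).comp h1)
  simpa [Function.comp_def, sub_eq_add_neg] using this

def leapStep (a : ℝ → E3 → E3) (h σ : ℝ) (z : E3 × E3) : E3 × E3 :=
  (z.1 - h • (z.2 - h • a σ z.1), z.2 - h • a σ z.1)

def leap (a : ℝ → E3 → E3) (h : ℝ) : ℕ → E3 × E3 → E3 × E3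
  | 0 => id
  | k + 1 => leapStep a h (k * h) ∘ leap a h k

section

variable {a : ℝ → E3 → E3}

theorem continuous_leap (ha : Continuous fun q : ℝ × E3 => a q.1 q.2) (h : ℝ) (k : ℕ) :
    Continuous (leap a h k) := by
  induction k with
  | zero => exact continuous_id
  | succ k ih =>
    refine Continuous.comp ?_ ih
    have : Continuous fun z : E3 × E3 => a (k * h) z.1 :=
      ha.comp (continuous_const.prodMk continuous_fst)
    unfold leapStep
    fun_prop

theorem measurePreserving_leap (ha : Continuous fun q : ℝ × E3 => a q.1 q.2) (h : ℝ) (k : ℕ) :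
    MeasurePreserving (leap a h k) volume volume := by
  induction k with
  | zero => exact MeasurePreserving.id _
  | succ k ih =>
    refine MeasurePreserving.comp ?_ ih
    have hc : Measurable fun x => -(h • a (k * h) x) := by
      have : Continuous fun x => a (k * h) x := ha.comp (continuous_const.prodMk continuous_id)
      exact (this.const_smul h).neg.measurable
    have e : leapStep a h (k * h) = (fun z : E3 × E3 => (z.1 - h • z.2, z.2)) ∘
        fun z : E3 × E3 => (z.1, z.2 + -(h • a (k * h) z.1)) := by
      funext z
      simp only [Function.comp, leapStep, sub_eq_add_neg]
    rw [e]
    exact (measurePreserving_drift h).comp (measurePreserving_shear hc)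

end

namespace ForcedFlow

variable {a : ℝ → E3 → E3} {t L A : ℝ} {X V : ℝ → E3 → E3 → E3}

theorem dist_leapStep_le (hF : ForcedFlow a t L A X V) {h σ : ℝ} (hh : h ∈ Icc 0 t)
    (hσ : σ ∈ Icc 0 t) (z z' : E3 × E3) :
    dist (leapStep a h σ z) (leapStep a h σ z') ≤ (1 + (1 + L + t * L) * h) * dist z z' := by
  set d := dist z z' with hd
  have d0 : 0 ≤ d := dist_nonneg
  have d1 : ‖z.1 - z'.1‖ ≤ d := by rw [← dist_eq_norm]; exact le_max_left _ _
  have d2 : ‖z.2 - z'.2‖ ≤ d := by rw [← dist_eq_norm]; exact le_max_right _ _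
  have hL := hF.L_nonneg
  have h0 := hh.1
  have hv : ‖(leapStep a h σ z).2 - (leapStep a h σ z').2‖ ≤ d + h * (L * d) := by
    have e : (leapStep a h σ z).2 - (leapStep a h σ z').2
        = (z.2 - z'.2) - h • (a σ z.1 - a σ z'.1) := by
      simp only [leapStep, smul_sub]; abel
    rw [e]
    refine (norm_sub_le _ _).trans ?_
    rw [norm_smul, Real.norm_of_nonneg h0]
    gcongr
    exact (hF.lip σ hσ _ _).trans (by gcongr)
  have hx : ‖(leapStep a h σ z).1 - (leapStep a h σ z').1‖ ≤ d + h * (d + h * (L * d)) := by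
    have e : (leapStep a h σ z).1 - (leapStep a h σ z').1
        = (z.1 - z'.1) - h • ((leapStep a h σ z).2 - (leapStep a h σ z').2) := by
      simp only [leapStep, smul_sub]; abel
    rw [e]
    refine (norm_sub_le _ _).trans ?_
    rw [norm_smul, Real.norm_of_nonneg h0]
    gcongr
  have hht : h * (h * (L * d)) ≤ t * (h * (L * d)) := by gcongr; exact hh.2
  have p1 : 0 ≤ h * (L * d) := by positivity
  have p2 : 0 ≤ t * (h * (L * d)) := mul_nonneg hF.t_nonneg p1
  have p3 : 0 ≤ h * d := by positivity
  refine max_le ?_ ?_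
  · rw [dist_eq_norm]; nlinarith
  · rw [dist_eq_norm]; nlinarith

theorem norm_leap_sub_le (hF : ForcedFlow a t L A X V) {h : ℝ} {N : ℕ} (hh : 0 ≤ h)
    (hN : N * h ≤ t) (z : E3 × E3) (k : ℕ) (hk : k ≤ N) :
    ‖(leap a h k z).2 - z.2‖ ≤ k * h * A ∧
      ‖(leap a h k z).1 - z.1‖ ≤ k * h * (‖z.2‖ + t * A) := by
  induction k with
  | zero => simp [leap]
  | succ k ih =>
    obtain ⟨i1, i2⟩ := ih (by omega)
    have hA := hF.A_nonneg
    have hkN : (k + 1 : ℝ) ≤ N := by exact_mod_cast hk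
    have hkt : (k + 1) * h ≤ t := (mul_le_mul_of_nonneg_right hkN hh).trans hN
    have hσ : (k : ℝ) * h ∈ Icc 0 t := ⟨by positivity, by nlinarith⟩
    have hb := hF.bound _ hσ (leap a h k z).1
    have e2 : (leap a h (k + 1) z).2 - z.2
        = ((leap a h k z).2 - z.2) - h • a (k * h) (leap a h k z).1 := by
      simp only [leap, leapStep, Function.comp]; abel
    have e1 : (leap a h (k + 1) z).1 - z.1
        = ((leap a h k z).1 - z.1) - h • (((leap a h (k + 1) z).2 - z.2) + z.2) := by
      simp only [leap, leapStep, Function.comp, smul_sub, sub_add_cancel]; abel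
    have j2 : ‖(leap a h (k + 1) z).2 - z.2‖ ≤ (k + 1) * h * A := by
      rw [e2]
      refine (norm_sub_le _ _).trans ?_
      rw [norm_smul, Real.norm_of_nonneg hh]
      nlinarith [mul_le_mul_of_nonneg_left hb hh]
    push_cast
    refine ⟨j2, ?_⟩
    rw [e1]
    refine (norm_sub_le _ _).trans ?_
    rw [norm_smul, Real.norm_of_nonneg hh]
    have j3 := norm_add_le ((leap a h (k + 1) z).2 - z.2) z.2
    have j4 : (k + 1) * h * A ≤ t * A := by gcongr
    have j5 : ‖(leap a h (k + 1) z).2 - z.2 + z.2‖ ≤ ‖z.2‖ + t * A := by linarith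
    nlinarith [mul_le_mul_of_nonneg_left j5 hh]

theorem dist_leap_flowMap_le (hF : ForcedFlow a t L A X V) {s ε h : ℝ} {N : ℕ} (hs : s ∈ Icc 0 t)
    (hh : 0 ≤ h) (hN : N * h = s) (hε : 0 ≤ ε) (hAε : h * A ≤ ε) (z : E3 × E3)
    (hmod : ∀ r ∈ Icc 0 s, ∀ r' ∈ Icc 0 s, |r' - r| ≤ h →
      ‖V r' z.1 z.2 - V r z.1 z.2‖ ≤ ε ∧
      ‖a r' (X r' z.1 z.2) - a r (X r z.1 z.2)‖ ≤ ε) (k : ℕ) (hk : k ≤ N) :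
    dist (leap a h k z) (flowMap X V (k * h) z)
      ≤ 2 * (k * h) * ε * (1 + (1 + L + t * L) * h) ^ k := by
  induction k with
  | zero => simp [leap, hF.flowMap_zero]
  | succ k ih =>
    have ih := ih (by omega)
    have hkN : (k + 1 : ℝ) ≤ N := by exact_mod_cast hk
    have hkt : (k + 1) * h ≤ s := (mul_le_mul_of_nonneg_right hkN hh).trans hN.le
    set σ := (k : ℝ) * h with hσd
    have hσ0 : 0 ≤ σ := by positivity
    have hσ' : (k + 1 : ℝ) * h = σ + h := by rw [hσd]; ring
    rw [hσ'] at hkt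
    have hσs : σ ∈ Icc 0 s := ⟨hσ0, by linarith⟩
    have hσt : σ ∈ Icc 0 t := ⟨hσ0, by linarith [hs.2]⟩
    have hht : h ∈ Icc 0 t := ⟨hh, by linarith [hs.2]⟩
    have hin : ∀ r ∈ Icc σ (σ + h), r ∈ Icc 0 s := fun r hr => ⟨hσ0.trans hr.1, hr.2.trans hkt⟩
    have hin' : ∀ r ∈ Icc σ (σ + h), r ∈ Icc 0 t := fun r hr =>
      ⟨hσ0.trans hr.1, (hr.2.trans hkt).trans hs.2⟩
    have habs : ∀ r ∈ Icc σ (σ + h), |r - σ| ≤ h := fun r hr => by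
      rw [abs_le]; constructor <;> linarith [hr.1, hr.2]
    have hl : σ ∈ Icc σ (σ + h) := left_mem_Icc.2 (by linarith)
    have hr : σ + h ∈ Icc σ (σ + h) := right_mem_Icc.2 (by linarith)
    have cV := Convex.norm_image_sub_le_of_norm_hasDerivWithin_le (C := ε)
      (f := fun r => V r z.1 z.2 + r • a σ (X σ z.1 z.2))
      (f' := fun r => -(a r (X r z.1 z.2)) + (1 : ℝ) • a σ (X σ z.1 z.2))
      (fun r hr => ((hF.ode_V z.1 z.2 r (hin' r hr)).add
        ((hasDerivAt_id r).smul_const _)).hasDerivWithinAt)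
      (fun r hr => by
        rw [one_smul, neg_add_eq_sub, norm_sub_rev]
        exact (hmod σ hσs r (hin r hr) (habs r hr)).2) (convex_Icc σ (σ + h)) hl hr
    have cX := Convex.norm_image_sub_le_of_norm_hasDerivWithin_le (C := ε)
      (f := fun r => X r z.1 z.2 + r • V σ z.1 z.2)
      (f' := fun r => -(V r z.1 z.2) + (1 : ℝ) • V σ z.1 z.2)
      (fun r hr => ((hF.ode_X z.1 z.2 r (hin' r hr)).add
        ((hasDerivAt_id r).smul_const _)).hasDerivWithinAt)
      (fun r hr => by
        rw [one_smul, neg_add_eq_sub, norm_sub_rev]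
        exact (hmod σ hσs r (hin r hr) (habs r hr)).1) (convex_Icc σ (σ + h)) hl hr
    simp only [add_sub_cancel_left, Real.norm_of_nonneg hh] at cV cX
    have hstep : dist (leapStep a h σ (flowMap X V σ z)) (flowMap X V (σ + h) z) ≤ 2 * h * ε := by
      refine max_le ?_ ?_
      · rw [dist_comm, dist_eq_norm]
        have e : (flowMap X V (σ + h) z).1 - (leapStep a h σ (flowMap X V σ z)).1
            = (X (σ + h) z.1 z.2 + (σ + h) • V σ z.1 z.2 - (X σ z.1 z.2 + σ • V σ z.1 z.2))
              - h • h • a σ (X σ z.1 z.2) := by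
          simp only [flowMap, leapStep, smul_sub, add_smul]; abel
        rw [e]
        refine (norm_sub_le _ _).trans ?_
        rw [norm_smul, norm_smul, Real.norm_of_nonneg hh]
        have := hF.bound σ hσt (X σ z.1 z.2)
        have : h * (h * ‖a σ (X σ z.1 z.2)‖) ≤ h * ε := by
          gcongr; exact (mul_le_mul_of_nonneg_left this hh).trans hAε
        linarith
      · rw [dist_comm, dist_eq_norm]
        have e : (flowMap X V (σ + h) z).2 - (leapStep a h σ (flowMap X V σ z)).2
            = (V (σ + h) z.1 z.2 + (σ + h) • a σ (X σ z.1 z.2)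
              - (V σ z.1 z.2 + σ • a σ (X σ z.1 z.2))) := by
          simp only [flowMap, leapStep, add_smul]; abel
        rw [e]
        nlinarith [mul_nonneg hh hε]
    set C := 1 + L + t * L with hC
    have hC0 : 0 ≤ C := by
      have := hF.L_nonneg; have := hF.t_nonneg; positivity
    have hpow : 1 ≤ (1 + C * h) ^ (k + 1) := one_le_pow₀ (by nlinarith [mul_nonneg hC0 hh])
    have e : leap a h (k + 1) z = leapStep a h σ (leap a h k z) := rfl
    push_cast
    rw [hσ', e]
    refine (dist_triangle _ (leapStep a h σ (flowMap X V σ z)) _).trans ?_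
    have h1 := hF.dist_leapStep_le hht hσt (leap a h k z) (flowMap X V σ z)
    have h2 : (1 + C * h) * dist (leap a h k z) (flowMap X V σ z)
        ≤ (1 + C * h) * (2 * σ * ε * (1 + C * h) ^ k) := by gcongr
    have h3 : 2 * h * ε ≤ 2 * h * ε * (1 + C * h) ^ (k + 1) := le_mul_of_one_le_right (by positivity) hpow
    calc _ ≤ (1 + C * h) * (2 * σ * ε * (1 + C * h) ^ k) + 2 * h * ε * (1 + C * h) ^ (k + 1) := by
          linarith
      _ = _ := by ring

theorem tendsto_leap (hF : ForcedFlow a t L A X V) {s : ℝ} (hs : s ∈ Icc 0 t) (z : E3 × E3) :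
    Tendsto (fun n : ℕ => leap a (s / (n + 1 : ℕ)) (n + 1) z) atTop (nhds (flowMap X V s z)) := by
  set C := 1 + L + t * L with hC
  have hC0 : 0 ≤ C := by
    have := hF.L_nonneg; have := hF.t_nonneg; positivity
  have hs0 := hs.1
  have hsub : ∀ r ∈ Icc 0 s, r ∈ Icc 0 t := fun r hr => ⟨hr.1, hr.2.trans hs.2⟩
  have uV : UniformContinuousOn (fun r => V r z.1 z.2) (Icc 0 s) :=
    isCompact_Icc.uniformContinuousOn_of_continuous fun r hr =>
      (hF.ode_V z.1 z.2 r (hsub r hr)).continuousAt.continuousWithinAt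
  have ua : UniformContinuousOn (fun r => a r (X r z.1 z.2)) (Icc 0 s) :=
    isCompact_Icc.uniformContinuousOn_of_continuous fun r hr => by
      have h1 := (hF.ode_X z.1 z.2 r (hsub r hr)).continuousAt
      exact (ContinuousAt.comp (f := fun r => (r, X r z.1 z.2)) hF.cont.continuousAt
        (continuousAt_id.prodMk h1)).continuousWithinAt
  rw [Metric.tendsto_atTop]
  intro ε' hε'
  set W := 2 * s * Real.exp (C * s) + 1 with hW
  have hW0 : 0 < W := by positivity
  set ε := ε' / W with hε
  have hε0 : 0 < ε := by positivity
  obtain ⟨δ1, hδ1, h1⟩ := Metric.uniformContinuousOn_iff.1 uV ε hε0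
  obtain ⟨δ2, hδ2, h2⟩ := Metric.uniformContinuousOn_iff.1 ua ε hε0
  have hA := hF.A_nonneg
  have hlim : Tendsto (fun n : ℕ => s / (n + 1 : ℕ)) atTop (nhds 0) :=
    (tendsto_const_div_atTop_nhds_zero_nat s).comp (tendsto_add_atTop_nat 1)
  have hlimA : Tendsto (fun n : ℕ => s / (n + 1 : ℕ) * A) atTop (nhds 0) := by
    simpa using hlim.mul_const A
  have ev := (hlim.eventually_lt_const hδ1).and ((hlim.eventually_lt_const hδ2).and
    (hlimA.eventually_lt_const hε0))
  obtain ⟨N, hN⟩ := eventually_atTop.1 ev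
  refine ⟨N, fun n hn => ?_⟩
  obtain ⟨e1, e2, e3⟩ := hN n hn
  set h := s / (n + 1 : ℕ) with hh
  have hn0 : ((n + 1 : ℕ) : ℝ) ≠ 0 := by positivity
  have hNs : ((n + 1 : ℕ) : ℝ) * h = s := by rw [hh]; field_simp
  have hh0 : 0 ≤ h := by positivity
  have key := hF.dist_leap_flowMap_le hs hh0 hNs hε0.le e3.le z (fun r hr r' hr' hd => by
    rw [← dist_eq_norm, ← dist_eq_norm]
    exact ⟨(h1 r' hr' r hr (hd.trans_lt e1)).le, (h2 r' hr' r hr (hd.trans_lt e2)).le⟩) (n + 1) le_rfl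
  rw [hNs] at key
  refine key.trans_lt ?_
  have hexp : (1 + C * h) ^ (n + 1) ≤ Real.exp (C * s) := by
    calc (1 + C * h) ^ (n + 1) ≤ Real.exp (C * h) ^ (n + 1) := by
          gcongr; rw [add_comm]; exact Real.add_one_le_exp _
      _ = Real.exp (C * s) := by rw [← Real.exp_nat_mul, ← hNs]; ring_nf
  calc 2 * s * ε * (1 + C * h) ^ (n + 1) ≤ 2 * s * ε * Real.exp (C * s) := by gcongr
    _ < W * ε := by rw [hW]; nlinarith
    _ = ε' := by rw [hε]; field_simp

theorem integral_comp_flowMap (hF : ForcedFlow a t L A X V) {s : ℝ} (hs : s ∈ Icc 0 t)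
    {g : E3 × E3 → ℝ} (hg : Continuous g) (hgc : HasCompactSupport g) :
    ∫ z, g (flowMap X V s z) = ∫ z, g z := by
  obtain ⟨M, hM⟩ := hgc.exists_bound_of_continuous hg
  obtain ⟨r, hr⟩ := hgc.isCompact.isBounded.subset_closedBall (0 : E3 × E3)
  have hA := hF.A_nonneg
  have ht := hF.t_nonneg
  set b : E3 × E3 → ℝ := (Metric.closedBall (0 : E3 × E3)
    (r + t * A + t * (r + t * A + t * A))).indicator fun _ => M with hb
  have hbi : Integrable b := (integrable_indicator_iff Metric.isClosed_closedBall.measurableSet).2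
    (integrableOn_const (isCompact_closedBall _ _).measure_ne_top)
  have hmeas := fun n : ℕ => (hg.comp (continuous_leap hF.cont (s / (n + 1 : ℕ)) (n + 1)))
  have hlim := tendsto_integral_of_dominated_convergence (μ := volume) b
    (F := fun (n : ℕ) z => g (leap a (s / (n + 1 : ℕ)) (n + 1) z))
    (f := fun z => g (flowMap X V s z)) (fun n => (hmeas n).aestronglyMeasurable) hbi
    (fun n => ae_of_all _ fun z => ?_)
    (ae_of_all _ fun z => (hg.tendsto _).comp (hF.tendsto_leap hs z))
  · have hc : ∀ n : ℕ, ∫ z, g (leap a (s / (n + 1 : ℕ)) (n + 1) z) = ∫ z, g z := fun n => by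
      have hmp := measurePreserving_leap hF.cont (s / (n + 1 : ℕ)) (n + 1)
      have := integral_map (μ := volume) hmp.measurable.aemeasurable (f := g)
        hg.aestronglyMeasurable
      rw [← this, hmp.map_eq]
    simp only [hc] at hlim
    exact tendsto_nhds_unique hlim tendsto_const_nhds
  · by_cases hz : g (leap a (s / (n + 1 : ℕ)) (n + 1) z) = 0
    · rw [hz, norm_zero]
      exact indicator_nonneg (fun _ _ => (norm_nonneg _).trans (hM 0)) _
    · have hmem := hr (subset_tsupport _ hz)
      rw [mem_closedBall_zero_iff] at hmem
      have hn0 : ((n + 1 : ℕ) : ℝ) ≠ 0 := by positivity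
      have hNs : ((n + 1 : ℕ) : ℝ) * (s / (n + 1 : ℕ)) = s := by field_simp
      have hs0 := hs.1
      obtain ⟨i2, i1⟩ := hF.norm_leap_sub_le (N := n + 1) (by positivity) (hNs.trans_le hs.2) z (n + 1) le_rfl
      rw [hNs] at i1 i2
      set y := leap a (s / (n + 1 : ℕ)) (n + 1) z
      have y1 : ‖y.1‖ ≤ r := (norm_fst_le y).trans hmem
      have y2 : ‖y.2‖ ≤ r := (norm_snd_le y).trans hmem
      have i2' : s * A ≤ t * A := by gcongr; exact hs.2
      have z2 : ‖z.2‖ ≤ r + t * A := by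
        have := norm_le_norm_add_norm_sub y.2 z.2
        linarith
      have i1' : s * (‖z.2‖ + t * A) ≤ t * (r + t * A + t * A) := by
        gcongr; exact hs.2
      have z1 : ‖z.1‖ ≤ r + t * (r + t * A + t * A) := by
        have := norm_le_norm_add_norm_sub y.1 z.1
        linarith
      have tA : 0 ≤ t * A := by positivity
      have hr0 : 0 ≤ r := (norm_nonneg _).trans hmem
      have tX : 0 ≤ t * (r + t * A + t * A) := by positivity
      have : z ∈ Metric.closedBall (0 : E3 × E3) (r + t * A + t * (r + t * A + t * A)) := by
        rw [mem_closedBall_zero_iff]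
        exact max_le (by linarith) (by linarith)
      rw [hb, indicator_of_mem this]
      exact hM _

theorem isClosedEmbedding_flowMap (hF : ForcedFlow a t L A X V) {s : ℝ} (hs : s ∈ Icc 0 t) :
    Topology.IsClosedEmbedding (flowMap X V s) :=
  (hF.antilipschitzWith_flowMap hs).isClosedEmbedding (hF.lipschitzWith_flowMap hs).uniformContinuous

theorem measurePreserving_flowMap (hF : ForcedFlow a t L A X V) {s : ℝ} (hs : s ∈ Icc 0 t) :
    MeasurePreserving (flowMap X V s) volume volume := by
  have hcl := hF.isClosedEmbedding_flowMap hs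
  have hm : Measurable (flowMap X V s) := hcl.continuous.measurable
  refine ⟨hm, ?_⟩
  have : IsFiniteMeasureOnCompacts (Measure.map (flowMap X V s) volume) := ⟨fun K hK => by
    rw [Measure.map_apply hm hK.measurableSet]
    exact (hcl.isCompact_preimage hK).measure_lt_top⟩
  have : IsLocallyFiniteMeasure (Measure.map (flowMap X V s) volume) :=
    isLocallyFiniteMeasure_of_isFiniteMeasureOnCompacts
  refine Measure.ext_of_integral_eq_on_compactlySupported fun g => ?_
  refine (integral_map hm.aemeasurable (f := fun z => g z) g.continuous.aestronglyMeasurable).trans ?_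
  exact hF.integral_comp_flowMap hs g.continuous g.hasCompactSupport

theorem surjective_flowMap (hF : ForcedFlow a t L A X V) {s : ℝ} (hs : s ∈ Icc 0 t) :
    Function.Surjective (flowMap X V s) := by
  have hcl := hF.isClosedEmbedding_flowMap hs
  rw [← range_eq_univ, ← compl_empty_iff]
  by_contra hne
  have h1 : 0 < volume (range (flowMap X V s))ᶜ :=
    hcl.isClosed_range.isOpen_compl.measure_pos _ (nonempty_iff_ne_empty.2 hne)
  rw [← (hF.measurePreserving_flowMap hs).measure_preimage
    hcl.isClosed_range.measurableSet.compl.nullMeasurableSet, preimage_compl, preimage_range,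
    compl_univ, measure_empty] at h1
  exact lt_irrefl _ h1

def homeomorph (hF : ForcedFlow a t L A X V) {s : ℝ} (hs : s ∈ Icc 0 t) :
    (E3 × E3) ≃ₜ (E3 × E3) :=
  (hF.isClosedEmbedding_flowMap hs).isEmbedding.toHomeomorphOfSurjective (hF.surjective_flowMap hs)

end ForcedFlow

theorem abs_sub_le_of_fderiv_near {ψ : E3 → ℝ} (hψ : ContDiff ℝ 1 ψ) {x : E3} {δ ε : ℝ}
    (hδ : ∀ y, dist y x < δ → ‖fderiv ℝ ψ y - fderiv ℝ ψ x‖ ≤ ε) {y : E3} (hy : dist y x < δ) :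
    |ψ y - ψ x| ≤ (‖fderiv ℝ ψ x‖ + ε) * ‖y - x‖ := by
  have h0 : 0 < δ := dist_nonneg.trans_lt hy
  refine Convex.norm_image_sub_le_of_norm_fderiv_le (𝕜 := ℝ) (s := Metric.ball x δ)
    (fun z _ => (hψ.differentiable one_ne_zero) z) (fun z hz => ?_) (convex_ball x δ)
    (Metric.mem_ball_self h0) hy
  have := norm_le_norm_add_norm_sub' (fderiv ℝ ψ z) (fderiv ℝ ψ x)
  linarith [hδ z hz]

namespace ForcedFlow

variable {a : ℝ → E3 → E3} {t L A : ℝ} {X V : ℝ → E3 → E3 → E3}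

theorem abs_integral_fderiv_comp_flowMap_le (hF : ForcedFlow a t L A X V) {s : ℝ}
    (hs : s ∈ Icc 0 t) {f : E3 × E3 → ℝ} (hf : ContDiff ℝ 1 f) (hfc : HasCompactSupport f)
    (hf0 : ∀ z, 0 ≤ f z) {G : E3 → E3} (hG : Continuous G) {ψ : E3 → ℝ} (hψ : ContDiff ℝ 1 ψ)
    (hψc : HasCompactSupport ψ) :
    |∫ z, fderiv ℝ f (flowMap X V s z) (0, G (flowMap X V s z).1) * ψ z.1|
      ≤ 2 * s * ∫ z, ‖G (flowMap X V s z).1‖ * f (flowMap X V s z) * ‖fderiv ℝ ψ z.1‖ := by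
  set Φ := hF.homeomorph hs with hΦ
  have hmp : MeasurePreserving Φ volume volume := hF.measurePreserving_flowMap hs
  have hme : MeasurableEmbedding Φ := Φ.measurableEmbedding
  set Y : E3 × E3 → E3 := fun z => (Φ.symm z).1 with hY
  have hYc : Continuous Y := continuous_fst.comp Φ.symm.continuous
  set g : E3 × E3 → ℝ := fun z => fderiv ℝ f z (0, G z.1) with hg
  have hDc : Continuous (fderiv ℝ f) := hf.continuous_fderiv one_ne_zero
  have hgc : Continuous g := hDc.clm_apply
    (continuous_const.prodMk (hG.comp continuous_fst))
  have hfc' := hf.continuous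
  have e1 : ∫ z, fderiv ℝ f (flowMap X V s z) (0, G (flowMap X V s z).1) * ψ z.1
      = ∫ z, g z * ψ (Y z) := by
    rw [← hmp.integral_comp hme fun z => g z * ψ (Y z)]
    refine integral_congr_ae (ae_of_all _ fun z => ?_)
    simp only [hY, hg, Homeomorph.symm_apply_apply]
    rfl
  have e2 : ∫ z, ‖G (flowMap X V s z).1‖ * f (flowMap X V s z) * ‖fderiv ℝ ψ z.1‖
      = ∫ z, ‖G z.1‖ * f z * ‖fderiv ℝ ψ (Y z)‖ := by
    rw [← hmp.integral_comp hme fun z => ‖G z.1‖ * f z * ‖fderiv ℝ ψ (Y z)‖]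
    refine integral_congr_ae (ae_of_all _ fun z => ?_)
    simp only [hY, Homeomorph.symm_apply_apply]
    rfl
  rw [e1, e2]
  have hψ'c : Continuous (fderiv ℝ ψ) := hψ.continuous_fderiv one_ne_zero
  have hψu : UniformContinuous (fderiv ℝ ψ) :=
    (hψc.fderiv (𝕜 := ℝ)).uniformContinuous_of_continuous hψ'c
  have hint1 : Integrable fun z => ‖G z.1‖ * f z * ‖fderiv ℝ ψ (Y z)‖ :=
    Continuous.integrable_of_hasCompactSupport (by fun_prop)
      (hfc.mono fun z hz h0 => hz (by simp [h0]))
  have hint2 : Integrable fun z => ‖G z.1‖ * f z :=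
    Continuous.integrable_of_hasCompactSupport (by fun_prop)
      (hfc.mono fun z hz h0 => hz (by simp [h0]))
  obtain ⟨r, hr⟩ := hfc.isCompact.isBounded.subset_closedBall (0 : E3 × E3)
  obtain ⟨MG, hMG⟩ := (isCompact_closedBall (0 : E3) r).exists_bound_of_continuousOn hG.continuousOn
  obtain ⟨Mψ, hMψ⟩ := hψc.exists_bound_of_continuous hψ.continuous
  have hgs : ∀ z, g z ≠ 0 → ‖z‖ ≤ r := fun z hz => by
    have : z ∈ tsupport f := by
      by_contra hz'
      exact hz (by simp [hg, fderiv_of_notMem_tsupport (𝕜 := ℝ) hz'])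
    simpa using hr this
  have hgcs : HasCompactSupport g :=
    HasCompactSupport.of_support_subset_isCompact (isCompact_closedBall (0 : E3 × E3) r)
      fun z hz => by simpa using hgs z hz
  obtain ⟨Mg, hMg⟩ := hgcs.exists_bound_of_continuous hgc
  set S : ℝ → E3 × E3 → E3 × E3 := fun h z => (z.1, z.2 + h • G z.1) with hS
  have hSc : ∀ h, Continuous (S h) := fun h => by rw [hS]; fun_prop
  set J : ℝ → ℝ := fun h => ∫ z, f (S h z) * ψ (Y z) with hJ
  have hJ' : HasDerivAt J (∫ z, g z * ψ (Y z)) 0 := by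
    have hd : ∀ z h, HasDerivAt (fun h => f (S h z) * ψ (Y z)) (g (S h z) * ψ (Y z)) h := by
      intro z h
      have h1 : HasDerivAt (fun h => S h z) (0, G z.1) h := by
        have := (hasDerivAt_const h z.1).prodMk
          (((hasDerivAt_id h).smul_const (G z.1)).const_add z.2)
        simpa using this
      have h2 := ((hf.differentiable one_ne_zero) (S h z)).hasFDerivAt.comp_hasDerivAt h h1
      exact h2.mul_const _
    have := (hasDerivAt_integral_of_dominated_loc_of_deriv_le (μ := (volume : Measure (E3 × E3)))
      (F := fun h z => f (S h z) * ψ (Y z)) (F' := fun h z => g (S h z) * ψ (Y z))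
      (x₀ := (0 : ℝ)) (s := Metric.ball 0 1)
      (bound := (Metric.closedBall (0 : E3 × E3) (r + MG)).indicator fun _ => Mg * Mψ)
      (Metric.ball_mem_nhds 0 one_pos) (Eventually.of_forall fun h =>
        ((hfc'.comp (hSc h)).mul (hψ.continuous.comp hYc)).aestronglyMeasurable) ?_
      (((hgc.comp (hSc 0)).mul (hψ.continuous.comp hYc)).aestronglyMeasurable) ?_
      ((integrable_indicator_iff Metric.isClosed_closedBall.measurableSet).2
        (integrableOn_const (isCompact_closedBall _ _).measure_ne_top))
      (ae_of_all _ fun z h _ => hd z h)).2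
    · simpa [hS] using this
    · simp only [hS, zero_smul, add_zero, Prod.mk.eta]
      exact Continuous.integrable_of_hasCompactSupport (by fun_prop)
        (hfc.mono fun z hz h0 => hz (by simp [h0]))
    · refine ae_of_all _ fun z h hh => ?_
      by_cases hz : g (S h z) = 0
      · rw [hz, zero_mul, norm_zero]
        exact indicator_nonneg (fun _ _ => mul_nonneg ((norm_nonneg _).trans (hMg 0))
          ((norm_nonneg _).trans (hMψ 0))) _
      · have h1 := hgs _ hz
        have h2 : ‖z.1‖ ≤ r := (norm_fst_le (S h z)).trans h1
        have h3 : ‖z.2 + h • G z.1‖ ≤ r := (norm_snd_le (S h z)).trans h1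
        have h4 : ‖h • G z.1‖ ≤ MG := by
          rw [norm_smul]
          have h5 := hMG z.1 (by simpa using h2)
          have h6 : ‖h‖ ≤ 1 := by simpa using (mem_ball_zero_iff.1 hh).le
          nlinarith [norm_nonneg (G z.1), norm_nonneg h]
        have h5 : ‖z.2‖ ≤ r + MG := by
          have := norm_sub_le (z.2 + h • G z.1) (h • G z.1)
          rw [add_sub_cancel_right] at this
          linarith
        have h6 : z ∈ Metric.closedBall (0 : E3 × E3) (r + MG) := by
          rw [mem_closedBall_zero_iff]
          exact max_le (by linarith [norm_nonneg (h • G z.1)]) h5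
        rw [indicator_of_mem h6, norm_mul]
        exact mul_le_mul (hMg _) (hMψ _) (norm_nonneg _) ((norm_nonneg _).trans (hMg 0))
  have hJe : ∀ h, J h = ∫ z, f z * ψ (Y (S (-h) z)) := fun h => by
    have hmpS : MeasurePreserving (S h) volume volume :=
      measurePreserving_shear (hG.measurable.const_smul h)
    have hinv : ∀ z, S (-h) (S h z) = z := fun z => by simp [hS]
    have hinv' : ∀ z, S h (S (-h) z) = z := fun z => by simp [hS]
    let e : (E3 × E3) ≃ₜ (E3 × E3) := ⟨⟨S h, S (-h), hinv, hinv'⟩, hSc h, hSc (-h)⟩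
    have := hmpS.integral_comp e.measurableEmbedding (fun z => f z * ψ (Y (S (-h) z)))
    rw [← this]
    simp only [hinv, hJ]
  have hYlip : ∀ h z, ‖Y (S (-h) z) - Y z‖ ≤ 2 * s * (|h| * ‖G z.1‖) := fun h z => by
    have h1 : flowMap X V s (Φ.symm (S (-h) z)) = S (-h) z := Φ.apply_symm_apply _
    have h2 : flowMap X V s (Φ.symm z) = z := Φ.apply_symm_apply _
    have := hF.norm_fst_sub_le_of_fst_eq hs (z := Φ.symm (S (-h) z)) (z' := Φ.symm z)
      (by rw [h1, h2])
    rw [h1, h2] at this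
    refine this.trans_eq ?_
    simp [hS, norm_smul]
  have hs0 := hs.1
  refine le_of_forall_pos_le_add fun ε hε => ?_
  set I2 := ∫ z, ‖G z.1‖ * f z with hI2
  have hI20 : 0 ≤ I2 := integral_nonneg fun z => mul_nonneg (norm_nonneg _) (hf0 z)
  set I1 := ∫ z, ‖G z.1‖ * f z * ‖fderiv ℝ ψ (Y z)‖ with hI1
  have hI10 : 0 ≤ I1 := integral_nonneg fun z =>
    mul_nonneg (mul_nonneg (norm_nonneg _) (hf0 z)) (norm_nonneg _)
  set ε' := ε / (2 * s * I2 + 1) with hε'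
  have hε'0 : 0 < ε' := by positivity
  have hε'1 : 2 * s * I2 * ε' ≤ ε := by
    rw [hε', mul_div_assoc', div_le_iff₀ (by positivity)]; nlinarith
  obtain ⟨δ, hδ, hδu⟩ := Metric.uniformContinuous_iff.1 hψu ε' hε'0
  have key := hJ'.le_of_lip' (C := 2 * s * (I1 + ε' * I2)) (by positivity) (by
    have hlim : Tendsto (fun h : ℝ => 2 * s * (|h| * MG)) (nhds 0) (nhds 0) := by
      have : Continuous fun h : ℝ => 2 * s * (|h| * MG) := by fun_prop
      simpa using this.tendsto 0
    filter_upwards [hlim.eventually_lt_const hδ] with h hh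
    rw [hJe h, hJe 0, sub_zero]
    simp only [neg_zero]
    have hc1 : ∀ h, Integrable fun z => f z * ψ (Y (S (-h) z)) := fun h =>
      Continuous.integrable_of_hasCompactSupport
        (hfc'.mul (hψ.continuous.comp (hYc.comp (hSc (-h)))))
        (hfc.mono fun z hz h0 => hz (by simp [h0]))
    have hc0 := hc1 0
    simp only [neg_zero] at hc0
    rw [← integral_sub (hc1 h) hc0]
    refine (norm_integral_le_integral_norm _).trans ?_
    have e3 : 2 * s * (I1 + ε' * I2) * ‖h‖ = ∫ z, 2 * s * ‖h‖ * (‖G z.1‖ * f z * ‖fderiv ℝ ψ (Y z)‖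
        + ε' * (‖G z.1‖ * f z)) := by
      rw [integral_const_mul, integral_add hint1 (hint2.const_mul _), integral_const_mul]
      ring
    rw [e3]
    refine integral_mono ((hc1 h).sub hc0).norm ((hint1.add (hint2.const_mul _)).const_mul _)
      fun z => ?_
    have hS0 : S 0 z = z := by simp [hS]
    simp only [hS0]
    by_cases hz : f z = 0
    · simp [hz]
    have hzr : ‖z.1‖ ≤ r := (norm_fst_le z).trans (by simpa using hr (subset_tsupport _ hz))
    have hGz := hMG z.1 (by simpa using hzr)
    have hyl := hYlip h z
    have hd : dist (Y (S (-h) z)) (Y z) < δ := by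
      rw [dist_eq_norm]
      refine (hyl.trans ?_).trans_lt hh
      gcongr
    have := abs_sub_le_of_fderiv_near hψ (x := Y z) (fun y hy => by
      rw [← dist_eq_norm]; exact (hδu hy).le) hd
    rw [← mul_sub, norm_mul, Real.norm_of_nonneg (hf0 z), Real.norm_eq_abs]
    calc f z * |ψ (Y (S (-h) z)) - ψ (Y z)|
        ≤ f z * ((‖fderiv ℝ ψ (Y z)‖ + ε') * (2 * s * (|h| * ‖G z.1‖))) := by
          gcongr
          · exact hf0 z
          · exact this.trans (by gcongr)
      _ = _ := by rw [Real.norm_eq_abs]; ring)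
  rw [Real.norm_eq_abs] at key
  refine key.trans ?_
  linarith

end ForcedFlow

theorem integral_intervalIntegral_swap_of_continuous {α : Type*} [NormedAddCommGroup α]
    [ProperSpace α] [MeasureSpace α] [BorelSpace α] [SFinite (volume : Measure α)]
    [SecondCountableTopology α]
    [IsFiniteMeasureOnCompacts (volume : Measure α)] {k : ℝ → α → ℝ} {t r : ℝ} (ht : 0 ≤ t)
    (hk : Continuous (Function.uncurry k)) (hr : ∀ s z, r < ‖z‖ → k s z = 0) :
    Integrable (fun z => ∫ s in (0 : ℝ)..t, k s z) ∧
    ∫ z, ∫ s in (0 : ℝ)..t, k s z = ∫ s in (0 : ℝ)..t, ∫ z, k s z := by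
  have hi : Integrable (fun q : α × ℝ => k q.2 q.1) (volume.prod (volume.restrict (Ioc 0 t))) := by
    have h1 : (volume : Measure α).prod (volume.restrict (Ioc 0 t))
        = (volume.prod (volume : Measure ℝ)).restrict (univ ×ˢ Ioc 0 t) := by
      rw [← Measure.prod_restrict, Measure.restrict_univ]
    rw [h1]
    have hk' : Continuous fun q : α × ℝ => k q.2 q.1 := hk.comp continuous_swap
    have h2 : IntegrableOn (fun q : α × ℝ => k q.2 q.1) (Metric.closedBall 0 r ×ˢ Icc 0 t)
        (volume.prod volume) :=
      hk'.continuousOn.integrableOn_compact ((isCompact_closedBall _ _).prod isCompact_Icc)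
    have h3 : IntegrableOn (fun q : α × ℝ => k q.2 q.1) (univ ×ˢ Icc 0 t) (volume.prod volume) := by
      refine h2.of_forall_sdiff_eq_zero (MeasurableSet.univ.prod measurableSet_Icc) fun q hq => ?_
      refine hr _ _ ?_
      by_contra hle
      exact hq.2 ⟨by simpa using hle, hq.1.2⟩
    exact h3.mono_set (prod_mono le_rfl Ioc_subset_Icc_self)
  simp only [intervalIntegral.integral_of_le ht]
  exact ⟨hi.integral_prod_left, integral_integral_swap hi⟩

theorem continuous_integral_of_norm_le {α β : Type*} [TopologicalSpace β] [FirstCountableTopology β]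
    [LocallyCompactSpace β]
    [NormedAddCommGroup α] [ProperSpace α] [MeasureSpace α] [BorelSpace α]
    [SecondCountableTopology α] [IsFiniteMeasureOnCompacts (volume : Measure α)]
    {k : β → α → ℝ} {r : ℝ} (hk : Continuous (Function.uncurry k))
    (hr : ∀ s z, r < ‖z‖ → k s z = 0) : Continuous fun s => ∫ z, k s z := by
  have e : ∀ s, ∫ z, k s z = ∫ z in Metric.closedBall 0 r, k s z := fun s =>
    (setIntegral_eq_integral_of_forall_compl_eq_zero fun z hz => hr s z (by simpa using hz)).symm
  simp only [e]
  exact continuous_parametric_integral_of_continuous hk (isCompact_closedBall _ _)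

namespace ForcedFlow

variable {a : ℝ → E3 → E3} {t L A : ℝ} {X V : ℝ → E3 → E3 → E3}

theorem continuous_flowMap_projIcc (hF : ForcedFlow a t L A X V) :
    Continuous fun q : ℝ × E3 × E3 => flowMap X V (projIcc 0 t hF.t_nonneg q.1) q.2 :=
  hF.continuousOn_flowMap.comp_continuous
    (f := fun q : ℝ × E3 × E3 => ((projIcc 0 t hF.t_nonneg q.1 : ℝ), q.2)) (by fun_prop)
    fun q => ⟨(projIcc 0 t hF.t_nonneg q.1).2, mem_univ _⟩

theorem exists_radius (hF : ForcedFlow a t L A X V) (r : ℝ) :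
    ∃ r', ∀ s ∈ Icc 0 t, ∀ z, ‖flowMap X V s z‖ ≤ r → ‖z‖ ≤ r' := by
  obtain ⟨B, hB⟩ := isCompact_Icc.exists_bound_of_continuousOn
    (f := fun s => flowMap X V s (0 : E3 × E3)) (s := Icc 0 t)
    (hF.continuousOn_flowMap.comp (f := fun s : ℝ => (s, (0 : E3 × E3))) (by fun_prop)
      fun s hs => ⟨hs, mem_univ _⟩)
  refine ⟨lipConst t L * (r + B), fun s hs z hz => ?_⟩
  have h1 := (hF.antilipschitzWith_flowMap hs).le_mul_dist z 0
  rw [dist_zero_right, dist_eq_norm] at h1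
  refine h1.trans ?_
  gcongr
  exact (norm_sub_le _ _).trans (add_le_add hz (hB s hs))

theorem duhamel_of_hasCompactSupport (hF : ForcedFlow a t L A X V) {f : ℝ × E3 × E3 → ℝ}
    (hf : ContDiff ℝ 1 f) (hfc : HasCompactSupport f) (hf0 : ∀ q, 0 ≤ f q) {G : ℝ × E3 → E3}
    (hG : Continuous G)
    (hV : ∀ τ ∈ Icc 0 t, ∀ z : E3 × E3,
      fderiv ℝ f (τ, z) (1, z.2, a (t - τ) z.1 + G (τ, z.1)) = 0) {D : E3 → ℝ}
    (hD : D = fun x => ∫ s in (0 : ℝ)..t, s * ∫ v, ‖G (t - s, X s x v)‖ * f (t - s, X s x v, V s x v)) :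
    Continuous D ∧ HasCompactSupport D ∧ (∀ x, 0 ≤ D x) ∧ ∀ ψ : E3 → ℝ, ContDiff ℝ 1 ψ →
      HasCompactSupport ψ →
      |∫ z : E3 × E3, f (t, z) * ψ z.1| ≤ |∫ z : E3 × E3, f (0, flowMap X V t z) * ψ z.1|
        + 2 * ∫ x, D x * ‖fderiv ℝ ψ x‖ := by
  have ht := hF.t_nonneg
  obtain ⟨r0, hr0⟩ := hfc.isCompact.isBounded.subset_closedBall (0 : ℝ × E3 × E3)
  obtain ⟨r, hr⟩ := hF.exists_radius r0
  set cl : ℝ → ℝ := fun s => projIcc 0 t ht s with hcl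
  have hclc : Continuous cl := by rw [hcl]; fun_prop
  have hclm : ∀ s, cl s ∈ Icc 0 t := fun s => (projIcc 0 t ht s).2
  have hcle : ∀ s ∈ Icc 0 t, cl s = s := fun s hs => by simp [hcl, projIcc_of_mem ht hs]
  have huIcc : uIcc 0 t = Icc 0 t := uIcc_of_le ht
  set P : ℝ × E3 × E3 → ℝ × E3 × E3 := fun q => (t - cl q.1, flowMap X V (cl q.1) q.2) with hP
  have hPc : Continuous P := (by fun_prop : Continuous fun q : ℝ × E3 × E3 => t - cl q.1).prodMk
    hF.continuous_flowMap_projIcc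
  have hPr : ∀ s z, r < ‖z‖ → P (s, z) ∉ tsupport f := fun s z hz hm => by
    have := hr0 hm
    rw [mem_closedBall_zero_iff] at this
    exact hz.not_ge (hr _ (hclm s) z ((norm_snd_le (P (s, z))).trans this))
  have hGP : Continuous fun q => G ((P q).1, (P q).2.1) := hG.comp (by fun_prop)
  have hfP : Continuous fun q => f (P q) := hf.continuous.comp hPc
  set k : ℝ → E3 × E3 → ℝ := fun s z => cl s * (‖G ((P (s, z)).1, (P (s, z)).2.1)‖ * f (P (s, z)))
    with hk
  have hkc : Continuous (Function.uncurry k) := by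
    simp only [hk, Function.uncurry_def, Prod.mk.eta]
    exact (hclc.comp continuous_fst).mul (hGP.norm.mul hfP)
  have hkr : ∀ s z, r < ‖z‖ → k s z = 0 := fun s z hz => by
    simp [hk, image_eq_zero_of_notMem_tsupport (hPr s z hz)]
  set m : ℝ → E3 → ℝ := fun s x => ∫ v, k s (x, v) with hm
  have hmc : Continuous (Function.uncurry m) := by
    have := continuous_integral_of_norm_le (r := r) (k := fun (q : ℝ × E3) v => k q.1 (q.2, v))
      (hkc.comp (by fun_prop : Continuous fun p : (ℝ × E3) × E3 => (p.1.1, p.1.2, p.2)))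
      fun q v hv => hkr _ _ (hv.trans_le (norm_snd_le (q.2, v)))
    exact this
  have hmr : ∀ s x, r < ‖x‖ → m s x = 0 := fun s x hx => by
    simp only [hm]
    rw [integral_eq_zero_of_ae (ae_of_all _ fun v => hkr _ _ (hx.trans_le (norm_fst_le (x, v))))]
  have hDm : D = fun x => ∫ s in (0 : ℝ)..t, m s x := by
    rw [hD]
    funext x
    refine intervalIntegral.integral_congr fun s hs => ?_
    rw [huIcc] at hs
    simp only [hm, hk, hP, hcle s hs, flowMap]
    rw [integral_const_mul]
  have hDc : Continuous D := by
    rw [hDm]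
    exact intervalIntegral.continuous_parametric_intervalIntegral_of_continuous'
      (f := fun x s => m s x) (hmc.comp continuous_swap) 0 t
  have hDr : ∀ x, r < ‖x‖ → D x = 0 := fun x hx => by
    rw [hDm]; simp [hmr _ x hx]
  refine ⟨hDc, HasCompactSupport.of_support_subset_isCompact (isCompact_closedBall (0 : E3) r)
    fun x hx => ?_, fun x => ?_, fun ψ hψ hψc => ?_⟩
  · by_contra h
    exact hx (hDr x (by simpa using h))
  · rw [hD]
    exact intervalIntegral.integral_nonneg ht fun s hs => mul_nonneg hs.1
      (integral_nonneg fun v => mul_nonneg (norm_nonneg _) (hf0 _))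
  have hψ' : Continuous fun x => ‖fderiv ℝ ψ x‖ := (hψ.continuous_fderiv one_ne_zero).norm
  set k0 : ℝ → E3 × E3 → ℝ := fun s z =>
    fderiv ℝ f (P (s, z)) (0, 0, G ((P (s, z)).1, (P (s, z)).2.1)) with hk0
  have hk0c : Continuous (Function.uncurry k0) := by
    have h1 : Continuous fun q => fderiv ℝ f (P q) := (hf.continuous_fderiv one_ne_zero).comp hPc
    have h2 : Continuous fun q => ((0 : ℝ), (0 : E3), G ((P q).1, (P q).2.1)) := by fun_prop
    exact h1.clm_apply h2
  have hk0r : ∀ s z, r < ‖z‖ → k0 s z = 0 := fun s z hz => by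
    simp [hk0, fderiv_of_notMem_tsupport (𝕜 := ℝ) (hPr s z hz)]
  have hFTC : ∀ z, ∫ s in (0 : ℝ)..t, k0 s z = f (0, flowMap X V t z) - f (t, z) := fun z => by
    have hd : ∀ s ∈ uIcc 0 t, HasDerivAt (fun s => f (t - s, flowMap X V s z)) (k0 s z) s := by
      intro s hs
      rw [huIcc] at hs
      have h1 : HasDerivAt (fun s => (t - s, flowMap X V s z))
          (-1, -(V s z.1 z.2), -(a s (X s z.1 z.2))) s :=
        ((hasDerivAt_id s).const_sub t).prodMk ((hF.ode_X z.1 z.2 s hs).prodMk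
          (hF.ode_V z.1 z.2 s hs))
      have h2 := ((hf.differentiable one_ne_zero) (t - s, flowMap X V s z)).hasFDerivAt.comp_hasDerivAt
        s h1
      refine h2.congr_deriv (Eq.symm ?_)
      have h3 := hV (t - s) ⟨by linarith [hs.2], by linarith [hs.1]⟩ (flowMap X V s z)
      rw [sub_sub_cancel] at h3
      simp only [hk0, hP, hcle s hs]
      have e1 : ((-1 : ℝ), -(V s z.1 z.2), -(a s (X s z.1 z.2)))
          = ((0 : ℝ), (0 : E3), G (t - s, (flowMap X V s z).1)) - ((1 : ℝ), (flowMap X V s z).2,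
            a s (flowMap X V s z).1 + G (t - s, (flowMap X V s z).1)) := by
        simp [flowMap]
      rw [e1, map_sub, h3, sub_zero]
    have := intervalIntegral.integral_eq_sub_of_hasDerivAt hd
      ((hk0c.comp (by fun_prop : Continuous fun s : ℝ => (s, z))).intervalIntegrable _ _)
    rw [this, sub_self, sub_zero, hF.flowMap_zero]
  have hk0ψc : Continuous (Function.uncurry fun s z => k0 s z * ψ z.1) :=
    hk0c.mul (hψ.continuous.comp (by fun_prop))
  obtain ⟨-, hsw0⟩ := integral_intervalIntegral_swap_of_continuous (t := t) (r := r) ht hk0ψc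
    fun s z hz => by rw [hk0r s z hz, zero_mul]
  simp only [intervalIntegral.integral_mul_const, hFTC, sub_mul] at hsw0
  have hmψc : Continuous (Function.uncurry fun s x => m s x * ‖fderiv ℝ ψ x‖) :=
    hmc.mul (hψ'.comp continuous_snd)
  obtain ⟨-, hsw1⟩ := integral_intervalIntegral_swap_of_continuous (t := t) (r := r) ht hmψc
    fun s x hx => by rw [hmr s x hx, zero_mul]
  simp only [intervalIntegral.integral_mul_const] at hsw1
  have hi1 : Integrable fun z : E3 × E3 => f (0, flowMap X V t z) * ψ z.1 := by
    refine Continuous.integrable_of_hasCompactSupport ?_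
      (HasCompactSupport.of_support_subset_isCompact (isCompact_closedBall (0 : E3 × E3) r)
      fun z hz => ?_)
    · have h1 : Continuous (flowMap X V t) :=
        (hF.isClosedEmbedding_flowMap (right_mem_Icc.2 ht)).continuous
      exact (hf.continuous.comp (continuous_const.prodMk h1)).mul (hψ.continuous.comp continuous_fst)
    · by_contra h
      refine hz ?_
      have h2 := hPr t z (by simpa using h)
      simp only [hP, hcle t (right_mem_Icc.2 ht), sub_self] at h2
      simp [image_eq_zero_of_notMem_tsupport h2]
  have hi2 : Integrable fun z : E3 × E3 => f (t, z) * ψ z.1 := by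
    refine Continuous.integrable_of_hasCompactSupport
      ((hf.continuous.comp (by fun_prop)).mul (hψ.continuous.comp continuous_fst))
      (HasCompactSupport.of_support_subset_isCompact (isCompact_closedBall (0 : E3 × E3) r)
      fun z hz => ?_)
    by_contra h
    refine hz ?_
    have h2 := hPr 0 z (by simpa using h)
    simp only [hP, hcle 0 (left_mem_Icc.2 ht), sub_zero, hF.flowMap_zero] at h2
    simp [image_eq_zero_of_notMem_tsupport h2]
  rw [integral_sub hi1 hi2] at hsw0
  have hle : |∫ s in (0 : ℝ)..t, ∫ z, k0 s z * ψ z.1| ≤ 2 * ∫ x, D x * ‖fderiv ℝ ψ x‖ := by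
    have e2 : ∫ x, D x * ‖fderiv ℝ ψ x‖ = ∫ s in (0 : ℝ)..t, ∫ x, m s x * ‖fderiv ℝ ψ x‖ := by
      rw [← hsw1, hDm]
    rw [e2, ← intervalIntegral.integral_const_mul]
    rw [← Real.norm_eq_abs]
    refine intervalIntegral.norm_integral_le_of_norm_le ht (ae_of_all _ fun s hs => ?_) ?_
    · have hs' : s ∈ Icc 0 t := Ioc_subset_Icc_self hs
      have hfs : ContDiff ℝ 1 fun z : E3 × E3 => f (t - s, z) := hf.comp (by fun_prop)
      have hfcs : HasCompactSupport fun z : E3 × E3 => f (t - s, z) :=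
        HasCompactSupport.of_support_subset_isCompact (isCompact_closedBall (0 : E3 × E3) r0)
        fun z hz => by
          have := hr0 (subset_tsupport _ hz)
          rw [mem_closedBall_zero_iff] at this ⊢
          exact (norm_snd_le ((t - s, z) : ℝ × E3 × E3)).trans this
      have key := hF.abs_integral_fderiv_comp_flowMap_le hs' hfs hfcs (fun z => hf0 _)
        (G := fun x => G (t - s, x)) (hG.comp (by fun_prop)) hψ hψc
      have hde : ∀ z w, fderiv ℝ (fun z : E3 × E3 => f (t - s, z)) z w
          = fderiv ℝ f (t - s, z) (0, w) := fun z w => by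
        have h1 : HasFDerivAt (fun z : E3 × E3 => (t - s, z))
          (ContinuousLinearMap.inr ℝ ℝ (E3 × E3)) z := hasFDerivAt_prodMk_right _ _
        have := ((hf.differentiable one_ne_zero) (t - s, z)).hasFDerivAt.comp z h1
        have h3 := congrArg (fun l => l w) this.fderiv
        simpa [Function.comp_def] using h3
      have hmi : Integrable fun z : E3 × E3 => k s z * ‖fderiv ℝ ψ z.1‖ :=
        Continuous.integrable_of_hasCompactSupport
          ((hkc.comp (by fun_prop : Continuous fun z : E3 × E3 => (s, z))).mul
            (hψ'.comp continuous_fst))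
          (HasCompactSupport.of_support_subset_isCompact (isCompact_closedBall (0 : E3 × E3) r)
          fun z hz => by
            by_contra h
            exact hz (by simp [hkr s z (by simpa using h)]))
      have e3 : ∫ x, m s x * ‖fderiv ℝ ψ x‖ = s * ∫ z, ‖G (t - s, (flowMap X V s z).1)‖
          * f (t - s, flowMap X V s z) * ‖fderiv ℝ ψ z.1‖ := by
        rw [← integral_const_mul]
        have : ∀ z : E3 × E3, s * (‖G (t - s, (flowMap X V s z).1)‖
          * f (t - s, flowMap X V s z) * ‖fderiv ℝ ψ z.1‖) = k s z * ‖fderiv ℝ ψ z.1‖ := fun z => by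
          simp only [hk, hP, hcle s hs']; ring
        simp only [this]
        rw [Measure.volume_eq_prod, integral_prod _ hmi]
        simp only [integral_mul_const, hm]
      rw [e3]
      simp only [hde] at key
      simp only [hk0, hP, hcle s hs', Real.norm_eq_abs]
      exact key.trans_eq (by ring)
    · refine (Continuous.intervalIntegrable ?_ _ _)
      refine continuous_const.mul ?_
      exact continuous_integral_of_norm_le (r := r) hmψc fun s x hx => by
        rw [hmr s x hx, zero_mul]
  rw [← hsw0] at hle
  have := abs_sub_abs_le_abs_sub (∫ z : E3 × E3, f (t, z) * ψ z.1)
    (∫ z : E3 × E3, f (0, flowMap X V t z) * ψ z.1)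
  rw [abs_sub_comm] at this
  linarith

end ForcedFlow

theorem isClosedEmbedding_prodMk {α β : Type*} [TopologicalSpace α] [T1Space α]
    [TopologicalSpace β] (a : α) : Topology.IsClosedEmbedding fun b : β => (a, b) := by
  refine ⟨isEmbedding_prodMkRight a, ?_⟩
  have : range (fun b : β => (a, b)) = {a} ×ˢ univ := by ext q; simp [Prod.ext_iff, eq_comm]
  rw [this]
  exact isClosed_singleton.prod isClosed_univ

namespace ForcedFlow

variable {a : ℝ → E3 → E3} {t L A : ℝ} {X V : ℝ → E3 → E3 → E3}

theorem hasCompactSupport_comp_flowMap (hF : ForcedFlow a t L A X V) {f : E3 × E3 → ℝ}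
    (hfc : HasCompactSupport f) : HasCompactSupport fun z => f (flowMap X V t z) :=
  hfc.comp_isClosedEmbedding (hF.isClosedEmbedding_flowMap (right_mem_Icc.2 hF.t_nonneg))

theorem duhamel (hF : ForcedFlow a t L A X V) {f : ℝ × E3 × E3 → ℝ}
    (hf : ContDiff ℝ 1 f) (hfc : HasCompactSupport f) (hf0 : ∀ q, 0 ≤ f q) {G : ℝ × E3 → E3}
    (hG : Continuous G)
    (hV : ∀ τ ∈ Icc 0 t, ∀ z : E3 × E3,
      fderiv ℝ f (τ, z) (1, z.2, a (t - τ) z.1 + G (τ, z.1)) = 0) {D : E3 → ℝ}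
    (hD : D = fun x => ∫ s in (0 : ℝ)..t, s * ∫ v, ‖G (t - s, X s x v)‖ * f (t - s, X s x v, V s x v)) :
    Continuous D ∧ HasCompactSupport D ∧ (∀ x, 0 ≤ D x) ∧ ∀ ψ : E3 → ℝ, ContDiff ℝ 1 ψ →
      |∫ z : E3 × E3, f (t, z) * ψ z.1| ≤ |∫ z : E3 × E3, f (0, flowMap X V t z) * ψ z.1|
        + 2 * ∫ x, D x * ‖fderiv ℝ ψ x‖ := by
  obtain ⟨h1, h2, h3, h4⟩ := hF.duhamel_of_hasCompactSupport hf hfc hf0 hG hV hD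
  refine ⟨h1, h2, h3, fun ψ hψ => ?_⟩
  have hemb : ∀ τ : ℝ, Topology.IsClosedEmbedding fun z : E3 × E3 => (τ, z) :=
    isClosedEmbedding_prodMk
  obtain ⟨r1, hr1⟩ := (hfc.comp_isClosedEmbedding (hemb t)).isCompact.isBounded.subset_closedBall 0
  obtain ⟨r2, hr2⟩ := (hF.hasCompactSupport_comp_flowMap
    (hfc.comp_isClosedEmbedding (hemb 0))).isCompact.isBounded.subset_closedBall 0
  obtain ⟨r3, hr3⟩ := h2.isCompact.isBounded.subset_closedBall 0
  set B : ℝ := |r1| + |r2| + |r3| + 1 with hB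
  have hB0 : 0 < B := by positivity
  let b : ContDiffBump (0 : E3) := ⟨B, B + 1, hB0, by linarith⟩
  have hb1 : ∀ x, ‖x‖ ≤ B → b x = 1 := fun x hx =>
    b.one_of_mem_closedBall (by simpa using hx)
  have key := h4 (fun x => b x * ψ x) (b.contDiff.mul hψ) (b.hasCompactSupport.mul_right)
  have e1 : ∀ z : E3 × E3, f (t, z) * (b z.1 * ψ z.1) = f (t, z) * ψ z.1 := fun z => by
    by_cases hz : f (t, z) = 0
    · simp [hz]
    have := hr1 (subset_tsupport _ hz)
    rw [mem_closedBall_zero_iff] at this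
    rw [hb1 _ ((norm_fst_le z).trans (by
      linarith [le_abs_self r1, abs_nonneg r2, abs_nonneg r3])), one_mul]
  have e2 : ∀ z : E3 × E3, f (0, flowMap X V t z) * (b z.1 * ψ z.1)
      = f (0, flowMap X V t z) * ψ z.1 := fun z => by
    by_cases hz : f (0, flowMap X V t z) = 0
    · simp [hz]
    have := hr2 (subset_tsupport _ hz)
    rw [mem_closedBall_zero_iff] at this
    rw [hb1 _ ((norm_fst_le z).trans (by
      linarith [le_abs_self r2, abs_nonneg r1, abs_nonneg r3])), one_mul]
  have e3 : ∀ x, D x * ‖fderiv ℝ (fun x => b x * ψ x) x‖ = D x * ‖fderiv ℝ ψ x‖ := fun x => by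
    by_cases hx : D x = 0
    · simp [hx]
    have := hr3 (subset_tsupport _ hx)
    rw [mem_closedBall_zero_iff] at this
    have hev : (fun x => b x * ψ x) =ᶠ[nhds x] ψ := by
      have hlt : ‖x‖ < B := by linarith [le_abs_self r3, abs_nonneg r1, abs_nonneg r2]
      filter_upwards [(continuous_norm.tendsto x).eventually_lt_const hlt] with y hy
      rw [hb1 y hy.le, one_mul]
    rw [hev.fderiv_eq]
  simp only [e1, e2, e3] at key
  exact key

end ForcedFlow

theorem lintegral_ofReal_rpow_eq {p : ℝ} (hp : 1 ≤ p) {D : E3 → ℝ} (hD : Continuous D)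
    (hDc : HasCompactSupport D) (hD0 : ∀ x, 0 ≤ D x) :
    ∫⁻ x, ENNReal.ofReal (D x ^ p)
      = ENNReal.ofReal ((eLpNorm D (ENNReal.ofReal p) volume).toReal ^ p) := by
  have hp0 : 0 < p := by linarith
  have hfin : eLpNorm D (ENNReal.ofReal p) volume ≠ ⊤ :=
    (hD.memLp_of_hasCompactSupport hDc).eLpNorm_ne_top
  rw [← ENNReal.ofReal_rpow_of_nonneg ENNReal.toReal_nonneg hp0.le, ENNReal.ofReal_toReal hfin,
    eLpNorm_eq_lintegral_rpow_enorm_toReal (by simpa using hp0) ENNReal.ofReal_ne_top,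
    ENNReal.toReal_ofReal hp0.le, ← ENNReal.rpow_mul, one_div_mul_cancel hp0.ne', ENNReal.rpow_one]
  refine lintegral_congr fun x => ?_
  rw [← ENNReal.ofReal_rpow_of_nonneg (hD0 x) hp0.le, Real.enorm_of_nonneg (hD0 x)]

theorem exists_integral_mul_fderiv_coulombAdjoint_le {p q : ℝ} (hp : 2 ≤ p)
    (hpq : p.HolderConjugate q) :
    ∃ C : ℝ, 0 ≤ C ∧ ∀ (D : E3 → ℝ) (φ : E3 → E3), Continuous D → HasCompactSupport D →
      (∀ x, 0 ≤ D x) → ContDiff ℝ 1 φ → HasCompactSupport φ →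
      ∫⁻ x, ENNReal.ofReal (‖φ x‖ ^ q) ≤ 1 →
      ∫ x, D x * ‖fderiv ℝ (coulombAdjoint φ) x‖
        ≤ C * (eLpNorm D (ENNReal.ofReal p) volume).toReal := by
  obtain ⟨C, hC, h⟩ := exists_lintegral_mul_fderiv_coulombAdjoint_le hp hpq
  refine ⟨2 * C, by positivity, fun D φ hD hDc hD0 hφ hφc hφ1 => ?_⟩
  set N := (eLpNorm D (ENNReal.ofReal p) volume).toReal with hN
  have hN0 : 0 ≤ N := ENNReal.toReal_nonneg
  have hp0 : 0 < p := by linarith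
  refine le_of_forall_pos_le_add fun ε hε => ?_
  set ε' := ε / (2 * C + 1) with hε'
  have hε'0 : 0 < ε' := by positivity
  have hε'1 : 2 * C * ε' ≤ ε := by
    rw [hε', mul_div_assoc', div_le_iff₀ (by positivity)]; nlinarith
  set l := (N + ε')⁻¹ with hl
  have hl0 : 0 < l := by positivity
  obtain ⟨M, hM⟩ := hDc.exists_bound_of_continuous hD
  have key := h (fun x => l * D x) (l * M) φ (hD.measurable.const_mul l)
    ((hD.integrable_of_hasCompactSupport hDc).const_mul l) (fun x => mul_nonneg hl0.le (hD0 x))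
    (fun x => by gcongr; exact (le_abs_self _).trans (hM x)) hφ hφc
  have e1 : ∫ x, l * D x * ‖fderiv ℝ (coulombAdjoint φ) x‖
      = l * ∫ x, D x * ‖fderiv ℝ (coulombAdjoint φ) x‖ := by
    rw [← integral_const_mul]; simp only [mul_assoc]
  have e2 : ∫⁻ x, ENNReal.ofReal ((l * D x) ^ p) ≤ 1 := by
    have : ∀ x, ENNReal.ofReal ((l * D x) ^ p)
        = ENNReal.ofReal (l ^ p) * ENNReal.ofReal (D x ^ p) := fun x => by
      rw [Real.mul_rpow hl0.le (hD0 x), ENNReal.ofReal_mul (by positivity)]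
    simp only [this]
    rw [lintegral_const_mul' _ _ ENNReal.ofReal_ne_top,
      lintegral_ofReal_rpow_eq (by linarith) hD hDc hD0,
      ← ENNReal.ofReal_mul (by positivity), ← Real.mul_rpow hl0.le hN0, ENNReal.ofReal_le_one]
    refine Real.rpow_le_one (by positivity) ?_ hp0.le
    rw [hl, inv_mul_le_one₀ (by positivity)]
    linarith
  have hI0 : 0 ≤ ∫ x, D x * ‖fderiv ℝ (coulombAdjoint φ) x‖ :=
    integral_nonneg fun x => mul_nonneg (hD0 x) (norm_nonneg _)
  rw [e1, Real.enorm_of_nonneg (mul_nonneg hl0.le hI0)] at key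
  have k2 : ENNReal.ofReal (l * ∫ x, D x * ‖fderiv ℝ (coulombAdjoint φ) x‖)
      ≤ ENNReal.ofReal (C * 2) := by
    refine key.trans ?_
    rw [ENNReal.ofReal_mul hC]
    gcongr
    exact (add_le_add e2 hφ1).trans_eq (by norm_num)
  rw [ENNReal.ofReal_le_ofReal_iff (by positivity), hl, inv_mul_le_iff₀ (by positivity)] at k2
  linarith

theorem ForcedFlow.exists_pairing_le {p q k Λ : ℝ} (hpq : p.HolderConjugate q) (hp : 2 ≤ p)
    (hk : 0 < k) (hkp : (k + 3) / 3 ≤ p) (hkr : 2 / 3 < 1 / p + 1 - 1 / ((k + 3) / 3)) (hΛ : 0 ≤ Λ) :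
    ∃ C : ℝ, 0 ≤ C ∧ ∀ {a : ℝ → E3 → E3} {t L A : ℝ} {X V : ℝ → E3 → E3 → E3}
      (_ : ForcedFlow a t L A X V) {f : ℝ × E3 × E3 → ℝ} (_ : ContDiff ℝ 1 f)
      (_ : HasCompactSupport f) (_ : ∀ q, 0 ≤ f q) {G : ℝ × E3 → E3} (_ : Continuous G)
      (_ : ∀ τ ∈ Icc 0 t, ∀ z : E3 × E3,
        fderiv ℝ f (τ, z) (1, z.2, a (t - τ) z.1 + G (τ, z.1)) = 0) {D : E3 → ℝ}
      (_ : D = fun x => ∫ s in (0 : ℝ)..t, s * ∫ v, ‖G (t - s, X s x v)‖ * f (t - s, X s x v, V s x v))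
      (_ : ∀ z, f (0, z) ≤ Λ) (_ : ∫ z : E3 × E3, f (0, z) ≤ 1) {B : ℝ} (_ : 0 ≤ B) {w : E3}
      (_ : ∫⁻ z : E3 × E3, ENNReal.ofReal (‖z.2 - w‖ ^ k * f (0, flowMap X V t z))
        ≤ ENNReal.ofReal B)
      {φ : E3 → E3} (_ : ContDiff ℝ 1 φ) (_ : HasCompactSupport φ)
      (_ : ∫⁻ x, ENNReal.ofReal (‖φ x‖ ^ q) ≤ 1),
      ∫ z : E3 × E3, f (t, z) * coulombAdjoint φ z.1
        ≤ C * (1 + B) + C * (eLpNorm D (ENNReal.ofReal p) volume).toReal := by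
  obtain ⟨C1, hC1, h1⟩ := exists_integral_mul_fderiv_coulombAdjoint_le hp hpq
  obtain ⟨C2, hC2, h2⟩ := exists_rpow_integral_le_lintegral_moment hk hΛ
  obtain ⟨C3, hC3, h3⟩ := exists_integral_mul_coulombAdjoint_le hpq hp (r := (k + 3) / 3)
    (by linarith) hkp hkr
  refine ⟨2 * C1 + C3 * (1 + C2), by positivity, ?_⟩
  intro a t L A X V hF f hf hfc hf0 G hG hV D hD hfΛ hfm B hB w hmom φ hφ hφc hφ1
  obtain ⟨hDc, hDs, hD0, hdu⟩ := hF.duhamel hf hfc hf0 hG hV hD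
  have hts : t ∈ Icc 0 t := right_mem_Icc.2 hF.t_nonneg
  set g : E3 × E3 → ℝ := fun z => f (0, flowMap X V t z) with hg
  have hfc0 : HasCompactSupport fun z : E3 × E3 => f (0, z) :=
    hfc.comp_isClosedEmbedding (isClosedEmbedding_prodMk 0)
  have hgs : HasCompactSupport g := hF.hasCompactSupport_comp_flowMap hfc0
  have hgc : Continuous g := hf.continuous.comp
    (continuous_const.prodMk (hF.isClosedEmbedding_flowMap hts).continuous)
  have hgi : Integrable g := hgc.integrable_of_hasCompactSupport hgs
  have hg1 : ∫ z, g z ≤ 1 := by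
    have := (hF.measurePreserving_flowMap hts).integral_comp
      (hF.isClosedEmbedding_flowMap hts).measurableEmbedding fun z => f (0, z)
    rw [hg, this]
    exact hfm
  have hg0 : ∀ z, 0 ≤ g z := fun z => hf0 _
  set ρ : E3 → ℝ := fun x => ∫ v, g (x, v) with hρ
  have hρm : Measurable ρ := hgc.stronglyMeasurable.integral_prod_right'.measurable
  have hρ0 : ∀ x, 0 ≤ ρ x := fun x => integral_nonneg fun v => hg0 _
  have hψ := contDiff_coulombAdjoint hφ hφc
  have hgψ : Integrable fun z : E3 × E3 => g z * coulombAdjoint φ z.1 :=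
    Continuous.integrable_of_hasCompactSupport
      (hgc.mul (hψ.continuous.comp continuous_fst)) hgs.mul_right
  have e1 : ∫ z : E3 × E3, g z * coulombAdjoint φ z.1 = ∫ x, ρ x * coulombAdjoint φ x := by
    rw [Measure.volume_eq_prod, integral_prod _ hgψ]
    simp only [integral_mul_const, hρ]
  have e2 : ∫⁻ x, ENNReal.ofReal (ρ x) ≤ 1 := by
    have hi : Integrable g (volume.prod volume) := hgi
    have hρi : Integrable ρ := hi.integral_prod_left
    rw [← ofReal_integral_eq_lintegral_ofReal hρi (ae_of_all _ hρ0), ENNReal.ofReal_le_one]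
    rw [Measure.volume_eq_prod, integral_prod _ hi] at hg1
    exact hg1
  have e3 : ∫⁻ x, ENNReal.ofReal (ρ x ^ ((k + 3) / 3)) ≤ ENNReal.ofReal (C2 * B) := by
    have hgx : ∀ x, Integrable fun v => g (x, v) := fun x =>
      Continuous.integrable_of_hasCompactSupport (hgc.comp (by fun_prop))
        (hgs.comp_isClosedEmbedding (isClosedEmbedding_prodMk x))
    have hm : Measurable fun z : E3 × E3 => ENNReal.ofReal (‖z.2 - w‖ ^ k * g z) :=
      (((measurable_snd.sub_const w).norm.pow_const k).mul hgc.measurable).ennreal_ofReal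
    rw [ENNReal.ofReal_mul hC2]
    calc ∫⁻ x, ENNReal.ofReal (ρ x ^ ((k + 3) / 3))
        ≤ ∫⁻ x, ENNReal.ofReal C2 * ∫⁻ v, ENNReal.ofReal (‖v - w‖ ^ k * g (x, v)) :=
          lintegral_mono fun x => h2 w (fun v => g (x, v)) (hgc.comp (by fun_prop)).measurable
            (fun v => hg0 _) (fun v => hfΛ _) (hgx x)
      _ = ENNReal.ofReal C2 * ∫⁻ z : E3 × E3, ENNReal.ofReal (‖z.2 - w‖ ^ k * g z) := by
          rw [lintegral_const_mul' _ _ ENNReal.ofReal_ne_top, Measure.volume_eq_prod,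
            lintegral_prod _ hm.aemeasurable]
      _ ≤ _ := by gcongr
  have k1 := h3 (C2 * B) ρ φ (by positivity) hρm hρ0 hφ.continuous e2 e3 hφ1
  rw [← e1, Real.enorm_eq_ofReal_abs, ENNReal.ofReal_le_ofReal_iff (by positivity)] at k1
  have k2 := h1 D φ hDc hDs hD0 hφ hφc hφ1
  have k3 := hdu _ hψ
  set N := (eLpNorm D (ENNReal.ofReal p) volume).toReal with hN
  have hN0 : 0 ≤ N := ENNReal.toReal_nonneg
  refine (le_abs_self _).trans (k3.trans ?_)
  have k4 : C3 * (1 + C2 * B) ≤ C3 * (1 + C2) * (1 + B) := by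
    rw [mul_assoc]; gcongr; nlinarith [mul_nonneg hC2 hB]
  have k5 : 0 ≤ 2 * C1 * (1 + B) := by positivity
  have k6 : 0 ≤ C3 * (1 + C2) * N := by positivity
  linarith

theorem contDiff_integral_snd {g : E3 × E3 → ℝ} (hg : ContDiff ℝ 1 g) (hgc : HasCompactSupport g) :
    ContDiff ℝ 1 fun x => ∫ v, g (x, v) := by
  obtain ⟨r, hr⟩ := hgc.isCompact.isBounded.subset_closedBall (0 : E3 × E3)
  have hc := hg.continuous_fderiv one_ne_zero
  obtain ⟨M, hM⟩ := (hgc.fderiv (𝕜 := ℝ)).exists_bound_of_continuous hc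
  set g' : E3 → E3 → (E3 →L[ℝ] ℝ) := fun x v =>
    (fderiv ℝ g (x, v)).comp (ContinuousLinearMap.inl ℝ E3 E3) with hg'
  have hg'c : Continuous (Function.uncurry g') := by
    simp only [hg', Function.uncurry_def]
    exact hc.clm_comp continuous_const
  have hg'r : ∀ x v, v ∉ Metric.closedBall (0 : E3) r → g' x v = 0 := fun x v hv => by
    have : (x, v) ∉ tsupport g := fun hm => hv (by
      have := hr hm
      rw [mem_closedBall_zero_iff] at this ⊢
      exact (norm_snd_le (x, v)).trans this)
    simp [hg', fderiv_of_notMem_tsupport (𝕜 := ℝ) this]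
  have hd : ∀ x, HasFDerivAt (fun x => ∫ v, g (x, v)) (∫ v, g' x v) x := fun x => by
    refine hasFDerivAt_integral_of_dominated_of_fderiv_le (s := univ)
      (bound := (Metric.closedBall (0 : E3) r).indicator fun _ => M) univ_mem
      (Eventually.of_forall fun x => (hg.continuous.comp (by fun_prop)).aestronglyMeasurable)
      ((hg.continuous.comp (by fun_prop)).integrable_of_hasCompactSupport
        (hgc.comp_isClosedEmbedding (isClosedEmbedding_prodMk x)))
      (hg'c.comp (by fun_prop : Continuous fun v : E3 => (x, v))).aestronglyMeasurable
      (ae_of_all _ fun v y _ => ?_)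
      ((integrable_indicator_iff Metric.isClosed_closedBall.measurableSet).2
        (integrableOn_const (isCompact_closedBall _ _).measure_ne_top))
      (ae_of_all _ fun v y _ => ?_)
    · by_cases hv : v ∈ Metric.closedBall (0 : E3) r
      · rw [indicator_of_mem hv]
        refine (ContinuousLinearMap.opNorm_comp_le _ _).trans ?_
        have h1 : ‖ContinuousLinearMap.inl ℝ E3 E3‖ ≤ 1 := ContinuousLinearMap.norm_inl_le_one ℝ E3 E3
        calc _ ≤ ‖fderiv ℝ g (y, v)‖ * 1 := by gcongr
          _ ≤ M := by rw [mul_one]; exact hM _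
      · rw [hg'r y v hv, norm_zero, indicator_of_notMem hv]
    · exact ((hg.differentiable one_ne_zero) (y, v)).hasFDerivAt.comp y
        (hasFDerivAt_prodMk_left y v)
  rw [contDiff_one_iff_fderiv]
  refine ⟨fun x => (hd x).differentiableAt, ?_⟩
  have e : fderiv ℝ (fun x => ∫ v, g (x, v)) = fun x => ∫ v in Metric.closedBall (0 : E3) r, g' x v := by
    funext x
    rw [(hd x).fderiv, setIntegral_eq_integral_of_forall_compl_eq_zero (hg'r x)]
  rw [e]
  exact continuous_parametric_integral_of_continuous hg'c (isCompact_closedBall _ _)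

section

variable {f : ℝ → E3 → E3 → ℝ}

theorem continuous_rho (hf : Continuous fun p : ℝ × E3 × E3 => f p.1 p.2.1 p.2.2)
    (hfc : HasCompactSupport fun p : ℝ × E3 × E3 => f p.1 p.2.1 p.2.2) :
    Continuous fun q : ℝ × E3 => rho f q.1 q.2 := by
  obtain ⟨r, hr⟩ := hfc.isCompact.isBounded.subset_closedBall (0 : ℝ × E3 × E3)
  refine continuous_integral_of_norm_le (r := r) (k := fun (q : ℝ × E3) v => f q.1 q.2 v)
    (hf.comp (by fun_prop : Continuous fun p : (ℝ × E3) × E3 => (p.1.1, p.1.2, p.2)))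
    fun q v hv => ?_
  by_contra h
  have := hr (subset_tsupport _ (show (q.1, q.2, v) ∈ Function.support _ from h))
  rw [mem_closedBall_zero_iff] at this
  exact hv.not_ge (((norm_snd_le (q.2, v)).trans (norm_snd_le (q.1, q.2, v))).trans this)

theorem hasCompactSupport_rho
    (hfc : HasCompactSupport fun p : ℝ × E3 × E3 => f p.1 p.2.1 p.2.2) :
    HasCompactSupport fun q : ℝ × E3 => rho f q.1 q.2 := by
  obtain ⟨r, hr⟩ := hfc.isCompact.isBounded.subset_closedBall (0 : ℝ × E3 × E3)
  refine HasCompactSupport.of_support_subset_isCompact (isCompact_closedBall (0 : ℝ × E3) r)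
    fun q hq => ?_
  by_contra hn
  refine hq ?_
  simp only [rho]
  rw [integral_eq_zero_of_ae]
  refine ae_of_all _ fun v => ?_
  by_contra h
  have := hr (subset_tsupport _ (show (q.1, q.2, v) ∈ Function.support _ from h))
  rw [mem_closedBall_zero_iff] at this hn
  refine hn (max_le ((norm_fst_le (q.1, q.2, v)).trans this) ?_)
  exact ((norm_fst_le (q.2, v)).trans (norm_snd_le (q.1, q.2, v))).trans this

theorem contDiff_rho (hf : ContDiff ℝ 1 fun p : ℝ × E3 × E3 => f p.1 p.2.1 p.2.2)
    (hfc : HasCompactSupport fun p : ℝ × E3 × E3 => f p.1 p.2.1 p.2.2) (t : ℝ) :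
    ContDiff ℝ 1 (rho f t) :=
  contDiff_integral_snd (g := fun z => f t z.1 z.2) (hf.comp (by fun_prop :
    ContDiff ℝ 1 fun z : E3 × E3 => (t, z)))
    (hfc.comp_isClosedEmbedding (isClosedEmbedding_prodMk t))

theorem integral_rho (hf : Continuous fun p : ℝ × E3 × E3 => f p.1 p.2.1 p.2.2)
    (hfc : HasCompactSupport fun p : ℝ × E3 × E3 => f p.1 p.2.1 p.2.2) (t : ℝ) :
    ∫ x, rho f t x = mass f t := by
  have hi : Integrable (fun z : E3 × E3 => f t z.1 z.2) (volume.prod volume) :=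
    (hf.comp (by fun_prop : Continuous fun z : E3 × E3 => (t, z))).integrable_of_hasCompactSupport
      (hfc.comp_isClosedEmbedding (isClosedEmbedding_prodMk t))
  rw [mass, Measure.volume_eq_prod, integral_prod _ hi]
  rfl

def kernelField (κ : E3 → E3) (f : ℝ → E3 → E3 → ℝ) (t : ℝ) (x : E3) : E3 :=
  ∫ y, rho f t y • κ (x - y)

theorem Efield_eq_kernelField : Efield f = kernelField coulomb f := by
  funext t x
  simp only [Efield, kernelField, coulomb, smul_smul, div_eq_mul_inv]

theorem kernelField_eq_convolution (κ : E3 → E3) (t : ℝ) :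
    kernelField κ f t = convolution κ (rho f t) (ContinuousLinearMap.lsmul ℝ ℝ).flip := by
  funext x
  rw [convolution, kernelField,
    ← integral_sub_left_eq_self (fun y => rho f t y • κ (x - y)) volume x]
  simp only [sub_sub_cancel]
  rfl

section

variable {κ : E3 → E3} (hκ : LocallyIntegrable κ)
  (hf : ContDiff ℝ 1 fun p : ℝ × E3 × E3 => f p.1 p.2.1 p.2.2)
  (hfc : HasCompactSupport fun p : ℝ × E3 × E3 => f p.1 p.2.1 p.2.2)

include hκ hf hfc

theorem continuous_kernelField : Continuous fun q : ℝ × E3 => kernelField κ f q.1 q.2 := by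
  obtain ⟨r, hr⟩ := (hasCompactSupport_rho hfc).isCompact.isBounded.subset_closedBall (0 : ℝ × E3)
  have := continuousOn_convolution_right_with_param (μ := volume) (g := rho f) (s := univ)
    (k := Metric.closedBall (0 : E3) r)
    (ContinuousLinearMap.lsmul ℝ ℝ).flip (isCompact_closedBall _ _) (fun t x _ hx => by
      by_contra h
      have := hr (subset_tsupport _ (show (t, x) ∈ Function.support _ from h))
      rw [mem_closedBall_zero_iff] at this hx
      exact hx ((norm_snd_le (t, x)).trans this)) hκ
    (continuous_rho hf.continuous hfc).continuousOn
  rw [univ_prod_univ, continuousOn_univ] at this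
  simp only [kernelField_eq_convolution]
  exact this

theorem contDiff_kernelField (t : ℝ) : ContDiff ℝ 1 (kernelField κ f t) := by
  rw [kernelField_eq_convolution]
  exact ((hasCompactSupport_rho hfc).comp_isClosedEmbedding
    (isClosedEmbedding_prodMk t)).contDiff_convolution_right _ hκ (contDiff_rho hf hfc t)

theorem integrable_kernelField (t : ℝ) (x : E3) :
    Integrable fun y => rho f t y • κ (x - y) := by
  have h := ((hasCompactSupport_rho hfc).comp_isClosedEmbedding
    (isClosedEmbedding_prodMk t)).convolutionExists_right
    (ContinuousLinearMap.lsmul ℝ ℝ).flip hκ (contDiff_rho hf hfc t).continuous x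
  have := (show Integrable (fun z => rho f t (x - z) • κ z) volume from h).comp_sub_left x
  simpa only [sub_sub_cancel] using this

end

end

theorem differentiableAt_coulomb {z : E3} (hz : z ≠ 0) : DifferentiableAt ℝ coulomb z := by
  have h : DifferentiableAt ℝ (fun z : E3 => ‖z‖) z := differentiableAt_id.norm ℝ hz
  exact ((h.pow 3).inv (pow_ne_zero 3 (norm_ne_zero_iff.2 hz))).smul differentiableAt_id

theorem contDiffAt_coulomb {n : WithTop ℕ∞} {z : E3} (hz : z ≠ 0) : ContDiffAt ℝ n coulomb z :=
  (((contDiffAt_id.norm ℝ hz).pow 3).inv (pow_ne_zero 3 (norm_ne_zero_iff.2 hz))).smul contDiffAt_id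

theorem norm_fderiv_coulomb_le {z : E3} (hz : z ≠ 0) : ‖fderiv ℝ coulomb z‖ ≤ 4 * (‖z‖ ^ 3)⁻¹ := by
  have hz' := norm_pos_iff.2 hz
  have hd : DifferentiableAt ℝ (fun z : E3 => ‖z‖) z := differentiableAt_id.norm ℝ hz
  have h3 : HasFDerivAt (fun z : E3 => (‖z‖ ^ 3)⁻¹)
      (-((‖z‖ ^ 3) ^ 2)⁻¹ • ((3 * ‖z‖ ^ 2) • fderiv ℝ (fun z : E3 => ‖z‖) z)) z := by
    have h1 := hd.hasFDerivAt.pow 3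
    have h2 := (hasDerivAt_inv (pow_ne_zero 3 hz'.ne')).comp_hasFDerivAt z h1
    refine h2.congr_fderiv ?_
    simp
  have h := h3.smul (hasFDerivAt_id (𝕜 := ℝ) z)
  have hn : ‖fderiv ℝ (fun z : E3 => ‖z‖) z‖ = 1 := norm_fderiv_norm hd
  have e : fderiv ℝ coulomb z = _ := h.fderiv
  rw [e]
  refine (norm_add_le _ _).trans ?_
  have e1 : ‖(‖z‖ ^ 3)⁻¹ • ContinuousLinearMap.id ℝ E3‖ ≤ (‖z‖ ^ 3)⁻¹ := by
    rw [norm_smul, norm_inv, norm_pow, norm_norm]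
    exact mul_le_of_le_one_right (by positivity) ContinuousLinearMap.norm_id_le
  refine (add_le_add e1 (ContinuousLinearMap.norm_smulRight_apply _ _).le).trans (le_of_eq ?_)
  rw [norm_smul, norm_smul, hn]
  simp only [norm_neg, norm_inv, norm_pow, norm_mul, norm_norm, id]
  norm_num
  field_simp
  norm_num

namespace CutoffData

variable (c : CutoffData) (R : ℝ)

def nearKernel (z : E3) : E3 := c.χ (R⁻¹ • z) • coulomb z

def farKernel (z : E3) : E3 := (1 - c.χ (R⁻¹ • z)) • coulomb z

theorem nearKernel_add_farKernel (z : E3) : c.nearKernel R z + c.farKernel R z = coulomb z := by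
  rw [nearKernel, farKernel, ← add_smul]; simp

theorem nearKernel_eq : c.nearKernel R = coulomb - c.farKernel R := by
  funext z
  rw [Pi.sub_apply, ← c.nearKernel_add_farKernel R z, add_sub_cancel_right]

variable {R}

theorem hasFDerivAt_cutoff (z : E3) :
    HasFDerivAt (fun z => c.χ (R⁻¹ • z)) (R⁻¹ • fderiv ℝ c.χ (R⁻¹ • z)) z := by
  have h := ((c.smooth.differentiable (by simp)) (R⁻¹ • z)).hasFDerivAt.comp z
    ((hasFDerivAt_id (𝕜 := ℝ) z).const_smul R⁻¹)
  refine h.congr_fderiv ?_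
  ext w
  simp

variable (hR : 0 < R)

include hR

theorem farKernel_eq_zero {z : E3} (hz : ‖z‖ ≤ R) : c.farKernel R z = 0 := by
  rw [farKernel, c.eq_one, sub_self, zero_smul]
  rw [norm_smul, norm_inv, Real.norm_of_nonneg hR.le]
  exact inv_mul_le_one_of_le₀ hz hR.le

theorem norm_farKernel_le (z : E3) : ‖c.farKernel R z‖ ≤ (R ^ 2)⁻¹ := by
  rcases le_or_gt ‖z‖ R with h | h
  · rw [c.farKernel_eq_zero hR h, norm_zero]; positivity
  · have hm := c.mem_Icc (R⁻¹ • z)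
    have h1 : ‖1 - c.χ (R⁻¹ • z)‖ ≤ 1 := by
      rw [Real.norm_eq_abs, abs_le]; constructor <;> linarith [hm.1, hm.2]
    have hz : 0 < ‖z‖ := hR.trans h
    have h2 : ‖coulomb z‖ ≤ (R ^ 2)⁻¹ := by
      rw [norm_coulomb, show (-2 : ℝ) = ((-2 : ℤ) : ℝ) by norm_num, Real.rpow_intCast, zpow_neg]
      norm_cast
      gcongr
    rw [farKernel, norm_smul]
    calc _ ≤ 1 * (R ^ 2)⁻¹ := by gcongr
      _ = _ := one_mul _

theorem contDiff_farKernel : ContDiff ℝ 1 (c.farKernel R) := by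
  rw [contDiff_iff_contDiffAt]
  intro z
  rcases lt_or_ge ‖z‖ R with h | h
  · refine (contDiffAt_const (c := (0 : E3))).congr_of_eventuallyEq ?_
    filter_upwards [(isOpen_lt continuous_norm continuous_const).mem_nhds h] with y hy
      using c.farKernel_eq_zero hR (le_of_lt hy)
  · have hz : z ≠ 0 := norm_pos_iff.1 (hR.trans_le h)
    have hχ : ContDiff ℝ 1 fun z => 1 - c.χ (R⁻¹ • z) :=
      contDiff_const.sub ((c.smooth.of_le (by simp)).comp (contDiff_const_smul R⁻¹))
    exact hχ.contDiffAt.smul (contDiffAt_coulomb hz)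

theorem norm_fderiv_farKernel_le (z : E3) : ‖fderiv ℝ (c.farKernel R) z‖ ≤ 6 * (R ^ 3)⁻¹ := by
  rcases lt_or_ge ‖z‖ R with h | h
  · have : c.farKernel R =ᶠ[nhds z] fun _ => 0 := by
      filter_upwards [(isOpen_lt continuous_norm continuous_const).mem_nhds h] with y hy
        using c.farKernel_eq_zero hR (le_of_lt hy)
    rw [this.fderiv_eq]
    simp only [fderiv_fun_const, Pi.zero_apply, norm_zero]
    positivity
  · have hz' : 0 < ‖z‖ := hR.trans_le h
    have hz : z ≠ 0 := norm_pos_iff.1 hz'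
    have hd := ((c.hasFDerivAt_cutoff (R := R) z).const_sub 1).smul
      (differentiableAt_coulomb hz).hasFDerivAt
    have e : fderiv ℝ (c.farKernel R) z = _ := hd.fderiv
    rw [e]
    have hm := c.mem_Icc (R⁻¹ • z)
    have h1 : ‖1 - c.χ (R⁻¹ • z)‖ ≤ 1 := by
      rw [Real.norm_eq_abs, abs_le]; constructor <;> linarith [hm.1, hm.2]
    have h3 : (‖z‖ ^ 3)⁻¹ ≤ (R ^ 3)⁻¹ := by gcongr
    have h2 : ‖coulomb z‖ ≤ (R ^ 2)⁻¹ := by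
      rw [norm_coulomb, show (-2 : ℝ) = ((-2 : ℤ) : ℝ) by norm_num, Real.rpow_intCast, zpow_neg]
      norm_cast
      gcongr
    refine (norm_add_le _ _).trans ?_
    rw [norm_smul]
    refine (add_le_add (mul_le_mul h1 (norm_fderiv_coulomb_le hz) (norm_nonneg _) zero_le_one)
      (ContinuousLinearMap.norm_smulRight_apply _ _).le).trans ?_
    rw [norm_neg, norm_smul, norm_inv, Real.norm_of_nonneg hR.le]
    calc _ ≤ 1 * (4 * (R ^ 3)⁻¹) + R⁻¹ * 2 * (R ^ 2)⁻¹ := by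
          gcongr
          exact c.grad_le _
      _ = _ := by field_simp; norm_num

theorem norm_farKernel_sub_le (x y : E3) :
    ‖c.farKernel R x - c.farKernel R y‖ ≤ 6 * (R ^ 3)⁻¹ * ‖x - y‖ :=
  Convex.norm_image_sub_le_of_norm_fderiv_le (𝕜 := ℝ)
    (fun z _ => ((c.contDiff_farKernel hR).differentiable one_ne_zero) z)
    (fun z _ => c.norm_fderiv_farKernel_le hR z) convex_univ (mem_univ y) (mem_univ x)

theorem locallyIntegrable_farKernel : LocallyIntegrable (c.farKernel R) :=
  (c.contDiff_farKernel hR).continuous.locallyIntegrable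

theorem locallyIntegrable_nearKernel : LocallyIntegrable (c.nearKernel R) := by
  rw [c.nearKernel_eq]
  exact locallyIntegrable_coulomb.sub (c.locallyIntegrable_farKernel hR)

end CutoffData

section

variable {f : ℝ → E3 → E3 → ℝ} {κ : E3 → E3}
  (hf0 : ∀ t x v, 0 ≤ f t x v)
  (hf : ContDiff ℝ 1 fun p : ℝ × E3 × E3 => f p.1 p.2.1 p.2.2)
  (hfc : HasCompactSupport fun p : ℝ × E3 × E3 => f p.1 p.2.1 p.2.2)

include hf0 in
theorem rho_nonneg (t : ℝ) (x : E3) : 0 ≤ rho f t x := integral_nonneg fun v => hf0 t x v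

include hf hfc in
theorem integrable_rho (t : ℝ) : Integrable (rho f t) :=
  (contDiff_rho hf hfc t).continuous.integrable_of_hasCompactSupport
    ((hasCompactSupport_rho hfc).comp_isClosedEmbedding (isClosedEmbedding_prodMk t))

include hf0 hf hfc in
theorem norm_kernelField_le {B : ℝ} (hB : ∀ z, ‖κ z‖ ≤ B) (t : ℝ) (x : E3) :
    ‖kernelField κ f t x‖ ≤ mass f t * B := by
  rw [← integral_rho hf.continuous hfc t, ← integral_mul_const]
  refine norm_integral_le_of_norm_le ((integrable_rho hf hfc t).mul_const B) (ae_of_all _ fun y => ?_)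
  rw [norm_smul, Real.norm_of_nonneg (rho_nonneg hf0 t y)]
  exact mul_le_mul_of_nonneg_left (hB _) (rho_nonneg hf0 t y)

include hf0 hf hfc in
theorem norm_kernelField_sub_le (hκ : LocallyIntegrable κ) {L : ℝ}
    (hL : ∀ x y, ‖κ x - κ y‖ ≤ L * ‖x - y‖) (t : ℝ) (x y : E3) :
    ‖kernelField κ f t x - kernelField κ f t y‖ ≤ mass f t * (L * ‖x - y‖) := by
  rw [← integral_rho hf.continuous hfc t, ← integral_mul_const, kernelField, kernelField,
    ← integral_sub (integrable_kernelField hκ hf hfc t x) (integrable_kernelField hκ hf hfc t y)]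
  refine norm_integral_le_of_norm_le ((integrable_rho hf hfc t).mul_const _) (ae_of_all _ fun w => ?_)
  rw [← smul_sub, norm_smul, Real.norm_of_nonneg (rho_nonneg hf0 t w)]
  refine mul_le_mul_of_nonneg_left ?_ (rho_nonneg hf0 t w)
  simpa using hL (x - w) (y - w)

include hf hfc in
theorem kernelField_add {κ' : E3 → E3} (hκ : LocallyIntegrable κ) (hκ' : LocallyIntegrable κ')
    (t : ℝ) (x : E3) :
    kernelField κ f t x + kernelField κ' f t x = kernelField (fun z => κ z + κ' z) f t x := by
  rw [kernelField, kernelField, ← integral_add (integrable_kernelField hκ hf hfc t x)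
    (integrable_kernelField hκ' hf hfc t x)]
  simp only [kernelField, smul_add]

end

namespace VPClassicalSolution

variable {T : ℝ} (S : VPClassicalSolution T) (c : CutoffData)

def density (p : ℝ × E3 × E3) : ℝ := S.f p.1 p.2.1 p.2.2

theorem contDiff_density : ContDiff ℝ 1 S.density := S.f_c1

theorem hasCompactSupport_density : HasCompactSupport S.density := S.f_cpt

theorem density_nonneg (p : ℝ × E3 × E3) : 0 ≤ S.density p := S.f_nonneg _ _ _

theorem mass_nonneg (t : ℝ) : 0 ≤ mass S.f t := integral_nonneg fun _ => S.f_nonneg _ _ _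

theorem Rcut_pos : 0 < Rcut T S.f c.K0 := by
  have h1 := S.mass_nonneg 0
  have h2 := c.K0_ge
  have h3 := S.T_pos
  unfold Rcut
  positivity

theorem Rcut_cube : Rcut T S.f c.K0 ^ 3 = 24 * c.K0 * (1 + mass S.f 0) * (1 + T) ^ 3 := by
  have h1 := S.mass_nonneg 0
  have h2 := c.K0_ge
  rw [Rcut, mul_pow, ← Real.rpow_natCast, ← Real.rpow_mul (by positivity)]
  norm_num

theorem le_Rcut_cube : 2400 * (1 + T) ^ 3 ≤ Rcut T S.f c.K0 ^ 3 := by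
  have h1 := S.mass_nonneg 0
  have h2 := c.K0_ge
  have h3 := S.T_pos
  rw [S.Rcut_cube c]
  gcongr
  nlinarith

theorem le_Rcut : 1 + T ≤ Rcut T S.f c.K0 := by
  have h3 := S.T_pos
  refine le_of_pow_le_pow_left₀ three_ne_zero (S.Rcut_pos c).le (le_trans ?_ (S.le_Rcut_cube c))
  have : 0 < (1 + T) ^ 3 := by positivity
  linarith

theorem Eint_eq (t : ℝ) (x : E3) :
    Eint T S.f c t x = kernelField (c.nearKernel (Rcut T S.f c.K0)) S.f t x := by
  simp only [Eint, kernelField, CutoffData.nearKernel, coulomb, smul_smul, chiR]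
  congr 1
  ext1 y
  congr 1
  ring

theorem Eext_eq (t : ℝ) (x : E3) :
    Eext T S.f c t x = kernelField (c.farKernel (Rcut T S.f c.K0)) S.f t x := by
  have hR := S.Rcut_pos c
  rw [Eext, S.Eint_eq c, sub_eq_iff_eq_add', kernelField_add S.f_c1 S.f_cpt
    (c.locallyIntegrable_nearKernel hR) (c.locallyIntegrable_farKernel hR), Efield_eq_kernelField]
  simp only [c.nearKernel_add_farKernel]

theorem Fint_eq (t : ℝ) (x : E3) :
    Fint T S.f S.ξ c t x = c.nearKernel (Rcut T S.f c.K0) (x - S.ξ t) := rfl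

theorem Fext_eq (t : ℝ) (x : E3) :
    Fext T S.f S.ξ c t x = c.farKernel (Rcut T S.f c.K0) (x - S.ξ t) := by
  rw [Fext, S.Fint_eq c, sub_eq_iff_eq_add', c.nearKernel_add_farKernel]
  rfl

theorem continuous_ξ : Continuous S.ξ := S.ξ_c2.continuous

theorem continuous_Eext_add_Fext :
    Continuous fun q : ℝ × E3 => Eext T S.f c q.1 q.2 + Fext T S.f S.ξ c q.1 q.2 := by
  have hR := S.Rcut_pos c
  simp only [S.Eext_eq c, S.Fext_eq c]
  refine (continuous_kernelField (c.locallyIntegrable_farKernel hR) S.f_c1 S.f_cpt).add ?_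
  exact (c.contDiff_farKernel hR).continuous.comp
    (continuous_snd.sub (S.continuous_ξ.comp continuous_fst))

theorem norm_Eext_add_Fext_le {t : ℝ} (ht : mass S.f t ≤ 1) (x : E3) :
    ‖Eext T S.f c t x + Fext T S.f S.ξ c t x‖ ≤ 2 * (Rcut T S.f c.K0 ^ 2)⁻¹ := by
  have hR := S.Rcut_pos c
  rw [S.Eext_eq c, S.Fext_eq c]
  have h1 := norm_kernelField_le S.f_nonneg S.f_c1 S.f_cpt (c.norm_farKernel_le hR) t x
  have h2 : mass S.f t * (Rcut T S.f c.K0 ^ 2)⁻¹ ≤ 1 * (Rcut T S.f c.K0 ^ 2)⁻¹ := by gcongr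
  have h3 := c.norm_farKernel_le hR (x - S.ξ t)
  have h4 := norm_add_le (kernelField (c.farKernel (Rcut T S.f c.K0)) S.f t x)
    (c.farKernel (Rcut T S.f c.K0) (x - S.ξ t))
  linarith

theorem norm_Eext_add_Fext_sub_le {t : ℝ} (ht : mass S.f t ≤ 1) (x y : E3) :
    ‖(Eext T S.f c t x + Fext T S.f S.ξ c t x) - (Eext T S.f c t y + Fext T S.f S.ξ c t y)‖
      ≤ 12 * (Rcut T S.f c.K0 ^ 3)⁻¹ * ‖x - y‖ := by
  have hR := S.Rcut_pos c
  simp only [S.Eext_eq c, S.Fext_eq c]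
  rw [add_sub_add_comm]
  refine (norm_add_le _ _).trans ?_
  have h1 := norm_kernelField_sub_le S.f_nonneg S.f_c1 S.f_cpt (c.locallyIntegrable_farKernel hR)
    (c.norm_farKernel_sub_le hR) t x y
  have h2 : mass S.f t * (6 * (Rcut T S.f c.K0 ^ 3)⁻¹ * ‖x - y‖)
    ≤ 1 * (6 * (Rcut T S.f c.K0 ^ 3)⁻¹ * ‖x - y‖) := by gcongr
  have h3 := c.norm_farKernel_sub_le hR (x - S.ξ t) (y - S.ξ t)
  rw [sub_sub_sub_cancel_right] at h3
  linarith

end VPClassicalSolution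

theorem BackwardFlow.forcedFlow {T : ℝ} {S : VPClassicalSolution T} {c : CutoffData} {t : ℝ}
    (Φ : BackwardFlow T S c t) (ht : t ∈ Icc 0 T) (hm : ∀ τ ∈ Icc 0 T, mass S.f τ ≤ 1) :
    ForcedFlow (fun s x => Eext T S.f c (t - s) x + Fext T S.f S.ξ c (t - s) x) t
      (12 * (Rcut T S.f c.K0 ^ 3)⁻¹) (2 * (Rcut T S.f c.K0 ^ 2)⁻¹) Φ.X Φ.V := by
  have hR := S.Rcut_pos c
  have hm' : ∀ s ∈ Icc 0 t, mass S.f (t - s) ≤ 1 := fun s hs =>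
    hm _ ⟨by linarith [hs.2], by linarith [hs.1, ht.2]⟩
  refine ⟨ht.1, by positivity, by positivity, ?_, fun s hs => S.norm_Eext_add_Fext_sub_le c (hm' s hs),
    fun s hs => S.norm_Eext_add_Fext_le c (hm' s hs), ?_, Φ.init_X, Φ.init_V, Φ.ode_X, Φ.ode_V⟩
  · have h := (S.continuous_Eext_add_Fext c).comp
      (by fun_prop : Continuous fun q : ℝ × E3 => (t - q.1, q.2))
    simpa only [Function.comp_def] using h
  · have h1 := S.le_Rcut_cube c
    have hT := S.T_pos
    rw [mul_assoc, inv_mul_eq_div, mul_div, div_le_iff₀ (by positivity)]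
    have h2 : t ^ 2 ≤ (1 + T) ^ 3 := by
      have : t ^ 2 ≤ (1 + T) ^ 2 := pow_le_pow_left₀ ht.1 (by linarith [ht.2]) 2
      have h3 : (1 + T) ^ 2 ≤ (1 + T) ^ 3 := pow_le_pow_right₀ (by linarith) (by norm_num)
      exact this.trans h3
    have h4 : 0 ≤ (1 + T) ^ 3 := by positivity
    linarith

theorem VPClassicalSolution.two_mul_inv_Rcut_sq_mul_le {T : ℝ} (S : VPClassicalSolution T)
    (c : CutoffData) {t : ℝ} (ht : t ∈ Icc 0 T) : 2 * (Rcut T S.f c.K0 ^ 2)⁻¹ * t ≤ 1 := by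
  have hR := S.Rcut_pos c
  have h := S.le_Rcut c
  have hT := S.T_pos
  rw [mul_right_comm, ← div_eq_mul_inv, div_le_one (by positivity)]
  have h2 : (1 + T) ^ 2 ≤ Rcut T S.f c.K0 ^ 2 := by gcongr
  nlinarith [ht.2]

section

variable {f : ℝ → E3 → E3 → ℝ} {φ : E3 → E3}
  (hf : ContDiff ℝ 1 fun p : ℝ × E3 × E3 => f p.1 p.2.1 p.2.2)
  (hfc : HasCompactSupport fun p : ℝ × E3 × E3 => f p.1 p.2.1 p.2.2)
  (hφ : ContDiff ℝ 1 φ) (hφc : HasCompactSupport φ)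

theorem integrable_inner_smul_coulomb_sub {r : E3 → ℝ} (hr : Continuous r)
    (hrc : HasCompactSupport r) (hφ : Continuous φ) (hφc : HasCompactSupport φ) :
    Integrable (fun p : E3 × E3 => inner ℝ (r p.2 • coulomb (p.1 - p.2)) (φ p.1))
      (volume.prod volume) := by
  obtain ⟨a, ha⟩ := hrc.isCompact.isBounded.subset_closedBall (0 : E3)
  obtain ⟨b, hb⟩ := hφc.isCompact.isBounded.subset_closedBall (0 : E3)
  obtain ⟨M, hM⟩ := hφc.exists_bound_of_continuous hφ
  set k : E3 → E3 := (Metric.ball (0 : E3) (a + b + 1)).indicator coulomb with hk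
  have hki : Integrable k :=
    (integrable_indicator_iff Metric.isOpen_ball.measurableSet).2 (integrableOn_coulomb_ball _)
  have hri : Integrable r := hr.integrable_of_hasCompactSupport hrc
  have h := hri.convolution_integrand
    (ContinuousLinearMap.lsmul ℝ ℝ) hki
  simp only [ContinuousLinearMap.lsmul_apply] at h
  have e : (fun p : E3 × E3 => inner ℝ (r p.2 • coulomb (p.1 - p.2)) (φ p.1))
      = fun p => inner ℝ (r p.2 • k (p.1 - p.2)) (φ p.1) := by
    funext p
    by_cases h1 : r p.2 = 0
    · simp [h1]
    by_cases h2 : φ p.1 = 0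
    · simp [h2]
    have h3 := ha (subset_tsupport _ h1)
    have h4 := hb (subset_tsupport _ h2)
    rw [mem_closedBall_zero_iff] at h3 h4
    rw [hk, indicator_of_mem]
    rw [mem_ball_zero_iff]
    linarith [norm_sub_le p.1 p.2]
  rw [e]
  refine (h.norm.mul_const M).mono' (h.aestronglyMeasurable.inner
    (hφ.comp continuous_fst).aestronglyMeasurable) (ae_of_all _ fun p => ?_)
  exact (norm_inner_le_norm _ _).trans (mul_le_mul_of_nonneg_left (hM _) (norm_nonneg _))

include hf hfc hφ hφc

theorem integral_inner_Efield (t : ℝ) :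
    ∫ x, inner ℝ (Efield f t x) (φ x) = ∫ z : E3 × E3, f t z.1 z.2 * coulombAdjoint φ z.1 := by
  have hrc : HasCompactSupport (rho f t) :=
    (hasCompactSupport_rho hfc).comp_isClosedEmbedding (isClosedEmbedding_prodMk t)
  have hr := (contDiff_rho hf hfc t).continuous
  have hi := integrable_inner_smul_coulomb_sub hr hrc hφ.continuous hφc
  have h1 : ∀ x, inner ℝ (Efield f t x) (φ x)
      = ∫ y, inner ℝ (rho f t y • coulomb (x - y)) (φ x) := fun x => by
    simp_rw [real_inner_comm (φ x)]
    rw [integral_inner (integrable_kernelField locallyIntegrable_coulomb hf hfc t x),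
      Efield_eq_kernelField, kernelField]
  have h2 : ∀ y, ∫ x, inner ℝ (rho f t y • coulomb (x - y)) (φ x)
      = rho f t y * coulombAdjoint φ y := fun y => by
    simp_rw [real_inner_smul_left]
    rw [integral_const_mul, coulombAdjoint,
      ← integral_add_left_eq_self (fun x => inner ℝ (coulomb (x - y)) (φ x)) y]
    simp only [add_sub_cancel_left]
  simp_rw [h1]
  rw [integral_integral_swap hi]
  simp_rw [h2]
  have hz : Integrable (fun z : E3 × E3 => f t z.1 z.2 * coulombAdjoint φ z.1)
      (volume.prod volume) := by
    refine Continuous.integrable_of_hasCompactSupport ?_ ?_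
    · exact (hf.continuous.comp (by fun_prop : Continuous fun z : E3 × E3 => (t, z))).mul
        ((contDiff_coulombAdjoint hφ hφc).continuous.comp continuous_fst)
    · exact (hfc.comp_isClosedEmbedding (isClosedEmbedding_prodMk t)).mono
        fun z hz h0 => hz (by
          have : f t z.1 z.2 = 0 := h0
          simp [this])
  rw [Measure.volume_eq_prod, integral_prod _ hz]
  simp_rw [integral_mul_const]
  rfl

end

theorem integral_fderiv_apply_eq_zero {E : Type*} [NormedAddCommGroup E] [NormedSpace ℝ E]
    [FiniteDimensional ℝ E] [MeasurableSpace E] [BorelSpace E] (μ : Measure E) [μ.IsAddHaarMeasure]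
    {g : E → ℝ} (hg : ContDiff ℝ 1 g) (hgc : HasCompactSupport g) (w : E) :
    ∫ x, fderiv ℝ g x w ∂μ = 0 := by
  have hi : Integrable (fun x => fderiv ℝ g x w) μ :=
    ((hg.continuous_fderiv one_ne_zero).clm_apply continuous_const).integrable_of_hasCompactSupport
      ((hgc.fderiv (𝕜 := ℝ)).mono fun x hx h0 => hx (by simp [h0]))
  have h := integral_mul_fderiv_eq_neg_fderiv_mul_of_integrable (𝕜 := ℝ) (μ := μ)
    (f := fun _ => (1 : ℝ)) (g := g) (v := w) (by simp) (by simpa using hi)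
    (by simpa using hg.continuous.integrable_of_hasCompactSupport hgc)
    (fun _ _ => differentiableAt_const _) (fun x _ => (hg.differentiable one_ne_zero) x)
  simpa using h

section

variable {g : ℝ × E3 × E3 → ℝ} (hg : ContDiff ℝ 1 g) (hgc : HasCompactSupport g)

include hg in
theorem fderiv_slice_apply (τ : ℝ) (z w : E3 × E3) :
    fderiv ℝ (fun z => g (τ, z)) z w = fderiv ℝ g (τ, z) (0, w) := by
  have h := ((hg.differentiable one_ne_zero) (τ, z)).hasFDerivAt.comp z
    (hasFDerivAt_prodMk_right τ z)
  have e : fderiv ℝ (fun z => g (τ, z)) z = _ := h.fderiv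
  rw [e]
  simp

include hg hgc

theorem hasDerivAt_integral_slice (τ : ℝ) :
    HasDerivAt (fun τ => ∫ z, g (τ, z)) (∫ z, fderiv ℝ g (τ, z) (1, 0)) τ := by
  obtain ⟨r, hr⟩ := hgc.isCompact.isBounded.subset_closedBall (0 : ℝ × E3 × E3)
  have hc := hg.continuous_fderiv one_ne_zero
  obtain ⟨M, hM⟩ := (hgc.fderiv (𝕜 := ℝ)).exists_bound_of_continuous hc
  refine (hasDerivAt_integral_of_dominated_loc_of_deriv_le (s := univ)
    (F := fun τ z => g (τ, z)) (F' := fun τ z => fderiv ℝ g (τ, z) (1, 0))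
    (bound := (Metric.closedBall (0 : E3 × E3) r).indicator fun _ => M * ‖((1, 0) : ℝ × E3 × E3)‖)
    univ_mem
    (Eventually.of_forall fun x => (hg.continuous.comp (by fun_prop)).aestronglyMeasurable)
    ((hg.continuous.comp (by fun_prop)).integrable_of_hasCompactSupport
      (hgc.comp_isClosedEmbedding (isClosedEmbedding_prodMk τ)))
    ((hc.comp (by fun_prop : Continuous fun z : E3 × E3 => (τ, z))).clm_apply
      continuous_const).aestronglyMeasurable
    (ae_of_all _ fun z σ _ => ?_)
    ((integrable_indicator_iff Metric.isClosed_closedBall.measurableSet).2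
      (integrableOn_const (isCompact_closedBall _ _).measure_ne_top))
    (ae_of_all _ fun z σ _ => ?_)).2
  · by_cases hz : z ∈ Metric.closedBall (0 : E3 × E3) r
    · rw [indicator_of_mem hz]
      exact (ContinuousLinearMap.le_opNorm _ _).trans (by gcongr; exact hM _)
    · rw [indicator_of_notMem hz, fderiv_of_notMem_tsupport (𝕜 := ℝ)]
      · simp
      · intro hm
        have := hr hm
        rw [mem_closedBall_zero_iff] at this hz
        exact hz ((norm_snd_le (σ, z)).trans this)
  · exact ((hg.differentiable one_ne_zero) (σ, z)).hasFDerivAt.comp_hasDerivAt σ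
      ((hasDerivAt_id σ).prodMk (hasDerivAt_const σ z))

end

section

variable {g : E3 × E3 → ℝ} (hg : ContDiff ℝ 1 g) (hgc : HasCompactSupport g)

include hg hgc

theorem integral_fderiv_fst_eq_zero : ∫ z : E3 × E3, fderiv ℝ g z (z.2, 0) = 0 := by
  have hi : Integrable (fun z : E3 × E3 => fderiv ℝ g z (z.2, 0)) (volume.prod volume) :=
    ((hg.continuous_fderiv one_ne_zero).clm_apply
      (by fun_prop)).integrable_of_hasCompactSupport
      ((hgc.fderiv (𝕜 := ℝ)).mono fun x hx h0 => hx (by simp [h0]))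
  rw [Measure.volume_eq_prod, integral_prod_symm _ hi]
  refine integral_eq_zero_of_ae (ae_of_all _ fun v => ?_)
  have h := integral_fderiv_apply_eq_zero volume (g := fun x => g (x, v))
    (hg.comp (by fun_prop : ContDiff ℝ 1 fun x : E3 => (x, v)))
    (hgc.comp_isClosedEmbedding ⟨isEmbedding_prodMkLeft v, by
      have : range (fun b : E3 => (b, v)) = univ ×ˢ {v} := by ext q; simp [Prod.ext_iff, eq_comm]
      rw [this]
      exact isClosed_univ.prod isClosed_singleton⟩) v
  refine Eq.trans ?_ h
  refine integral_congr_ae (ae_of_all _ fun x => ?_)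
  have h := ((hg.differentiable one_ne_zero) (x, v)).hasFDerivAt.comp x
    (hasFDerivAt_prodMk_left (𝕜 := ℝ) x v)
  have e : fderiv ℝ (fun x => g (x, v)) x = _ := h.fderiv
  simp [e]

theorem integral_fderiv_snd_eq_zero {c : E3 → E3}
    (hi : Integrable fun z : E3 × E3 => fderiv ℝ g z (0, c z.1)) :
    ∫ z : E3 × E3, fderiv ℝ g z (0, c z.1) = 0 := by
  rw [Measure.volume_eq_prod] at hi ⊢
  rw [integral_prod _ hi]
  refine integral_eq_zero_of_ae (ae_of_all _ fun x => ?_)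
  have h := integral_fderiv_apply_eq_zero volume (g := fun v => g (x, v))
    (hg.comp (by fun_prop : ContDiff ℝ 1 fun v : E3 => (x, v)))
    (hgc.comp_isClosedEmbedding (isClosedEmbedding_prodMk x)) (c x)
  refine Eq.trans ?_ h
  refine integral_congr_ae (ae_of_all _ fun v => ?_)
  have h := ((hg.differentiable one_ne_zero) (x, v)).hasFDerivAt.comp v
    (hasFDerivAt_prodMk_right (𝕜 := ℝ) x v)
  have e : fderiv ℝ (fun v => g (x, v)) v = _ := h.fderiv
  simp [e]

end

theorem antitoneOn_integral_of_transport_nonpos {g : ℝ × E3 × E3 → ℝ} (hg : ContDiff ℝ 1 g)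
    (hgc : HasCompactSupport g) {T B : ℝ} {c : ℝ → E3 → E3} (hc : ∀ τ, Measurable (c τ))
    {ξ : ℝ → E3}
    (hb : ∀ τ ∈ Icc 0 T, ∀ z : E3 × E3, z.1 ≠ ξ τ →
      fderiv ℝ g (τ, z) (1, z.2, c τ z.1) ∈ Icc (-B) 0) :
    AntitoneOn (fun τ => ∫ z, g (τ, z)) (Icc 0 T) := by
  have hcd := hg.continuous_fderiv one_ne_zero
  have hd := hasDerivAt_integral_slice hg hgc
  refine antitoneOn_of_deriv_nonpos (convex_Icc 0 T)
    (fun τ _ => (hd τ).continuousAt.continuousWithinAt)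
    (fun τ _ => (hd τ).differentiableAt.differentiableWithinAt) fun τ hτ => ?_
  have hτ' := interior_subset hτ
  rw [(hd τ).deriv]
  have hs : ContDiff ℝ 1 fun z => g (τ, z) := hg.comp (by fun_prop)
  have hsc : HasCompactSupport fun z => g (τ, z) :=
    hgc.comp_isClosedEmbedding (isClosedEmbedding_prodMk τ)
  have hne : ∀ᵐ z : E3 × E3, z.1 ≠ ξ τ := by
    have h : ∀ᵐ x : E3, x ≠ ξ τ := by
      rw [ae_iff]; simp
    rw [Measure.volume_eq_prod]
    exact Measure.quasiMeasurePreserving_fst.ae h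
  have hτc : HasCompactSupport fun z : E3 × E3 => fderiv ℝ g (τ, z) :=
    (hgc.fderiv (𝕜 := ℝ)).comp_isClosedEmbedding (isClosedEmbedding_prodMk τ)
  have hcτ : Continuous fun z : E3 × E3 => fderiv ℝ g (τ, z) := hcd.comp (by fun_prop)
  have hi1 : Integrable fun z : E3 × E3 => fderiv ℝ g (τ, z) (1, 0) :=
    (hcτ.clm_apply continuous_const).integrable_of_hasCompactSupport
      (hτc.mono fun x hx h0 => hx (by simp [h0]))
  have hi2 : Integrable fun z : E3 × E3 => fderiv ℝ g (τ, z) (0, z.2, 0) :=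
    (hcτ.clm_apply (by fun_prop)).integrable_of_hasCompactSupport
      (hτc.mono fun x hx h0 => hx (by simp [h0]))
  have hmb : Measurable fun z : E3 × E3 => fderiv ℝ g (τ, z) (1, z.2, c τ z.1) := by
    have h : Continuous fun p : (E3 × E3) × E3 => fderiv ℝ g (τ, p.1) (1, p.1.2, p.2) :=
      (hcτ.comp continuous_fst).clm_apply (by fun_prop)
    exact h.measurable.comp (measurable_id.prodMk ((hc τ).comp measurable_fst))
  have hi3 : Integrable fun z : E3 × E3 => fderiv ℝ g (τ, z) (1, z.2, c τ z.1) := by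
    have hk : IsCompact (tsupport fun z : E3 × E3 => fderiv ℝ g (τ, z)) := hτc
    refine Integrable.mono' (g := (tsupport fun z : E3 × E3 => fderiv ℝ g (τ, z)).indicator
      fun _ => B) ((integrable_indicator_iff hk.isClosed.measurableSet).2
      (integrableOn_const hk.measure_ne_top)) hmb.aestronglyMeasurable ?_
    filter_upwards [hne] with z hz
    by_cases hm : z ∈ tsupport fun z : E3 × E3 => fderiv ℝ g (τ, z)
    · rw [indicator_of_mem hm, Real.norm_eq_abs, abs_le]
      have := hb τ hτ' z hz
      exact ⟨this.1, by linarith [this.1, this.2]⟩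
    · have h0 : fderiv ℝ g (τ, z) = 0 :=
        image_eq_zero_of_notMem_tsupport (f := fun z => fderiv ℝ g (τ, z)) hm
      rw [indicator_of_notMem hm, h0]
      simp
  have e : ∀ z : E3 × E3, fderiv ℝ g (τ, z) (0, 0, c τ z.1)
      = fderiv ℝ g (τ, z) (1, z.2, c τ z.1) - fderiv ℝ g (τ, z) (1, 0)
        - fderiv ℝ g (τ, z) (0, z.2, 0) := fun z => by
    rw [← map_sub, ← map_sub]
    congr 1
    simp
  have hi4 : Integrable fun z : E3 × E3 => fderiv ℝ g (τ, z) (0, 0, c τ z.1) := by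
    simp only [e]
    exact (hi3.sub hi1).sub hi2
  have h1 := integral_fderiv_fst_eq_zero hs hsc
  have h2 := integral_fderiv_snd_eq_zero hs hsc (c := c τ) (by
    simp only [fderiv_slice_apply hg]; exact hi4)
  simp only [fderiv_slice_apply hg] at h1 h2
  simp only [e] at h2
  have hi5 : Integrable fun z : E3 × E3 =>
      fderiv ℝ g (τ, z) (1, z.2, c τ z.1) - fderiv ℝ g (τ, z) (1, 0) := hi3.sub hi1
  rw [integral_sub hi5 hi2, integral_sub hi3 hi1, h1] at h2
  have h3 : ∫ z : E3 × E3, fderiv ℝ g (τ, z) (1, z.2, c τ z.1) ≤ 0 := by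
    refine integral_nonpos_of_ae ?_
    filter_upwards [hne] with z hz using (hb τ hτ' z hz).2
  linarith

def invEnergy (y w : E3) : ℝ := ‖y‖ / (‖y‖ * (1 + ‖w‖ ^ 2 / 2) + 1)

theorem invEnergy_denom_pos (y w : E3) : 0 < ‖y‖ * (1 + ‖w‖ ^ 2 / 2) + 1 := by positivity

theorem invEnergy_nonneg (y w : E3) : 0 ≤ invEnergy y w := by unfold invEnergy; positivity

theorem invEnergy_le_norm (y w : E3) : invEnergy y w ≤ ‖y‖ := by
  refine div_le_self (norm_nonneg _) ?_
  have : 0 ≤ ‖y‖ * (1 + ‖w‖ ^ 2 / 2) := by positivity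
  linarith

theorem invEnergy_le_one (y w : E3) : invEnergy y w ≤ 1 := by
  rw [invEnergy, div_le_one (invEnergy_denom_pos y w)]
  have : 0 ≤ ‖y‖ * (‖w‖ ^ 2 / 2) := by positivity
  nlinarith

theorem invEnergy_eq_inv {y : E3} (hy : y ≠ 0) (w : E3) :
    invEnergy y w = (1 + ‖w‖ ^ 2 / 2 + ‖y‖⁻¹)⁻¹ := by
  have := norm_pos_iff.2 hy
  rw [invEnergy]
  field_simp

theorem contDiffAt_invEnergy {y w : E3} (hy : y ≠ 0) :
    ContDiffAt ℝ 1 (fun p : E3 × E3 => invEnergy p.1 p.2) (y, w) := by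
  unfold invEnergy
  have h1 : ContDiffAt ℝ 1 (fun p : E3 × E3 => ‖p.1‖) (y, w) := contDiffAt_fst.norm ℝ hy
  have h2 : ContDiffAt ℝ 1 (fun p : E3 × E3 => ‖p.2‖ ^ 2) (y, w) := contDiffAt_snd.norm_sq ℝ
  exact h1.div ((h1.mul (contDiffAt_const.add (h2.div_const 2))).add contDiffAt_const)
    (invEnergy_denom_pos y w).ne'

theorem hasDerivAt_norm_comp {y : ℝ → E3} {y' : E3} {r : ℝ} (hy : HasDerivAt y y' r)
    (h0 : y r ≠ 0) : HasDerivAt (fun r => ‖y r‖) (inner ℝ (y r) y' / ‖y r‖) r := by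
  have h := hy.norm_sq.sqrt (by simpa using h0)
  simp only [Real.sqrt_sq (norm_nonneg _)] at h
  exact h.congr_deriv (by field_simp)

theorem hasDerivAt_invEnergy_comp {y w : ℝ → E3} {e : E3} {r : ℝ} (hy : HasDerivAt y (w r) r)
    (hw : HasDerivAt w (e + coulomb (y r)) r) (h0 : y r ≠ 0) :
    HasDerivAt (fun r => invEnergy (y r) (w r))
      (-(invEnergy (y r) (w r) ^ 2 * inner ℝ (w r) e)) r := by
  have hn := norm_pos_iff.2 h0
  have h1 := ((hw.norm_sq.div_const 2).const_add 1).add ((hasDerivAt_norm_comp hy h0).inv hn.ne')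
  have h2 := h1.inv (by simp only [Pi.add_apply, Pi.inv_apply]; positivity)
  have hev : ∀ᶠ s in nhds r, y s ≠ 0 := hy.continuousAt.eventually_ne h0
  refine (h2.congr_of_eventuallyEq ?_).congr_deriv ?_
  · filter_upwards [hev] with s hs
    rw [invEnergy_eq_inv hs]
    rfl
  · rw [invEnergy_eq_inv h0]
    simp only [Pi.add_apply, Pi.inv_apply]
    rw [inner_add_right, coulomb, real_inner_smul_right, real_inner_comm (y r) (w r)]
    field_simp
    ring

def chargeCutoff (C N : ℝ) (τ : ℝ) (y w : E3) : ℝ :=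
  1 - Real.smoothTransition (invEnergy y w * (Real.exp (C * τ) * N) - 1)

theorem chargeCutoff_nonneg (C N τ : ℝ) (y w : E3) : 0 ≤ chargeCutoff C N τ y w :=
  sub_nonneg.2 (Real.smoothTransition.le_one _)

theorem chargeCutoff_eq_one {C N τ : ℝ} (hN : 0 ≤ N) {y w : E3}
    (h : ‖y‖ * (Real.exp (C * τ) * N) ≤ 1) : chargeCutoff C N τ y w = 1 := by
  rw [chargeCutoff, Real.smoothTransition.zero_of_nonpos, sub_zero]
  have : invEnergy y w * (Real.exp (C * τ) * N) ≤ ‖y‖ * (Real.exp (C * τ) * N) := by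
    gcongr; exact invEnergy_le_norm y w
  linarith

theorem contDiff_chargeCutoff (C : ℝ) {N : ℝ} (hN : 0 ≤ N) :
    ContDiff ℝ 1 fun p : ℝ × E3 × E3 => chargeCutoff C N p.1 p.2.1 p.2.2 := by
  rw [contDiff_iff_contDiffAt]
  rintro ⟨τ, y, w⟩
  by_cases hy : y = 0
  · refine (contDiffAt_const (c := (1 : ℝ))).congr_of_eventuallyEq ?_
    have hc : ContinuousAt (fun p : ℝ × E3 × E3 => ‖p.2.1‖ * (Real.exp (C * p.1) * N)) (τ, y, w) := by
      fun_prop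
    have hlt : ‖y‖ * (Real.exp (C * τ) * N) < 1 := by simp [hy]
    have := hc.eventually (gt_mem_nhds hlt)
    filter_upwards [this] with p hp using chargeCutoff_eq_one hN hp.le
  · unfold chargeCutoff
    have h1 : ContDiffAt ℝ 1 (fun p : ℝ × E3 × E3 => invEnergy p.2.1 p.2.2) (τ, y, w) :=
      (contDiffAt_invEnergy hy).comp (τ, y, w) contDiffAt_snd
    refine contDiffAt_const.sub (Real.smoothTransition.contDiffAt.comp _
      ((h1.mul ?_).sub contDiffAt_const))
    have h2 : ContDiff ℝ 1 fun p : ℝ × E3 × E3 => Real.exp (C * p.1) * N := by fun_prop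
    exact h2.contDiffAt

theorem hasDerivAt_chargeCutoff_comp {C N τ : ℝ} {y w : ℝ → E3} {e : E3} {r : ℝ}
    (hy : HasDerivAt y (w r) r) (hw : HasDerivAt w (e + coulomb (y r)) r) (h0 : y r ≠ 0) :
    HasDerivAt (fun r => chargeCutoff C N (τ + r) (y r) (w r))
      (-(deriv Real.smoothTransition (invEnergy (y r) (w r) * (Real.exp (C * (τ + r)) * N) - 1)
        * (Real.exp (C * (τ + r)) * N
          * (C * invEnergy (y r) (w r) - invEnergy (y r) (w r) ^ 2 * inner ℝ (w r) e)))) r := by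
  have h1 : HasDerivAt (fun r => Real.exp (C * (τ + r)) * N)
      (Real.exp (C * (τ + r)) * C * N) r := by
    have h := (((hasDerivAt_id r).const_add τ).const_mul C).exp.mul_const N
    exact h.congr_deriv (by simp)
  have h2 := ((hasDerivAt_invEnergy_comp hy hw h0).mul h1).sub_const 1
  have hS : HasDerivAt Real.smoothTransition _
      (invEnergy (y r) (w r) * (Real.exp (C * (τ + r)) * N) - 1) :=
    ((Real.smoothTransition.contDiff (n := 1)).differentiable (by simp) _).hasDerivAt
  refine ((hS.comp r h2).const_sub 1).congr_deriv ?_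
  ring

theorem deriv_chargeCutoff_mem {C N τ T : ℝ} (hC : 0 ≤ C) (hN : 0 ≤ N) (hτ : τ ∈ Icc 0 T) {M : ℝ}
    (hM : ∀ x ∈ Icc (-1) (Real.exp (C * T) * N), ‖deriv Real.smoothTransition x‖ ≤ M) {y w e : E3}
    (he : |inner ℝ w e| ≤ C) :
    -(deriv Real.smoothTransition (invEnergy y w * (Real.exp (C * τ) * N) - 1)
        * (Real.exp (C * τ) * N * (C * invEnergy y w - invEnergy y w ^ 2 * inner ℝ w e)))
      ∈ Icc (-(M * (Real.exp (C * T) * N * (2 * C)))) 0 := by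
  set κ := invEnergy y w
  have hk0 : 0 ≤ κ := invEnergy_nonneg y w
  have hk1 : κ ≤ 1 := invEnergy_le_one y w
  have hexp : Real.exp (C * τ) * N ≤ Real.exp (C * T) * N := by gcongr; exact hτ.2
  have hexp0 : 0 ≤ Real.exp (C * τ) * N := by positivity
  have hk2 : κ ^ 2 ≤ κ := by nlinarith
  have hi : |κ ^ 2 * inner ℝ w e| ≤ κ * C := by
    rw [abs_mul, abs_of_nonneg (sq_nonneg κ)]
    gcongr
  rw [abs_le] at hi
  have hb0 : 0 ≤ C * κ - κ ^ 2 * inner ℝ w e := by linarith [hi.2]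
  have hb1 : C * κ - κ ^ 2 * inner ℝ w e ≤ 2 * C := by nlinarith [hi.1]
  have hd0 := Real.smoothTransition.monotone.deriv_nonneg (x := κ * (Real.exp (C * τ) * N) - 1)
  have hd1 := hM (κ * (Real.exp (C * τ) * N) - 1) ⟨by nlinarith, by nlinarith⟩
  rw [Real.norm_of_nonneg hd0] at hd1
  refine ⟨neg_le_neg ?_, neg_nonpos.2 (by positivity)⟩
  have hM0 := hd0.trans hd1
  gcongr

theorem fderiv_apply_eq_deriv_curve {g : ℝ × E3 × E3 → ℝ} (hg : Differentiable ℝ g) (τ : ℝ)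
    (x v e : E3) {d : ℝ} (h : HasDerivAt (fun r : ℝ => g (τ + r, x + r • v, v + r • e)) d 0) :
    fderiv ℝ g (τ, x, v) (1, v, e) = d := by
  have hd : HasFDerivAt g (fderiv ℝ g (τ, x, v)) (τ + 0, x + (0 : ℝ) • v, v + (0 : ℝ) • e) := by
    rw [add_zero, zero_smul, zero_smul, add_zero, add_zero]
    exact (hg _).hasFDerivAt
  have hr : HasDerivAt (fun r : ℝ => (τ + r, x + r • v, v + r • e)) (1, v, e) 0 := by
    refine ((hasDerivAt_id (0 : ℝ)).const_add τ).prodMk (HasDerivAt.prodMk ?_ ?_)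
    · simpa using ((hasDerivAt_id (0 : ℝ)).smul_const v).const_add x
    · simpa using ((hasDerivAt_id (0 : ℝ)).smul_const e).const_add v
  exact (HasFDerivAt.comp_hasDerivAt (f := fun r : ℝ => (τ + r, x + r • v, v + r • e)) 0 hd hr).unique h

theorem fderiv_chargeCutoff_comp_apply {C N τ : ℝ} {ξ η : ℝ → E3} {e₀ e x v : E3}
    (hG : Differentiable ℝ fun p : ℝ × E3 × E3 =>
      chargeCutoff C N p.1 (p.2.1 - ξ p.1) (p.2.2 - η p.1))
    (hξ : HasDerivAt ξ (η τ) τ) (hη : HasDerivAt η e₀ τ) (hx : x ≠ ξ τ) :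
    fderiv ℝ (fun p : ℝ × E3 × E3 => chargeCutoff C N p.1 (p.2.1 - ξ p.1) (p.2.2 - η p.1))
        (τ, x, v) (1, v, e + coulomb (x - ξ τ))
      = -(deriv Real.smoothTransition
          (invEnergy (x - ξ τ) (v - η τ) * (Real.exp (C * τ) * N) - 1)
        * (Real.exp (C * τ) * N * (C * invEnergy (x - ξ τ) (v - η τ)
          - invEnergy (x - ξ τ) (v - η τ) ^ 2 * inner ℝ (v - η τ) (e - e₀)))) := by
  refine fderiv_apply_eq_deriv_curve hG τ x v _ ?_
  have hs : HasDerivAt (fun r : ℝ => τ + r) 1 0 := (hasDerivAt_id (0 : ℝ)).const_add τ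
  have hy : HasDerivAt (fun r : ℝ => x + r • v - ξ (τ + r))
      (v + (0 : ℝ) • (e + coulomb (x - ξ τ)) - η (τ + 0)) 0 := by
    have h2 := HasDerivAt.scomp (h := fun r : ℝ => τ + r) (g₁ := ξ) (g₁' := η τ) (0 : ℝ)
      (by simpa using hξ) hs
    have h3 := (((hasDerivAt_id (0 : ℝ)).smul_const v).const_add x).sub h2
    exact h3.congr_deriv (by simp)
  have hw : HasDerivAt (fun r : ℝ => v + r • (e + coulomb (x - ξ τ)) - η (τ + r))
      (e - e₀ + coulomb (x + (0 : ℝ) • v - ξ (τ + 0))) 0 := by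
    have h2 := HasDerivAt.scomp (h := fun r : ℝ => τ + r) (g₁ := η) (g₁' := e₀) (0 : ℝ)
      (by simpa using hη) hs
    have h3 := (((hasDerivAt_id (0 : ℝ)).smul_const (e + coulomb (x - ξ τ))).const_add v).sub h2
    refine h3.congr_deriv ?_
    simp only [one_smul, zero_smul, add_zero]
    abel
  have h4 := hasDerivAt_chargeCutoff_comp (C := C) (N := N) (τ := τ) (e := e - e₀) (r := 0)
    (y := fun r : ℝ => x + r • v - ξ (τ + r))
    (w := fun r : ℝ => v + r • (e + coulomb (x - ξ τ)) - η (τ + r)) hy hw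
    (by simpa [sub_eq_zero] using hx)
  simp only [add_zero, zero_smul] at h4
  exact h4

namespace VPClassicalSolution

variable {T : ℝ} (S : VPClassicalSolution T)

theorem continuous_Efield : Continuous fun q : ℝ × E3 => Efield S.f q.1 q.2 := by
  rw [Efield_eq_kernelField]
  exact continuous_kernelField locallyIntegrable_coulomb S.f_c1 S.f_cpt

theorem measurable_Efield_add_Fpt (τ : ℝ) :
    Measurable fun x => Efield S.f τ x + Fpt S.ξ τ x :=
  (S.continuous_Efield.comp (by fun_prop : Continuous fun x : E3 => (τ, x))).measurable.add
    (measurable_coulomb.comp (measurable_id.sub_const (S.ξ τ)))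

theorem fderiv_density_apply_of_ne {τ : ℝ} (hτ : τ ∈ Icc 0 T) {z : E3 × E3} (hz : z.1 ≠ S.ξ τ) :
    fderiv ℝ S.density (τ, z) (1, z.2, Efield S.f τ z.1 + Fpt S.ξ τ z.1) = 0 := by
  obtain ⟨x, v⟩ := z
  have hd := ((S.contDiff_density.differentiable one_ne_zero) (τ, x, v)).hasFDerivAt
  have c1 : HasDerivAt (fun τ : ℝ => (τ, x, v)) (1, 0, 0) τ :=
    (hasDerivAt_id τ).prodMk (hasDerivAt_const τ (x, v))
  have c2 : HasFDerivAt (fun y : E3 => (τ, y, v)) _ x :=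
    (hasFDerivAt_prodMk_right (𝕜 := ℝ) τ (x, v)).comp x (hasFDerivAt_prodMk_left (𝕜 := ℝ) x v)
  have c3 : HasFDerivAt (fun w : E3 => (τ, x, w)) _ v :=
    (hasFDerivAt_prodMk_right (𝕜 := ℝ) τ (x, v)).comp v (hasFDerivAt_prodMk_right (𝕜 := ℝ) x v)
  have h1 : HasDerivAt (fun τ => S.f τ x v) _ τ :=
    HasFDerivAt.comp_hasDerivAt (f := fun τ : ℝ => (τ, x, v)) τ hd c1
  have h2 : HasFDerivAt (fun y => S.f τ y v) _ x :=
    HasFDerivAt.comp (f := fun y : E3 => (τ, y, v)) x hd c2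
  have h3 : HasFDerivAt (fun w => S.f τ x w) _ v :=
    HasFDerivAt.comp (f := fun w : E3 => (τ, x, w)) v hd c3
  have h := S.vlasov τ hτ x v hz
  rw [h1.deriv, h2.fderiv, h3.fderiv] at h
  simp only [ContinuousLinearMap.comp_apply, ContinuousLinearMap.inl_apply,
    ContinuousLinearMap.inr_apply] at h
  rw [← map_add, ← map_add] at h
  simpa using h

theorem mass_eq {τ : ℝ} (hτ : τ ∈ Icc 0 T) : mass S.f τ = mass S.f 0 := by
  have h0 : (0 : ℝ) ∈ Icc 0 T := ⟨le_rfl, S.T_pos.le⟩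
  refine le_antisymm ?_ ?_
  · refine antitoneOn_integral_of_transport_nonpos S.contDiff_density S.hasCompactSupport_density
      (B := 0) S.measurable_Efield_add_Fpt (ξ := S.ξ) (fun τ hτ z hz => ?_) h0 hτ hτ.1
    rw [S.fderiv_density_apply_of_ne hτ hz]
    simp
  · have h := antitoneOn_integral_of_transport_nonpos S.contDiff_density.neg
      (S.hasCompactSupport_density.mono fun x hx h0 => hx (by simp [h0]))
      (B := 0) S.measurable_Efield_add_Fpt (ξ := S.ξ) (fun τ hτ z hz => by
        rw [fderiv_fun_neg, neg_apply, S.fderiv_density_apply_of_ne hτ hz]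
        simp) h0 hτ hτ.1
    simp only [integral_neg] at h
    exact neg_le_neg_iff.1 h

theorem contDiff_η : ContDiff ℝ 1 S.η := by
  have : S.η = deriv S.ξ := funext fun t => (S.ξ_ode t).deriv.symm
  rw [this]
  exact (contDiff_succ_iff_deriv.1 (S.ξ_c2 : ContDiff ℝ (1 + 1) S.ξ)).2.2

theorem contDiff_chargeCutoff_comp (C : ℝ) {N : ℝ} (hN : 0 ≤ N) :
    ContDiff ℝ 1 fun p : ℝ × E3 × E3 => chargeCutoff C N p.1 (p.2.1 - S.ξ p.1) (p.2.2 - S.η p.1) := by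
  have h1 : ContDiff ℝ 1 S.ξ := S.ξ_c2.of_le (by norm_num)
  have h2 := S.contDiff_η
  have h3 : ContDiff ℝ 1 fun p : ℝ × E3 × E3 => (p.1, p.2.1 - S.ξ p.1, p.2.2 - S.η p.1) := by
    fun_prop
  have h := (contDiff_chargeCutoff C hN).comp h3
  simpa only [Function.comp_def] using h

theorem fderiv_chargeCutoff_apply (C : ℝ) {N : ℝ} (hN : 0 ≤ N) {τ : ℝ} (hτ : τ ∈ Icc 0 T)
    {z : E3 × E3} (hz : z.1 ≠ S.ξ τ) :
    fderiv ℝ (fun p : ℝ × E3 × E3 => chargeCutoff C N p.1 (p.2.1 - S.ξ p.1) (p.2.2 - S.η p.1))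
        (τ, z) (1, z.2, Efield S.f τ z.1 + Fpt S.ξ τ z.1)
      = -(deriv Real.smoothTransition
          (invEnergy (z.1 - S.ξ τ) (z.2 - S.η τ) * (Real.exp (C * τ) * N) - 1)
        * (Real.exp (C * τ) * N * (C * invEnergy (z.1 - S.ξ τ) (z.2 - S.η τ)
          - invEnergy (z.1 - S.ξ τ) (z.2 - S.η τ) ^ 2
            * inner ℝ (z.2 - S.η τ) (Efield S.f τ z.1 - Efield S.f τ (S.ξ τ))))) :=
  fderiv_chargeCutoff_comp_apply
    ((S.contDiff_chargeCutoff_comp C hN).differentiable one_ne_zero) (S.ξ_ode τ) (S.η_ode τ hτ) hz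

end VPClassicalSolution

namespace VPClassicalSolution

variable {T : ℝ} (S : VPClassicalSolution T)

theorem continuous_chargeWork : Continuous fun p : ℝ × E3 × E3 =>
    inner ℝ (p.2.2 - S.η p.1) (Efield S.f p.1 p.2.1 - Efield S.f p.1 (S.ξ p.1)) := by
  have h1 : Continuous fun p : ℝ × E3 × E3 => Efield S.f p.1 p.2.1 := by
    have h := S.continuous_Efield.comp
      (by fun_prop : Continuous fun p : ℝ × E3 × E3 => (p.1, p.2.1))
    simpa only [Function.comp_def] using h
  have h2 : Continuous fun p : ℝ × E3 × E3 => Efield S.f p.1 (S.ξ p.1) := by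
    have h := S.continuous_Efield.comp
      (continuous_fst.prodMk (S.continuous_ξ.comp continuous_fst) :
        Continuous fun p : ℝ × E3 × E3 => (p.1, S.ξ p.1))
    simpa only [Function.comp_def] using h
  have h3 : Continuous fun p : ℝ × E3 × E3 => p.2.2 - S.η p.1 :=
    (continuous_snd.comp continuous_snd).sub (S.contDiff_η.continuous.comp continuous_fst)
  exact h3.inner (h1.sub h2)

/-- On the initial support the regularised inverse energy is bounded below. -/
theorem exists_chargeCutoff_initial_eq_zero (C : ℝ) :
    ∃ N, 0 < N ∧ ∀ x v, S.f 0 x v ≠ 0 → chargeCutoff C N 0 (x - S.ξ 0) (v - S.η 0) = 0 := by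
  obtain ⟨ε, hε, hf0⟩ := S.f0_vanishes_near_charge
  obtain ⟨A, hA⟩ := S.hasCompactSupport_density.isCompact.exists_bound_of_continuousOn
    (f := fun p : ℝ × E3 × E3 => ‖p.2.2 - S.η 0‖ ^ 2 / 2) (by fun_prop)
  have hB : 0 ≤ max A 0 := le_max_right _ _
  have hN : 0 < 2 * (1 + max A 0 + ε⁻¹) := by positivity
  refine ⟨2 * (1 + max A 0 + ε⁻¹), hN, fun x v h => ?_⟩
  have hx : ε ≤ ‖x - S.ξ 0‖ := not_lt.1 fun hlt => h (hf0 x v hlt)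
  have hv : ‖v - S.η 0‖ ^ 2 / 2 ≤ max A 0 := by
    have := hA (0, x, v) (subset_tsupport _ (by exact h))
    exact ((le_abs_self _).trans this).trans (le_max_left _ _)
  have hne : x - S.ξ 0 ≠ 0 := norm_pos_iff.1 (hε.trans_le hx)
  rw [chargeCutoff, Real.smoothTransition.one_of_one_le, sub_self]
  rw [invEnergy_eq_inv hne, mul_zero, Real.exp_zero, one_mul]
  have h1 : ‖x - S.ξ 0‖⁻¹ ≤ ε⁻¹ := inv_anti₀ hε hx
  have h2 : 0 < 1 + ‖v - S.η 0‖ ^ 2 / 2 + ‖x - S.ξ 0‖⁻¹ := by positivity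
  have h3 : 2 ≤ (1 + ‖v - S.η 0‖ ^ 2 / 2 + ‖x - S.ξ 0‖⁻¹)⁻¹ * (2 * (1 + max A 0 + ε⁻¹)) := by
    rw [← div_eq_inv_mul, le_div_iff₀ h2]
    linarith
  linarith

/-- The density stays away from the point charge. -/
theorem exists_pos_forall_eq_zero : ∃ δ > 0, ∀ τ ∈ Icc (0 : ℝ) T, ∀ x v,
    ‖x - S.ξ τ‖ ≤ δ → S.f τ x v = 0 := by
  obtain ⟨C', hC'⟩ := S.hasCompactSupport_density.isCompact.exists_bound_of_continuousOn
    S.continuous_chargeWork.continuousOn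
  set C := max C' 0
  have hC : 0 ≤ C := le_max_right _ _
  obtain ⟨N, hN, hinit⟩ := S.exists_chargeCutoff_initial_eq_zero C
  obtain ⟨M', hM'⟩ := (isCompact_Icc (a := -1) (b := Real.exp (C * T) * N)).exists_bound_of_continuousOn
    (((Real.smoothTransition.contDiff (n := 1)).continuous_deriv le_rfl).continuousOn)
  obtain ⟨A', hA'⟩ := S.hasCompactSupport_density.exists_bound_of_continuous
    S.contDiff_density.continuous
  set M := max M' 0
  have hM0 : 0 ≤ M := le_max_right _ _
  have hM : ∀ x ∈ Icc (-1) (Real.exp (C * T) * N), ‖deriv Real.smoothTransition x‖ ≤ M :=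
    fun x hx => (hM' x hx).trans (le_max_left _ _)
  have hΘ := S.contDiff_chargeCutoff_comp C hN.le
  have hg : ContDiff ℝ 1 fun p : ℝ × E3 × E3 =>
      S.density p * chargeCutoff C N p.1 (p.2.1 - S.ξ p.1) (p.2.2 - S.η p.1) :=
    S.contDiff_density.mul hΘ
  have hgc : HasCompactSupport fun p : ℝ × E3 × E3 =>
      S.density p * chargeCutoff C N p.1 (p.2.1 - S.ξ p.1) (p.2.2 - S.η p.1) :=
    S.hasCompactSupport_density.mul_right
  have hanti := antitoneOn_integral_of_transport_nonpos hg hgc (T := T)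
    (B := A' * (M * (Real.exp (C * T) * N * (2 * C)))) S.measurable_Efield_add_Fpt (ξ := S.ξ)
    (fun τ hτ z hz => by
      rw [fderiv_fun_mul (S.contDiff_density.differentiable one_ne_zero _)
        (hΘ.differentiable one_ne_zero _)]
      rw [add_apply, smul_apply, smul_apply, S.fderiv_density_apply_of_ne hτ hz,
        S.fderiv_chargeCutoff_apply C hN.le hτ hz, smul_zero, add_zero, smul_eq_mul]
      have hA0 : 0 ≤ M * (Real.exp (C * T) * N * (2 * C)) := by positivity
      have hfA : S.density (τ, z) ≤ A' := (le_abs_self _).trans (hA' _)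
      have hf := S.density_nonneg (τ, z)
      rcases eq_or_ne (S.density (τ, z)) 0 with h0 | h0
      · rw [h0, zero_mul]
        have : 0 ≤ A' := hf.trans hfA
        exact ⟨neg_nonpos.2 (by positivity), le_rfl⟩
      · have hwork := (hC' (τ, z) (subset_tsupport _ h0)).trans (le_max_left C' 0)
        obtain ⟨h1, h2⟩ := deriv_chargeCutoff_mem hC hN.le hτ hM (y := z.1 - S.ξ τ) hwork
        refine ⟨?_, mul_nonpos_of_nonneg_of_nonpos hf h2⟩
        calc -(A' * (M * (Real.exp (C * T) * N * (2 * C))))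
            ≤ -(S.density (τ, z) * (M * (Real.exp (C * T) * N * (2 * C)))) := by gcongr
          _ = S.density (τ, z) * -(M * (Real.exp (C * T) * N * (2 * C))) := by ring
          _ ≤ _ := by gcongr)
  refine ⟨(Real.exp (C * T) * N)⁻¹, by positivity, fun τ hτ x v hx => ?_⟩
  have h0 : (0 : ℝ) ∈ Icc 0 T := ⟨le_rfl, S.T_pos.le⟩
  have hle := hanti h0 hτ hτ.1
  have hz : (fun z : E3 × E3 => S.density (0, z)
      * chargeCutoff C N (0, z).1 ((0, z).2.1 - S.ξ (0, z).1) ((0, z).2.2 - S.η (0, z).1)) = 0 := by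
    funext z
    by_cases h : S.f 0 z.1 z.2 = 0
    · simp [density, h]
    · simp [hinit _ _ h]
  have hcont : Continuous fun z : E3 × E3 => S.density (τ, z)
      * chargeCutoff C N τ (z.1 - S.ξ τ) (z.2 - S.η τ) := by
    have h := hg.continuous.comp (by fun_prop : Continuous fun z : E3 × E3 => (τ, z))
    simpa only [Function.comp_def] using h
  have hcs : HasCompactSupport fun z : E3 × E3 => S.density (τ, z)
      * chargeCutoff C N τ (z.1 - S.ξ τ) (z.2 - S.η τ) := by
    have h := hgc.comp_isClosedEmbedding (isClosedEmbedding_prodMk τ)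
    simpa only [Function.comp_def] using h
  have hnn : ∀ z : E3 × E3, 0 ≤ S.density (τ, z)
      * chargeCutoff C N τ (z.1 - S.ξ τ) (z.2 - S.η τ) :=
    fun z => mul_nonneg (S.density_nonneg _) (chargeCutoff_nonneg _ _ _ _ _)
  have hint : ∫ z : E3 × E3, S.density (τ, z)
      * chargeCutoff C N τ (z.1 - S.ξ τ) (z.2 - S.η τ) = 0 := by
    refine le_antisymm (hle.trans_eq ?_) (integral_nonneg hnn)
    simp only [hz]
    exact integral_zero _ _
  have hae := (integral_eq_zero_iff_of_nonneg hnn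
    (hcont.integrable_of_hasCompactSupport hcs)).1 hint
  have hzero := congrFun ((hcont.ae_eq_iff_eq volume continuous_zero).1 hae) (x, v)
  have hone : chargeCutoff C N τ (x - S.ξ τ) (v - S.η τ) = 1 := by
    refine chargeCutoff_eq_one hN.le ?_
    calc ‖x - S.ξ τ‖ * (Real.exp (C * τ) * N)
        ≤ (Real.exp (C * T) * N)⁻¹ * (Real.exp (C * T) * N) := by
          gcongr
          exact hτ.2
      _ = 1 := inv_mul_cancel₀ (by positivity)
  simpa [hone, density] using hzero

end VPClassicalSolution

namespace VPClassicalSolution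

variable {T : ℝ} (S : VPClassicalSolution T) (c : CutoffData)

/-- The internal field, with the charge singularity removed in the ball of radius `δ`. -/
def regularizedInt (δ : ℝ) (q : ℝ × E3) : E3 :=
  Eint T S.f c q.1 q.2 + chiR T S.f c (q.2 - S.ξ q.1) •
    ((max ‖q.2 - S.ξ q.1‖ δ ^ 3)⁻¹ • (q.2 - S.ξ q.1))

theorem continuous_regularizedInt {δ : ℝ} (hδ : 0 < δ) : Continuous (S.regularizedInt c δ) := by
  have h1 : Continuous fun q : ℝ × E3 => Eint T S.f c q.1 q.2 := by
    simp only [S.Eint_eq c]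
    exact continuous_kernelField (c.locallyIntegrable_nearKernel (S.Rcut_pos c)) S.f_c1 S.f_cpt
  have h2 : Continuous fun q : ℝ × E3 => q.2 - S.ξ q.1 :=
    continuous_snd.sub (S.continuous_ξ.comp continuous_fst)
  have h3 : Continuous fun q : ℝ × E3 => chiR T S.f c (q.2 - S.ξ q.1) :=
    c.smooth.continuous.comp (h2.const_smul (Rcut T S.f c.K0)⁻¹)
  have h4 : Continuous fun q : ℝ × E3 => (max ‖q.2 - S.ξ q.1‖ δ ^ 3)⁻¹ :=
    ((h2.norm.max continuous_const).pow 3).inv₀ fun q =>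
      pow_ne_zero 3 (hδ.trans_le (le_max_right _ _)).ne'
  exact h1.add (h3.smul (h4.smul h2))

theorem regularizedInt_eq {δ τ : ℝ} {x : E3} (h : δ ≤ ‖x - S.ξ τ‖) :
    S.regularizedInt c δ (τ, x) = Eint T S.f c τ x + Fint T S.f S.ξ c τ x := by
  simp only [regularizedInt, Fint, Fpt, max_eq_left h]

theorem fderiv_density_eq_zero {p : ℝ × E3 × E3} (h : S.density p = 0) :
    fderiv ℝ S.density p = 0 :=
  IsLocalMin.fderiv_eq_zero (Eventually.of_forall fun q => h ▸ S.density_nonneg q)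

variable {δ : ℝ} (hδ : ∀ τ ∈ Icc (0 : ℝ) T, ∀ x v, ‖x - S.ξ τ‖ ≤ δ → S.f τ x v = 0)
include hδ

theorem norm_regularizedInt_mul {τ : ℝ} (hτ : τ ∈ Icc 0 T) (x v : E3) :
    ‖S.regularizedInt c δ (τ, x)‖ * S.f τ x v
      = ‖Eint T S.f c τ x + Fint T S.f S.ξ c τ x‖ * S.f τ x v := by
  rcases le_total ‖x - S.ξ τ‖ δ with h | h
  · rw [hδ τ hτ x v h, mul_zero, mul_zero]
  · rw [S.regularizedInt_eq c h]

theorem fderiv_density_apply (hδ0 : 0 < δ) {τ : ℝ} (hτ : τ ∈ Icc 0 T) (z : E3 × E3) :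
    fderiv ℝ S.density (τ, z) (1, z.2, Eext T S.f c τ z.1 + Fext T S.f S.ξ c τ z.1
      + S.regularizedInt c δ (τ, z.1)) = 0 := by
  by_cases h : S.density (τ, z) = 0
  · rw [S.fderiv_density_eq_zero h, zero_apply]
  · have hlt : δ < ‖z.1 - S.ξ τ‖ := not_le.1 fun hle => h (hδ τ hτ z.1 z.2 hle)
    have hz : z.1 ≠ S.ξ τ := fun h0 => by
      rw [h0, sub_self, norm_zero] at hlt
      linarith
    have := S.fderiv_density_apply_of_ne hτ hz
    rwa [S.regularizedInt_eq c hlt.le, Eext, Fext,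
      show Efield S.f τ z.1 - Eint T S.f c τ z.1 + (Fpt S.ξ τ z.1 - Fint T S.f S.ξ c τ z.1)
        + (Eint T S.f c τ z.1 + Fint T S.f S.ξ c τ z.1) = Efield S.f τ z.1 + Fpt S.ξ τ z.1 by abel]

theorem Dterm_eq {t : ℝ} (ht : t ∈ Icc 0 T) (Φ : BackwardFlow T S c t) :
    Dterm T S c t Φ = fun x => ∫ s in (0 : ℝ)..t, s * ∫ v,
      ‖S.regularizedInt c δ (t - s, Φ.X s x v)‖ * S.density (t - s, Φ.X s x v, Φ.V s x v) := by
  funext x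
  refine intervalIntegral.integral_congr fun s hs => ?_
  rw [uIcc_of_le ht.1] at hs
  have hts : t - s ∈ Icc 0 T := ⟨by linarith [hs.2], by linarith [hs.1, ht.2]⟩
  simp only [density, S.norm_regularizedInt_mul c hδ hts]

end VPClassicalSolution

namespace VPClassicalSolution

variable {T : ℝ} (S : VPClassicalSolution T)

theorem energy_nonneg : 0 ≤ energy S.f S.ξ S.η 0 := by
  have hr := rho_nonneg S.f_nonneg 0
  have hf := S.f_nonneg 0
  refine mul_nonneg (by norm_num) (integral_nonneg fun p => ?_)
  have h3 : 0 ≤ ∫ x : E3, rho S.f 0 x / ‖x - S.ξ 0‖ :=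
    integral_nonneg fun x => div_nonneg (hr x) (norm_nonneg _)
  have h2 : 0 ≤ ∫ x : E3, ∫ y : E3, (rho S.f 0 x * rho S.f 0 y / ‖x - y‖
      + ∫ x : E3, rho S.f 0 x / ‖x - S.ξ 0‖) :=
    integral_nonneg fun x => integral_nonneg fun y =>
      add_nonneg (div_nonneg (mul_nonneg (hr x) (hr y)) (norm_nonneg _)) h3
  have h1 := mul_nonneg (sq_nonneg ‖p.2‖) (hf p.1 p.2)
  exact add_nonneg (add_nonneg h1 (by positivity)) (mul_nonneg (by norm_num) h2)

theorem sq_add_one_le_hEnergy (x v : E3) :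
    ‖v - S.η 0‖ ^ 2 / 2 + 1 ≤ hEnergy S.f S.ξ S.η 0 x v := by
  have h1 := S.energy_nonneg
  have h2 : 0 ≤ (mass S.f 0)⁻¹ := inv_nonneg.2 (S.mass_nonneg 0)
  have h3 : 0 ≤ ‖x - S.ξ 0‖⁻¹ := inv_nonneg.2 (norm_nonneg _)
  rw [hEnergy]
  linarith

theorem one_le_hEnergy (x v : E3) : 1 ≤ hEnergy S.f S.ξ S.η 0 x v := by
  have h1 := S.sq_add_one_le_hEnergy x v
  have h2 : 0 ≤ ‖v - S.η 0‖ ^ 2 := sq_nonneg _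
  linarith

theorem norm_sub_add_one_le_hEnergy (x v : E3) :
    ‖v - S.η 0‖ + 1 ≤ 2 * hEnergy S.f S.ξ S.η 0 x v ^ (1 / 2 : ℝ) := by
  have h0 := S.one_le_hEnergy x v
  have h1 := S.sq_add_one_le_hEnergy x v
  rw [← Real.sqrt_eq_rpow]
  have hsq : √(hEnergy S.f S.ξ S.η 0 x v) ^ 2 = hEnergy S.f S.ξ S.η 0 x v := Real.sq_sqrt (by linarith)
  refine abs_le_of_sq_le_sq' ?_ (by positivity) |>.2
  nlinarith [sq_nonneg (‖v - S.η 0‖ - 1)]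

theorem measurable_hEnergy : Measurable fun z : E3 × E3 => hEnergy S.f S.ξ S.η 0 z.1 z.2 := by
  unfold hEnergy
  fun_prop

theorem continuous_initial : Continuous fun z : E3 × E3 => S.f 0 z.1 z.2 := by
  have h := S.contDiff_density.continuous.comp (by fun_prop : Continuous fun z : E3 × E3 => ((0 : ℝ), z))
  simpa only [Function.comp_def, density] using h

theorem integrable_slice (t : ℝ) : Integrable fun z : E3 × E3 => S.f t z.1 z.2 := by
  have h1 := S.contDiff_density.continuous.comp (by fun_prop : Continuous fun z : E3 × E3 => (t, z))
  have h2 := S.hasCompactSupport_density.comp_isClosedEmbedding (isClosedEmbedding_prodMk t)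
  exact h1.integrable_of_hasCompactSupport h2

theorem integrable_hEnergy_rpow_mul {k : ℝ} (hk : 0 ≤ k) :
    Integrable fun z : E3 × E3 => hEnergy S.f S.ξ S.η 0 z.1 z.2 ^ (k / 2) * S.f 0 z.1 z.2 := by
  obtain ⟨ε, hε, hf0⟩ := S.f0_vanishes_near_charge
  obtain ⟨A, hA⟩ := S.hasCompactSupport_density.isCompact.exists_bound_of_continuousOn
    (f := fun p : ℝ × E3 × E3 => ‖p.2.2 - S.η 0‖ ^ 2 / 2) (by fun_prop)
  refine ((S.integrable_slice 0).const_mul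
    ((A + ε⁻¹ + energy S.f S.ξ S.η 0 + (mass S.f 0)⁻¹ + 1) ^ (k / 2))).mono'
    ((S.measurable_hEnergy.pow_const _).mul S.continuous_initial.measurable).aestronglyMeasurable
    (Eventually.of_forall fun z => ?_)
  have h1 := S.one_le_hEnergy z.1 z.2
  rw [Real.norm_of_nonneg (mul_nonneg (by positivity) (S.f_nonneg _ _ _))]
  rcases eq_or_ne (S.f 0 z.1 z.2) 0 with h | h
  · rw [h, mul_zero, mul_zero]
  · have hx : ε ≤ ‖z.1 - S.ξ 0‖ := not_lt.1 fun hlt => h (hf0 z.1 z.2 hlt)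
    have h2 : ‖z.1 - S.ξ 0‖⁻¹ ≤ ε⁻¹ := inv_anti₀ hε hx
    have h3 : ‖z.2 - S.η 0‖ ^ 2 / 2 ≤ A :=
      (le_abs_self _).trans (hA (0, z) (subset_tsupport _ (by exact h)))
    refine mul_le_mul_of_nonneg_right (Real.rpow_le_rpow (by linarith) ?_ (by linarith))
      (S.f_nonneg _ _ _)
    rw [hEnergy]
    linarith

theorem mass_le_Htilde {k : ℝ} (hk : 0 ≤ k) : mass S.f 0 ≤ Htilde S.f S.ξ S.η k 0 := by
  refine integral_mono (S.integrable_slice 0) (S.integrable_hEnergy_rpow_mul hk) fun z => ?_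
  exact le_mul_of_one_le_left (S.f_nonneg _ _ _)
    (Real.one_le_rpow (S.one_le_hEnergy _ _) (by linarith))

theorem lintegral_moment_le {k : ℝ} (hk : 0 ≤ k) :
    ∫⁻ z : E3 × E3, ENNReal.ofReal ((‖z.2 - S.η 0‖ + 1) ^ k * S.f 0 z.1 z.2)
      ≤ ENNReal.ofReal (2 ^ k * Htilde S.f S.ξ S.η k 0) := by
  rw [Htilde, ← integral_const_mul, ofReal_integral_eq_lintegral_ofReal
    ((S.integrable_hEnergy_rpow_mul hk).const_mul _) (Eventually.of_forall fun z => ?_)]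
  · refine lintegral_mono fun z => ENNReal.ofReal_le_ofReal ?_
    rw [← mul_assoc]
    refine mul_le_mul_of_nonneg_right ?_ (S.f_nonneg _ _ _)
    have h0 := S.one_le_hEnergy z.1 z.2
    have h1 := Real.rpow_le_rpow (by positivity) (S.norm_sub_add_one_le_hEnergy z.1 z.2) hk
    rwa [Real.mul_rpow (by norm_num) (by positivity), ← Real.rpow_mul (by linarith),
      one_div_mul_eq_div] at h1
  · have h0 := S.one_le_hEnergy z.1 z.2
    have := S.f_nonneg 0 z.1 z.2
    simp only [Pi.zero_apply]
    positivity

theorem initial_le_supf0 (z : E3 × E3) : S.f 0 z.1 z.2 ≤ supf0 S.f := by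
  have hc := S.continuous_initial
  have hcs : HasCompactSupport fun z : E3 × E3 => S.f 0 z.1 z.2 :=
    S.hasCompactSupport_density.comp_isClosedEmbedding (isClosedEmbedding_prodMk 0)
  have hfin : eLpNorm (fun z : E3 × E3 => S.f 0 z.1 z.2) ⊤ volume ≠ ⊤ :=
    (hc.memLp_of_hasCompactSupport hcs).eLpNorm_ne_top
  have hae : ∀ᵐ z : E3 × E3, S.f 0 z.1 z.2 ≤ supf0 S.f := by
    filter_upwards [ae_le_eLpNormEssSup (f := fun z : E3 × E3 => S.f 0 z.1 z.2) (μ := volume)] with z hz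
    rw [← eLpNorm_exponent_top] at hz
    have := ENNReal.toReal_mono hfin hz
    rwa [toReal_enorm, Real.norm_of_nonneg (S.f_nonneg _ _ _)] at this
  have hcl : IsClosed {z : E3 × E3 | S.f 0 z.1 z.2 ≤ supf0 S.f} := isClosed_le hc continuous_const
  have huniv : {z : E3 × E3 | S.f 0 z.1 z.2 ≤ supf0 S.f} = univ := by
    rw [← hcl.closure_eq]
    exact (Measure.dense_of_ae hae).closure_eq
  exact eq_univ_iff_forall.1 huniv z

end VPClassicalSolution

theorem BackwardFlow.lintegral_moment_le {T : ℝ} {S : VPClassicalSolution T} {c : CutoffData} {t : ℝ}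
    (Φ : BackwardFlow T S c t) (ht : t ∈ Icc 0 T) (hm : ∀ τ ∈ Icc 0 T, mass S.f τ ≤ 1) {k : ℝ}
    (hk : 0 ≤ k) :
    ∫⁻ z : E3 × E3, ENNReal.ofReal (‖z.2 - S.η 0‖ ^ k * S.density (0, flowMap Φ.X Φ.V t z))
      ≤ ENNReal.ofReal (2 ^ k * Htilde S.f S.ξ S.η k 0) := by
  have hF := Φ.forcedFlow ht hm
  have hts : t ∈ Icc 0 t := right_mem_Icc.2 ht.1
  have hmp := (hF.measurePreserving_flowMap hts).lintegral_comp_emb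
    (hF.isClosedEmbedding_flowMap hts).measurableEmbedding
    fun z : E3 × E3 => ENNReal.ofReal ((‖z.2 - S.η 0‖ + 1) ^ k * S.f 0 z.1 z.2)
  refine le_trans (lintegral_mono fun z => ENNReal.ofReal_le_ofReal ?_)
    (hmp.trans_le (S.lintegral_moment_le hk))
  refine mul_le_mul_of_nonneg_right (Real.rpow_le_rpow (norm_nonneg _) ?_ hk) (S.density_nonneg _)
  have h1 := (hF.norm_V_sub_le hts z.1 z.2).trans (S.two_mul_inv_Rcut_sq_mul_le c ht)
  have h2 : ‖z.2 - S.η 0‖ ≤ ‖Φ.V t z.1 z.2 - S.η 0‖ + ‖z.2 - Φ.V t z.1 z.2‖ := by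
    have := norm_add_le (Φ.V t z.1 z.2 - S.η 0) (z.2 - Φ.V t z.1 z.2)
    rwa [sub_add_sub_comm, add_comm (Φ.V t z.1 z.2), add_sub_add_right_eq_sub] at this
  rw [norm_sub_rev] at h1
  exact h2.trans (by gcongr; rfl)

theorem exists_eLpNorm_Efield_le {m k Λ : ℝ} (hm : 3 ≤ m) (hk : m < k) (hk2 : k ≤ 2 * m)
    (hΛ : 0 ≤ Λ) :
    ∃ C : ℝ, 0 ≤ C ∧ ∀ {T : ℝ} (S : VPClassicalSolution T), mass S.f 0 ≤ 1 → supf0 S.f ≤ Λ →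
      ∀ {c : CutoffData} {t : ℝ}, t ∈ Icc 0 T → ∀ Φ : BackwardFlow T S c t,
        eLpNorm (Efield S.f t) (ENNReal.ofReal (m + 3)) volume
          ≤ ENNReal.ofReal (C * (1 + 2 ^ k * Htilde S.f S.ξ S.η k 0))
            + ENNReal.ofReal C * eLpNorm (Dterm T S c t Φ) (ENNReal.ofReal (m + 3)) volume := by
  have hpq : (m + 3).HolderConjugate (Real.conjExponent (m + 3)) :=
    Real.HolderConjugate.conjExponent (by linarith)
  have hkr : 2 / 3 < 1 / (m + 3) + 1 - 1 / ((k + 3) / 3) := by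
    have h1 : 3 / (k + 3) < 3 / (m + 3) := by gcongr
    have h2 : 2 / (m + 3) ≤ 1 / 3 := by
      rw [div_le_div_iff₀ (by linarith) (by norm_num)]
      linarith
    have h3 : 3 / (m + 3) = 1 / (m + 3) + 2 / (m + 3) := by ring
    rw [one_div_div]
    linarith
  obtain ⟨C, hC, h⟩ := ForcedFlow.exists_pairing_le hpq (by linarith) (by linarith : 0 < k)
    (by linarith) hkr hΛ
  refine ⟨C, hC, fun {T} S hM hsup {c t} ht Φ => ?_⟩
  have hm1 : ∀ τ ∈ Icc 0 T, mass S.f τ ≤ 1 := fun τ hτ => (S.mass_eq hτ).trans_le hM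
  obtain ⟨δ, hδ0, hδ⟩ := S.exists_pos_forall_eq_zero
  have hF := Φ.forcedFlow ht hm1
  have hH : 0 ≤ Htilde S.f S.ξ S.η k 0 :=
    (S.mass_nonneg 0).trans (S.mass_le_Htilde (by linarith))
  have hV : ∀ τ ∈ Icc 0 t, ∀ z : E3 × E3, fderiv ℝ S.density (τ, z)
      (1, z.2, Eext T S.f c (t - (t - τ)) z.1 + Fext T S.f S.ξ c (t - (t - τ)) z.1
        + S.regularizedInt c δ (τ, z.1)) = 0 := fun τ hτ z => by
    rw [sub_sub_cancel]
    exact S.fderiv_density_apply c hδ hδ0 ⟨hτ.1, hτ.2.trans ht.2⟩ z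
  have hB : 0 ≤ 2 ^ k * Htilde S.f S.ξ S.η k 0 := by positivity
  set N := eLpNorm (Dterm T S c t Φ) (ENNReal.ofReal (m + 3)) volume with hN
  have hdual : eLpNorm (Efield S.f t) (ENNReal.ofReal (m + 3)) volume
      ≤ ENNReal.ofReal (C * (1 + 2 ^ k * Htilde S.f S.ξ S.η k 0) + C * N.toReal) := by
    refine eLpNorm_le_of_dual (by linarith) hpq ?_ (by positivity) fun φ hφ hφc hφ1 => ?_
    · rw [Efield_eq_kernelField]
      exact contDiff_kernelField locallyIntegrable_coulomb S.f_c1 S.f_cpt t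
    · rw [integral_inner_Efield S.f_c1 S.f_cpt hφ hφc]
      exact h hF S.contDiff_density S.hasCompactSupport_density S.density_nonneg
        (S.continuous_regularizedInt c hδ0) hV (S.Dterm_eq c hδ ht Φ)
        (fun z => (S.initial_le_supf0 z).trans hsup) hM hB
        (Φ.lintegral_moment_le ht hm1 (by linarith)) hφ hφc hφ1
  refine hdual.trans ?_
  rw [ENNReal.ofReal_add (by positivity) (by positivity), ENNReal.ofReal_mul (p := C) (q := N.toReal) hC]
  gcongr
  exact ENNReal.ofReal_toReal_le

theorem VPClassicalSolution.Efield_eq_zero_of_mass_eq_zero {T : ℝ} (S : VPClassicalSolution T)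
    (h : mass S.f 0 = 0) {t : ℝ} (ht : t ∈ Icc 0 T) : Efield S.f t = 0 := by
  have hρ : rho S.f t =ᵐ[volume] 0 := by
    rw [← integral_eq_zero_iff_of_nonneg (rho_nonneg S.f_nonneg t)
      (integrable_rho S.f_c1 S.f_cpt t), integral_rho S.f_c1.continuous S.f_cpt, S.mass_eq ht, h]
  funext x
  rw [Efield_eq_kernelField, kernelField]
  refine integral_eq_zero_of_ae (hρ.mono fun y hy => ?_)
  simp [hy]

theorem exists_const_eLpNorm_Efield_le (m Λ : ℝ) (J : ℝ → ℝ) :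
    ∃ C : ℝ, ∀ {T : ℝ} (S : VPClassicalSolution T), mass S.f 0 < 1 → ∀ {c : CutoffData} {t : ℝ},
      t ∈ Icc 0 T → ∀ (Φ : BackwardFlow T S c t) (m₀ : ℝ), 3 ≤ m → m < m₀ → supf0 S.f = Λ →
      (fun k => if k < m₀ then Htilde S.f S.ξ S.η k 0 else 0) = J →
        eLpNorm (Efield S.f t) (ENNReal.ofReal (m + 3)) volume
          ≤ ENNReal.ofReal (C * (1 + T) ^ max (2 : ℝ) (3 * m / (3 + m)))
            + ENNReal.ofReal C * eLpNorm (Dterm T S c t Φ) (ENNReal.ofReal (m + 3)) volume := by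
  by_cases h : 3 ≤ m ∧ 0 ≤ Λ ∧ ∃ k, m < k ∧ k ≤ 2 * m ∧ J k ≠ 0
  · obtain ⟨hm, hΛ, k, hk, hk2, hJ⟩ := h
    obtain ⟨C, hC, hE⟩ := exists_eLpNorm_Efield_le hm hk hk2 hΛ
    refine ⟨C * (1 + 2 ^ k * J k), fun {T} S hM {c t} ht Φ m₀ _ _ hsup hJeq => ?_⟩
    have hk0 : k < m₀ := by
      by_contra hlt
      exact hJ (by rw [← hJeq]; exact if_neg hlt)
    have hJk : J k = Htilde S.f S.ξ S.η k 0 := by rw [← hJeq]; exact if_pos hk0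
    have hH : 0 ≤ Htilde S.f S.ξ S.η k 0 :=
      (S.mass_nonneg 0).trans (S.mass_le_Htilde (by linarith))
    have hT : 1 ≤ (1 + T) ^ max (2 : ℝ) (3 * m / (3 + m)) :=
      Real.one_le_rpow (by linarith [S.T_pos]) (zero_le_two.trans (le_max_left _ _))
    have hB : 0 ≤ 2 ^ k * Htilde S.f S.ξ S.η k 0 := by positivity
    rw [hJk]
    refine (hE S hM.le hsup.le ht Φ).trans (add_le_add (ENNReal.ofReal_le_ofReal ?_) ?_)
    · exact le_mul_of_one_le_right (by positivity) hT
    · gcongr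
      exact le_mul_of_one_le_right hC (by linarith)
  · refine ⟨0, fun {T} S _ {c t} ht Φ m₀ hm hm0 hsup hJeq => ?_⟩
    have hk : m < min (2 * m) ((m + m₀) / 2) := lt_min (by linarith) (by linarith)
    have hk0 : min (2 * m) ((m + m₀) / 2) < m₀ := (min_le_right _ _).trans_lt (by linarith)
    have hJ : J (min (2 * m) ((m + m₀) / 2)) = 0 := by
      by_contra hne
      exact h ⟨hm, hsup ▸ ENNReal.toReal_nonneg, _, hk, min_le_left _ _, hne⟩
    rw [← hJeq] at hJ
    have hH : Htilde S.f S.ξ S.η (min (2 * m) ((m + m₀) / 2)) 0 = 0 := (if_pos hk0).symm.trans hJ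
    have hmass : mass S.f 0 = 0 :=
      le_antisymm ((S.mass_le_Htilde (by linarith)).trans_eq hH) (S.mass_nonneg 0)
    rw [S.Efield_eq_zero_of_mass_eq_zero hmass ht, eLpNorm_zero]
    exact zero_le

/-- Duhamel estimate for `‖E(t)‖_{L^{m+3}}`. -/
theorem statement_14 :
    ∃ C : ℝ → ℝ → ℝ → ℝ → ℝ → (ℝ → ℝ) → ℝ,
      ∀ (T : ℝ) (S : VPClassicalSolution T), mass S.f 0 < 1 →
      ∀ (c : CutoffData) (t : ℝ), t ∈ Icc (0 : ℝ) T →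
      ∀ (Φ : BackwardFlow T S c t) (m₀ m : ℝ), 3 ≤ m → m < m₀ →
        eLpNorm (Efield S.f t) (ENNReal.ofReal (m + 3)) volume
          ≤ ENNReal.ofReal
              (C m (energy S.f S.ξ S.η 0) (mass S.f 0) (supf0 S.f) (1 - mass S.f 0)⁻¹
                  (fun k => if k < m₀ then Htilde S.f S.ξ S.η k 0 else 0)
                * (1 + T) ^ max (2 : ℝ) (3 * m / (3 + m)))
            + ENNReal.ofReal
                (C m (energy S.f S.ξ S.η 0) (mass S.f 0) (supf0 S.f) (1 - mass S.f 0)⁻¹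
                  (fun k => if k < m₀ then Htilde S.f S.ξ S.η k 0 else 0))
              * eLpNorm (Dterm T S c t Φ) (ENNReal.ofReal (m + 3)) volume := by
  choose C hC using exists_const_eLpNorm_Efield_le
  exact ⟨fun m _ _ Λ _ J => C m Λ J, fun T S hM c t ht Φ m₀ m hm hm0 =>
    hC m _ _ S hM ht Φ m₀ hm hm0 rfl rfl⟩

end
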